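/- arXiv:1709.06869 — 12 statements merged into one kernel-verified Lean document; each statement's English description precedes it below -/
import Mathlib

section
/- Let (k₁,…,k_r) be one of the tuples (2,2,2,2), (3,3,3), (2,4,4), (2,3,6), and let A₁,…,A_r be finite multisets of positive integers with every entry of A_j different from k_j, such that the associated almost-regular family has genus 1, i.e. E(n) has genus 1 for every admissible degree n. Assume that, up to reordering the indices j among indices with equal k_j, the pair ((k₁,…,k_r),(A₁,…,A_r)) is none of the following four exceptional families: (2,2,2,2) with ({1,3},∅,∅,∅); (3,3,3) with ({2,4},∅,∅); (2,4,4) with (∅,{3,5},∅); (2,3,6) with (∅,∅,{5,7}). If either the error ε ≤ 6, or (k₁,…,k_r) ∈ {(2,2,2,2),(3,3,3)} and ε ≤ 10, then there exists N such that for every admissible degree n ≥ N the ramification data E(n) is realizable. -/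
/-- The full cycle type of a permutation of a finite set: the multiset of the lengths of its
cycles, where each fixed point counts as a cycle of length 1. -/
def fullCycleType {α : Type*} [Fintype α] [DecidableEq α] (σ : Equiv.Perm α) : Multiset ℕ :=
  σ.cycleType + Multiset.replicate (Fintype.card α - σ.cycleType.sum) 1

/-- The subgroup generated by a set of permutations acts transitively. -/
def IsTransitiveSet {α : Type*} (s : Set (Equiv.Perm α)) : Prop :=
  ∀ x y : α, ∃ g ∈ Subgroup.closure s, g x = y

/-- A ramification data, given as a list of multisets of positive integers (partitions of `n`),
is realizable if there are permutations of `{1,…,n}` with product 1, generating a transitive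
subgroup, whose full cycle types are the given multisets. -/
def Realizable (n : ℕ) (E : List (Multiset ℕ)) : Prop :=
  ∃ σ : List (Equiv.Perm (Fin n)),
    σ.map fullCycleType = E ∧ σ.prod = 1 ∧ IsTransitiveSet {g | g ∈ σ}

/-- `n` is an admissible degree for the almost-regular family with regular parts `k` and
irregular parts `A`: for each `j`, `sum (A j) ≤ n` and `k j ∣ n - sum (A j)`. -/
def Admissible (k : List ℕ) (A : List (Multiset ℕ)) (n : ℕ) : Prop :=
  ∀ p ∈ k.zip A, p.2.sum ≤ n ∧ p.1 ∣ (n - p.2.sum)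

/-- The ramification data of degree `n` of the almost-regular family of type `k` with
irregular entries `A`: the `j`-th partition is `A j` together with `(n - sum (A j))/(k j)`
copies of `k j`. -/
def familyData (k : List ℕ) (A : List (Multiset ℕ)) (n : ℕ) : List (Multiset ℕ) :=
  (k.zip A).map fun p => p.2 + Multiset.replicate ((n - p.2.sum) / p.1) p.1


namespace AlmostRegular

open Equiv Equiv.Perm

section CycleType

variable {α β : Type} [Fintype α] [DecidableEq α] [Fintype β] [DecidableEq β]

theorem cycleType_sumCongr (σ : Perm α) (τ : Perm β) :
    (Perm.sumCongr σ τ).cycleType = σ.cycleType + τ.cycleType := by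
  have hl : (Perm.sumCongr σ (1 : Perm β)).cycleType = σ.cycleType := by
    rw [← cycleType_extendDomain (Equiv.sumIsLeft (α := α) (β := β)).symm (g := σ)]
    refine congrArg _ (Equiv.ext fun x => ?_)
    rcases x with a | b
    · exact (extendDomain_apply_image σ (Equiv.sumIsLeft (α := α) (β := β)).symm a).symm
    · exact (extendDomain_apply_not_subtype σ _ (by simp)).symm
  have hr : (Perm.sumCongr (1 : Perm α) τ).cycleType = τ.cycleType := by
    rw [← cycleType_extendDomain (Equiv.sumIsRight (α := α) (β := β)).symm (g := τ)]
    refine congrArg _ (Equiv.ext fun x => ?_)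
    rcases x with a | b
    · exact (extendDomain_apply_not_subtype τ _ (by simp)).symm
    · exact (extendDomain_apply_image τ (Equiv.sumIsRight (α := α) (β := β)).symm b).symm
  have hd : Perm.Disjoint (Perm.sumCongr σ (1 : Perm β)) (Perm.sumCongr (1 : Perm α) τ) := by
    rintro (a | b) <;> simp
  rw [← hl, ← hr, ← hd.cycleType_mul, Perm.sumCongr_mul, one_mul, mul_one]

theorem fullCycleType_sumCongr (σ : Perm α) (τ : Perm β) :
    fullCycleType (Perm.sumCongr σ τ) = fullCycleType σ + fullCycleType τ := by
  have hσ := sum_cycleType_le σ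
  have hτ := sum_cycleType_le τ
  have h : Fintype.card α + Fintype.card β - (σ.cycleType.sum + τ.cycleType.sum) =
      (Fintype.card α - σ.cycleType.sum) + (Fintype.card β - τ.cycleType.sum) := by omega
  simp only [fullCycleType, cycleType_sumCongr, Multiset.sum_add, Fintype.card_sum, h,
    Multiset.replicate_add]
  exact add_add_add_comm _ _ _ _

theorem fullCycleType_conj (s σ : Perm α) : fullCycleType (s * σ * s⁻¹) = fullCycleType σ := by
  simp only [fullCycleType, cycleType_conj]

theorem fullCycleType_permCongr (e : α ≃ β) (σ : Perm α) :
    fullCycleType (e.permCongrHom σ) = fullCycleType σ := by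
  have h : (e.permCongrHom σ).cycleType = σ.cycleType := by
    rw [← cycleType_extendDomain (e.trans (Equiv.subtypeUnivEquiv (p := fun _ => True)
      (fun _ => trivial)).symm) (g := σ)]
    refine congrArg _ (Equiv.ext fun x => ?_)
    rw [extendDomain_apply_subtype _ _ trivial]
    rfl
  simp only [fullCycleType, h, Fintype.card_congr e]

/-- The permutation of `Fin (m + 1)` given by a list of cycles. -/
def ofCycles (m : ℕ) (L : List (List ℕ)) : Perm (Fin (m + 1)) :=
  (L.map fun l => (l.map (Fin.ofNat (m + 1))).formPerm).prod

/-- The lists in `L` are nonempty and contain every element of `Fin (m + 1)` exactly once. -/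
def IsCycleList (m : ℕ) (L : List (List ℕ)) : Prop :=
  (L.flatten.map (Fin.ofNat (m + 1))).Nodup ∧ L.flatten.length = m + 1 ∧ [] ∉ L

theorem cycleType_prod_formPerm (L : List (List α)) (hL : L.flatten.Nodup) :
    (L.map List.formPerm).prod.cycleType = ((L.map List.length).filter (2 ≤ ·) : List ℕ) := by
  induction L with
  | nil => simp
  | cons l L ih =>
    rw [List.flatten_cons, List.nodup_append] at hL
    obtain ⟨hl, hL', hd⟩ := hL
    have hdis : Perm.Disjoint l.formPerm (L.map List.formPerm).prod := by
      intro x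
      by_cases hx : x ∈ l
      · right
        have : ∀ σ ∈ L.map List.formPerm, σ x = x := by
          intro σ hσ
          obtain ⟨l', hl', rfl⟩ := List.mem_map.1 hσ
          exact List.formPerm_apply_of_notMem fun h =>
            hd x hx x (List.mem_flatten.2 ⟨l', hl', h⟩) rfl
        generalize L.map List.formPerm = M at this
        induction M with
        | nil => rfl
        | cons σ M ihM =>
          rw [List.prod_cons, mul_apply, ihM fun σ h => this σ (List.mem_cons_of_mem _ h)]
          exact this σ List.mem_cons_self
      · exact Or.inl (List.formPerm_apply_of_notMem hx)
    rw [List.map_cons, List.prod_cons, hdis.cycleType_mul, ih hL', List.map_cons]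
    by_cases h2 : 2 ≤ l.length
    · have hs : l.formPerm.support.card = l.length := by
        rw [List.support_formPerm_of_nodup l hl (fun x h => by simp [h] at h2),
          List.toFinset_card_of_nodup hl]
      rw [(List.isCycle_formPerm hl h2).cycleType, hs, List.filter_cons_of_pos (by simpa using h2)]
      rfl
    · rw [List.filter_cons_of_neg (by simpa using h2),
        (List.formPerm_eq_one_iff l hl).2 (by omega)]
      simp

theorem filter_add_replicate_one (L : List ℕ) (hL : 0 ∉ L) :
    ((L.filter (2 ≤ ·) : List ℕ) : Multiset ℕ) +
      Multiset.replicate (L.sum - (L.filter (2 ≤ ·)).sum) 1 = (L : Multiset ℕ) ∧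
      (L.filter (2 ≤ ·)).sum ≤ L.sum := by
  induction L with
  | nil => simp
  | cons a L ih =>
    obtain ⟨ih, hle⟩ := ih fun h => hL (List.mem_cons_of_mem _ h)
    have ha : a ≠ 0 := fun h => hL (h ▸ List.mem_cons_self)
    by_cases h2 : 2 ≤ a
    · rw [List.filter_cons_of_pos (by simpa using h2), List.sum_cons, List.sum_cons]
      refine ⟨?_, by omega⟩
      rw [Nat.add_sub_add_left, ← Multiset.cons_coe, ← Multiset.cons_coe, Multiset.cons_add, ih]
    · obtain rfl : a = 1 := by omega
      rw [List.filter_cons_of_neg (by simp), List.sum_cons]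
      refine ⟨?_, by omega⟩
      rw [show 1 + L.sum - (L.filter (2 ≤ ·)).sum = L.sum - (L.filter (2 ≤ ·)).sum + 1 by omega,
        Multiset.replicate_succ, Multiset.add_cons, ih, Multiset.cons_coe]

theorem fullCycleType_ofCycles {m : ℕ} {L : List (List ℕ)} (hL : IsCycleList m L) :
    fullCycleType (ofCycles m L) = (L.map List.length : List ℕ) := by
  obtain ⟨hnd, hlen, hne⟩ := hL
  have h := cycleType_prod_formPerm (L.map (List.map (Fin.ofNat (m + 1))))
    (by rwa [← List.map_flatten])
  rw [List.map_map, List.map_map] at h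
  have hlen' : (List.length ∘ List.map (Fin.ofNat (m + 1))) = (List.length : List ℕ → ℕ) := by
    ext l; simp
  rw [hlen'] at h
  have h0 : 0 ∉ L.map List.length := by
    intro h0
    obtain ⟨l, hl, h0⟩ := List.mem_map.1 h0
    exact hne (List.length_eq_zero_iff.1 h0 ▸ hl)
  rw [List.length_flatten] at hlen
  have h' : (ofCycles m L).cycleType = _ := h
  rw [fullCycleType, Fintype.card_fin, h', Multiset.sum_coe, ← hlen]
  exact (filter_add_replicate_one _ h0).1

end CycleType

section Splice

variable {α β : Type}

/-- The permutations in `S` generate a transitive group, phrased through invariant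
equivalence relations. -/
def Connected (S : List (Perm α)) : Prop :=
  ∀ r : Setoid α, (∀ g ∈ S, ∀ x, r x (g x)) → ∀ x y, r x y

theorem Connected.isTransitiveSet {S T : List (Perm α)} (hS : Connected S) (h : S ⊆ T) :
    IsTransitiveSet {g | g ∈ T} := by
  intro x y
  have := hS (MulAction.orbitRel (Subgroup.closure {g | g ∈ T}) α) (fun g hg a => by
    refine (MulAction.orbitRel _ α).symm (MulAction.orbitRel_apply.2 ?_)
    exact ⟨⟨g, Subgroup.subset_closure (h hg)⟩, rfl⟩) y x
  obtain ⟨g, hg⟩ := MulAction.orbitRel_apply.1 this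
  exact ⟨g, g.2, hg⟩

/-- Places at which a pair of permutations can be spliced with another such pair: a `2`-cycle of
`E` undone by `F`, or a point at which `E` and `F` commute in general position. -/
def Site (twoCycle : Bool) (E F : Perm α) : Prop :=
  if twoCycle then ∃ z, F (E z) = z ∧ E z ≠ z
  else ∃ z, E (F z) = F (E z) ∧ [z, E z, F z, E (F z)].Nodup

/-- The condition on a pair of permutations to be spliced into a pair satisfying `Site`. -/
def WeakSite (twoCycle : Bool) (E F : Perm α) : Prop :=
  if twoCycle then ∃ z, F (E z) = z ∧ E z ≠ z
  else ∃ z, E (F z) = F (E z) ∧ [z, F z, E (F z)].Nodup ∧ E z ≠ z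

/-- The pairs `(E, F)` and `(E₂, F₂)` can be glued to a pair on the disjoint union by conjugating
with `s` and `u` without changing the product, and `s` links the two parts. -/
structure Splices (E F : Perm α) (E₂ F₂ : Perm β) (s u : Perm (α ⊕ β)) : Prop where
  mul_eq : s * Perm.sumCongr E E₂ * s⁻¹ * (u * Perm.sumCongr F F₂ * u⁻¹) =
    Perm.sumCongr E E₂ * Perm.sumCongr F F₂
  link : ∃ a b, s (.inl a) = .inr b
  rel : ∀ r : Setoid (α ⊕ β), (∀ x, r (s x) (s (Perm.sumCongr E E₂ x))) →
    (∀ b b', r (.inr b) (.inr b')) → ∀ x, r (s x) x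

theorem Splices.connected {E F : Perm α} {E₂ F₂ : Perm β} {s u : Perm (α ⊕ β)}
    (h : Splices E F E₂ F₂ s u) {Ps : List (Perm α)} {Qs : List (Perm β)}
    (hlen : Ps.length = Qs.length) (hP : Connected (E :: Ps)) (hQ : Connected Qs) :
    Connected (s * Perm.sumCongr E E₂ * s⁻¹ :: List.zipWith Perm.sumCongr Ps Qs) := by
  intro r hr
  have hzip : ∀ i (hi : i < Ps.length), ∀ x, r x (Perm.sumCongr Ps[i] (Qs[i]'(hlen ▸ hi)) x) := by
    intro i hi
    refine hr _ (List.mem_cons_of_mem _ (List.mem_iff_getElem.2 ⟨i, ?_, ?_⟩))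
    · simpa using ⟨hi, hlen ▸ hi⟩
    · simp
  have hb : ∀ b b', r (.inr b) (.inr b') := by
    refine hQ (r.comap Sum.inr) fun g hg b => ?_
    obtain ⟨i, hi, rfl⟩ := List.mem_iff_getElem.1 hg
    simpa [Setoid.comap_rel] using hzip i (hlen ▸ hi) (.inr b)
  have hE : ∀ x, r (s x) (s (Perm.sumCongr E E₂ x)) := by
    intro x
    simpa using hr _ List.mem_cons_self (s x)
  have hs := h.rel r hE hb
  have ha : ∀ a a', r (.inl a) (.inl a') := by
    refine hP (r.comap Sum.inl) fun g hg a => ?_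
    rw [Setoid.comap_rel]
    rcases List.mem_cons.1 hg with rfl | hg
    · exact r.trans (r.symm (hs _)) (r.trans (hE (.inl a)) (hs _))
    · obtain ⟨i, hi, rfl⟩ := List.mem_iff_getElem.1 hg
      simpa using hzip i hi (.inl a)
  obtain ⟨a₀, b₀, h₀⟩ := h.link
  have hab : r (.inl a₀) (.inr b₀) := h₀ ▸ r.symm (hs (.inl a₀))
  have habs : ∀ a b, r (.inl a) (.inr b) := fun a b =>
    r.trans (ha a a₀) (r.trans hab (hb b₀ b))
  rintro (a | b) (a' | b')
  · exact ha a a'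
  · exact habs a b'
  · exact r.symm (habs a' b)
  · exact hb b b'

variable [DecidableEq α] [DecidableEq β]

theorem rel_swap (r : Setoid α) {a b : α} (h : r a b) (x : α) : r (swap a b x) x := by
  rw [swap_apply_def]
  split_ifs with ha hb
  · exact ha ▸ r.symm h
  · exact hb ▸ h
  · exact r.refl x

/-- The transposition exchanging a point of `α` with a point of `β`. -/
abbrev bridge (a : α) (b : β) : Perm (α ⊕ β) := swap (.inl a) (.inr b)

theorem sumCongr_mul_bridge (σ : Perm α) (τ : Perm β) (a : α) (b : β) :
    Perm.sumCongr σ τ * bridge a b = bridge (σ a) (τ b) * Perm.sumCongr σ τ := by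
  rw [bridge, bridge, mul_swap_eq_swap_mul]
  rfl

theorem bridge_commute {a a' : α} {b b' : β} (ha : a ≠ a') (hb : b ≠ b') :
    Commute (bridge a b) (bridge a' b') := by
  refine (Perm.disjoint_iff_eq_or_eq.2 fun x => ?_).commute
  rcases x with x | x
  · by_cases h : x = a
    · right; subst h; exact swap_apply_of_ne_of_ne (by simpa using ha) (by simp)
    · left; exact swap_apply_of_ne_of_ne (by simpa using h) (by simp)
  · by_cases h : x = b
    · right; subst h; exact swap_apply_of_ne_of_ne (by simp) (by simpa using hb)
    · left; exact swap_apply_of_ne_of_ne (by simp) (by simpa using h)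

theorem exists_splices_of_twoCycle {E F : Perm α} {E₂ F₂ : Perm β} (h : Site true E F)
    (h₂ : WeakSite true E₂ F₂) : ∃ s u, Splices E F E₂ F₂ s u ∧
      Site true (s * Perm.sumCongr E E₂ * s⁻¹) (u * Perm.sumCongr F F₂ * u⁻¹) := by
  obtain ⟨z, hz, hne⟩ := h
  obtain ⟨z', hz', hne'⟩ := h₂
  have hEv : E₂ (E₂ z') ≠ E₂ z' := fun h => hne' (E₂.injective h)
  set s := bridge (E z) (E₂ z') with hs
  have hG : Perm.sumCongr E E₂ * bridge z z' = s * Perm.sumCongr E E₂ := sumCongr_mul_bridge ..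
  have hH : Perm.sumCongr F F₂ * s = bridge z z' * Perm.sumCongr F F₂ := by
    rw [hs, sumCongr_mul_bridge, hz, hz']
  have hss : s * s = 1 := swap_mul_self _ _
  refine ⟨s, s, ⟨?_, ⟨E z, E₂ z', by simp [hs]⟩, ?_⟩, ?_⟩
  · have : s⁻¹ = s := swap_inv _ _
    rw [this]
    calc s * Perm.sumCongr E E₂ * s * (s * Perm.sumCongr F F₂ * s)
        = s * Perm.sumCongr E E₂ * (s * s) * (Perm.sumCongr F F₂ * s) := by group
      _ = s * (Perm.sumCongr E E₂ * bridge z z') * Perm.sumCongr F F₂ := by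
        rw [hss, hH]; group
      _ = (s * s) * Perm.sumCongr E E₂ * Perm.sumCongr F F₂ := by rw [hG]; group
      _ = _ := by rw [hss, one_mul]
  · intro r hr hb x
    have hlink : r (.inl (E z)) (.inr (E₂ z')) := by
      have := hr (.inr (E₂ z'))
      rw [Perm.sumCongr_apply, Sum.map_inr, hs, swap_apply_right,
        swap_apply_of_ne_of_ne (by simp) (by simpa using hEv)] at this
      exact r.trans this (hb _ _)
    exact rel_swap r hlink x
  · rw [Site, if_pos rfl]
    refine ⟨.inr z', ?_, ?_⟩
    all_goals simp [hs, swap_apply_def, Ne.symm hne', hz']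

theorem mul_eq_of_braid {G : Type} [Group G] {g h a b c d : G} (ha : a * a = 1) (hb : b * b = 1)
    (hc : c * c = 1) (hd : d * d = 1) (hbc : Commute b c) (hbd : Commute b d) (hcd : Commute c d)
    (hgc : g * c = b * g) (hgd : g * d = a * g) (hha : h * a = b * h) (hhd : h * d = c * h) :
    a * b * g * (a * b)⁻¹ * (a * d * h * (a * d)⁻¹) = g * h := by
  have ha' : a⁻¹ = a := inv_eq_of_mul_eq_one_left ha
  have hb' : b⁻¹ = b := inv_eq_of_mul_eq_one_left hb
  have hd' : d⁻¹ = d := inv_eq_of_mul_eq_one_left hd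
  calc a * b * g * (a * b)⁻¹ * (a * d * h * (a * d)⁻¹)
      = a * (b * g) * b * (a * a) * d * (h * d) * a := by
        rw [mul_inv_rev, mul_inv_rev, ha', hb', hd']; group
    _ = (a * g) * c * b * d * c * (h * a) := by rw [← hgc, ha, hhd]; group
    _ = g * d * (c * b) * (d * c) * b * h := by rw [← hgd, hha]; group
    _ = g * (d * b) * (c * c) * d * b * h := by rw [← hbc.eq, ← hcd.eq]; group
    _ = g * b * (d * d) * b * h := by rw [← hbd.eq, hc]; group
    _ = g * (b * b) * h := by rw [hd]; group
    _ = g * h := by rw [hb, mul_one]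

theorem exists_splices_of_square {E F : Perm α} {E₂ F₂ : Perm β} (h : Site false E F)
    (h₂ : WeakSite false E₂ F₂) : ∃ s u, Splices E F E₂ F₂ s u ∧
      Site false (s * Perm.sumCongr E E₂ * s⁻¹) (u * Perm.sumCongr F F₂ * u⁻¹) := by
  rw [Site, if_neg (by simp)] at h
  rw [WeakSite, if_neg (by simp)] at h₂
  obtain ⟨d, hEF, hnd⟩ := h
  obtain ⟨d', hEF', hnd', had'⟩ := h₂
  generalize ha : E d = a at *
  generalize hc : F d = c at *
  generalize hb : E c = b at *
  generalize ha' : E₂ d' = a' at *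
  generalize hc' : F₂ d' = c' at *
  generalize hb' : E₂ c' = b' at *
  simp only [List.nodup_cons, List.mem_cons, List.not_mem_nil, or_false, not_or,
    List.nodup_nil, and_true, not_false_eq_true] at hnd hnd'
  obtain ⟨⟨hda, hdc, hdb⟩, ⟨hac, hab⟩, hcb⟩ := hnd
  obtain ⟨⟨hdc', hdb'⟩, hcb'⟩ := hnd'
  have hab' : a' ≠ b' := fun h => hdc' (E₂.injective (by rw [ha', hb', h]))
  have hsw : ∀ a b, bridge (α := α) (β := β) a b * bridge a b = 1 := fun _ _ => swap_mul_self _ _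
  refine ⟨bridge a a' * bridge b b', bridge a a' * bridge d d', ⟨?_, ⟨b, b', ?_⟩, ?_⟩, ?_⟩
  · refine mul_eq_of_braid (c := bridge c c') (hsw _ _) (hsw _ _) (hsw _ _) (hsw _ _)
      (bridge_commute (Ne.symm hcb) (Ne.symm hcb')) (bridge_commute (Ne.symm hdb) (Ne.symm hdb'))
      (bridge_commute (Ne.symm hdc) (Ne.symm hdc')) ?_ ?_ ?_ ?_
    all_goals simp only [sumCongr_mul_bridge, ha, ha', hb, hb', hc, hc', ← hEF, ← hEF']
  · simp [swap_apply_def, hab'.symm]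
  · intro r hr hβ
    have h₁ : r (.inl a) (.inr d') := by
      have := hr (.inr d')
      simp [ha', hdb', Ne.symm had', swap_apply_def, hab'] at this
      exact r.symm this
    have h₂ : r (.inl b) (.inr d') := by
      have := hr (.inr c')
      simp [hb', hcb', swap_apply_def, Ne.symm hab] at this
      by_cases hca : c' = a'
      · simp [hca] at this
        exact r.trans (r.symm this) h₁
      · simp [hca] at this
        exact r.trans (r.symm this) (hβ _ _)
    intro x
    exact r.trans (rel_swap r (r.trans h₁ (hβ _ _)) _) (rel_swap r (r.trans h₂ (hβ _ _)) x)
  · rw [Site, if_neg (by simp)]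
    have e₁ : (bridge a a' * bridge b b' * Perm.sumCongr E E₂ * (bridge a a' * bridge b b')⁻¹)
        (.inr d') = .inl a := by
      simp [swap_apply_def, hdb', Ne.symm had', hab', ha']
    have e₂ : (bridge a a' * bridge d d' * Perm.sumCongr F F₂ * (bridge a a' * bridge d d')⁻¹)
        (.inr d') = .inl c := by
      simp [swap_apply_def, Ne.symm had', Ne.symm hac, Ne.symm hdc, hc]
    have e₃ : (bridge a a' * bridge d d' * Perm.sumCongr F F₂ * (bridge a a' * bridge d d')⁻¹)
        (.inl a) = .inr b' := by
      simp [swap_apply_def, had', Ne.symm hab', Ne.symm hdb', ← hEF']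
    have e₄ : (bridge a a' * bridge b b' * Perm.sumCongr E E₂ * (bridge a a' * bridge b b')⁻¹)
        (.inl c) = .inr b' := by
      simp [swap_apply_def, Ne.symm hac, hcb, hb, Ne.symm hab']
    refine ⟨.inr d', ?_, ?_⟩
    · rw [e₁, e₂, e₃, e₄]
    · rw [e₁, e₂, e₄]
      simp [hac, hdb']

theorem exists_splices {b : Bool} {E F : Perm α} {E₂ F₂ : Perm β} (h : Site b E F)
    (h₂ : WeakSite b E₂ F₂) : ∃ s u, Splices E F E₂ F₂ s u ∧
      Site b (s * Perm.sumCongr E E₂ * s⁻¹) (u * Perm.sumCongr F F₂ * u⁻¹) := by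
  cases b
  · exact exists_splices_of_square h h₂
  · exact exists_splices_of_twoCycle h h₂

end Splice

section Realizable

/-- The partition of degree `n` of an almost-regular family with regular part `p.1` and irregular
parts `p.2`. -/
def familyPart (n : ℕ) (p : ℕ × Multiset ℕ) : Multiset ℕ :=
  p.2 + Multiset.replicate ((n - p.2.sum) / p.1) p.1

theorem familyPart_add {n t : ℕ} {p : ℕ × Multiset ℕ} (hn : p.2.sum ≤ n) (ht : p.1 ∣ t) :
    familyPart n p + familyPart t (p.1, 0) = familyPart (n + t) p := by
  simp only [familyPart, Multiset.sum_zero, Nat.sub_zero, zero_add]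
  rw [add_assoc, ← Multiset.replicate_add, show n + t - p.2.sum = n - p.2.sum + t by omega,
    Nat.add_div_of_dvd_left ht]

/-- A list of permutations followed by two permutations with a `Site` realizes the given data. -/
def Glueable (b : Bool) (n : ℕ) (L : List (Multiset ℕ)) (e f : Multiset ℕ) : Prop :=
  ∃ (α : Type) (_ : Fintype α) (_ : DecidableEq α) (Ps : List (Perm α)) (E F : Perm α),
    Fintype.card α = n ∧ Ps.map fullCycleType = L ∧ fullCycleType E = e ∧ fullCycleType F = f ∧
      Ps.prod * E * F = 1 ∧ Connected (E :: Ps) ∧ Site b E F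

/-- A piece which can be spliced into any data satisfying `Glueable`. -/
def IsTile (b : Bool) (n : ℕ) (L : List (Multiset ℕ)) (e f : Multiset ℕ) : Prop :=
  ∃ (α : Type) (_ : Fintype α) (_ : DecidableEq α) (Ps : List (Perm α)) (E F : Perm α),
    Fintype.card α = n ∧ Ps.map fullCycleType = L ∧ fullCycleType E = e ∧ fullCycleType F = f ∧
      Ps.prod * E * F = 1 ∧ Connected Ps ∧ WeakSite b E F

theorem prod_zipWith_sumCongr {α β : Type} (Ps : List (Perm α)) (Qs : List (Perm β))
    (h : Ps.length = Qs.length) :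
    (List.zipWith Perm.sumCongr Ps Qs).prod = Perm.sumCongr Ps.prod Qs.prod := by
  induction Ps generalizing Qs with
  | nil => cases Qs <;> simp_all
  | cons P Ps ih =>
    cases Qs with
    | nil => simp at h
    | cons Q Qs =>
      simp only [List.zipWith_cons_cons, List.prod_cons, ih Qs (by simpa using h),
        Perm.sumCongr_mul]

theorem map_fullCycleType_zipWith {α β : Type} [Fintype α] [DecidableEq α] [Fintype β]
    [DecidableEq β] (Ps : List (Perm α)) (Qs : List (Perm β)) :
    (List.zipWith Perm.sumCongr Ps Qs).map fullCycleType =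
      List.zipWith (· + ·) (Ps.map fullCycleType) (Qs.map fullCycleType) := by
  simp only [List.map_zipWith, List.zipWith_map, fullCycleType_sumCongr]

theorem Glueable.add {b : Bool} {n t : ℕ} {L M : List (Multiset ℕ)} {e f e' f' : Multiset ℕ}
    (h : Glueable b n L e f) (h' : IsTile b t M e' f') (hLM : L.length = M.length) :
    Glueable b (n + t) (List.zipWith (· + ·) L M) (e + e') (f + f') := by
  obtain ⟨α, _, _, Ps, E, F, rfl, rfl, rfl, rfl, hprod, hcon, hsite⟩ := h
  obtain ⟨β, _, _, Qs, E₂, F₂, rfl, rfl, rfl, rfl, hprod', hcon', hsite'⟩ := h'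
  have hlen : Ps.length = Qs.length := by simpa using hLM
  obtain ⟨s, u, hsu, hnew⟩ := exists_splices hsite hsite'
  refine ⟨α ⊕ β, inferInstance, inferInstance, List.zipWith Perm.sumCongr Ps Qs, _, _,
    Fintype.card_sum, map_fullCycleType_zipWith Ps Qs, ?_, ?_, ?_,
    hsu.connected hlen hcon hcon', hnew⟩
  · rw [fullCycleType_conj, fullCycleType_sumCongr]
  · rw [fullCycleType_conj, fullCycleType_sumCongr]
  · rw [mul_assoc, hsu.mul_eq, prod_zipWith_sumCongr _ _ hlen, Perm.sumCongr_mul,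
      Perm.sumCongr_mul, ← mul_assoc, ← mul_assoc, hprod, hprod', Perm.sumCongr_one]

theorem Glueable.realizable {b : Bool} {n : ℕ} {L : List (Multiset ℕ)} {e f : Multiset ℕ}
    (h : Glueable b n L e f) : Realizable n (L ++ [e, f]) := by
  obtain ⟨α, _, _, Ps, E, F, hcard, rfl, rfl, rfl, hprod, hcon, -⟩ := h
  let φ := (Fintype.equivFinOfCardEq hcard).permCongrHom
  refine ⟨(Ps ++ [E, F]).map φ, ?_, ?_, ?_⟩
  · have hφ : fullCycleType ∘ φ = fullCycleType := funext (fullCycleType_permCongr _)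
    rw [List.map_map, hφ]
    simp
  · rw [← map_list_prod, List.prod_append, List.prod_cons, List.prod_singleton, ← mul_assoc,
      hprod, map_one]
  · refine Connected.isTransitiveSet (S := (E :: Ps).map φ) (fun r hr x y => ?_) ?_
    · have := hcon (r.comap (Fintype.equivFinOfCardEq hcard)) (fun g hg a => ?_)
        ((Fintype.equivFinOfCardEq hcard).symm x) ((Fintype.equivFinOfCardEq hcard).symm y)
      · simpa [Setoid.comap_rel] using this
      · simpa [Setoid.comap_rel, φ] using
          hr _ (List.mem_map_of_mem hg) (Fintype.equivFinOfCardEq hcard a)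
    · exact List.map_subset _ fun g hg => by
        rcases List.mem_cons.1 hg with rfl | hg <;> simp [*]

theorem exists_rearrangement {α : Type} [Fintype α] [DecidableEq α] {L L' : List (Multiset ℕ)}
    (h : L.Perm L') (σ : List (Perm α)) (hσ : σ.map fullCycleType = L) :
    ∃ σ' : List (Perm α), σ'.map fullCycleType = L' ∧ σ'.prod = σ.prod ∧
      ∀ H : Subgroup (Perm α), (∀ g ∈ σ', g ∈ H) ↔ ∀ g ∈ σ, g ∈ H := by
  induction h generalizing σ with
  | nil => exact ⟨σ, hσ, rfl, fun _ => Iff.rfl⟩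
  | cons a _ ih =>
    obtain ⟨g, τ, rfl, hg, hτ⟩ := List.map_eq_cons_iff.1 hσ
    obtain ⟨τ', h₁, h₂, h₃⟩ := ih τ hτ
    exact ⟨g :: τ', by simp [h₁, hg], by simp [h₂], fun H => by simp [h₃ H]⟩
  | swap a b l =>
    obtain ⟨g, τ, rfl, hg, hτ⟩ := List.map_eq_cons_iff.1 hσ
    obtain ⟨g', τ', rfl, hg', hτ'⟩ := List.map_eq_cons_iff.1 hτ
    refine ⟨g * g' * g⁻¹ :: g :: τ', ?_, by simp [mul_assoc], fun H => ?_⟩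
    · simp [fullCycleType_conj, hg, hg', hτ']
    · simp only [List.forall_mem_cons]
      constructor
      · rintro ⟨h₁, h₂, h₃⟩
        refine ⟨h₂, ?_, h₃⟩
        simpa [mul_assoc] using H.mul_mem (H.mul_mem (H.inv_mem h₂) h₁) h₂
      · rintro ⟨h₁, h₂, h₃⟩
        exact ⟨H.mul_mem (H.mul_mem h₁ h₂) (H.inv_mem h₁), h₁, h₃⟩
  | trans _ _ ih₁ ih₂ =>
    obtain ⟨τ, h₁, h₂, h₃⟩ := ih₁ σ hσ
    obtain ⟨τ', h₁', h₂', h₃'⟩ := ih₂ τ h₁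
    exact ⟨τ', h₁', h₂'.trans h₂, fun H => (h₃' H).trans (h₃ H)⟩

theorem _root_.Realizable.perm {n : ℕ} {L L' : List (Multiset ℕ)} (hL : Realizable n L)
    (h : L.Perm L') : Realizable n L' := by
  obtain ⟨σ, hσ, hprod, htrans⟩ := hL
  obtain ⟨σ', h₁, h₂, h₃⟩ := exists_rearrangement h σ hσ
  refine ⟨σ', h₁, h₂.trans hprod, fun x y => ?_⟩
  obtain ⟨g, hg, hxy⟩ := htrans x y
  refine ⟨g, ?_, hxy⟩
  have := (h₃ (Subgroup.closure {g | g ∈ σ'})).1 fun g hg => Subgroup.subset_closure hg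
  exact (Subgroup.closure_le _).2 this hg

/-- The almost-regular family given by the pairs in `Z` is realizable in all large admissible
degrees. -/
def EventuallyRealizable (Z : List (ℕ × Multiset ℕ)) : Prop :=
  ∃ N, ∀ n ≥ N, (∀ p ∈ Z, p.2.sum ≤ n ∧ p.1 ∣ n - p.2.sum) → Realizable n (Z.map (familyPart n))

theorem EventuallyRealizable.perm {Z Z' : List (ℕ × Multiset ℕ)} (hZ : EventuallyRealizable Z)
    (h : Z.Perm Z') : EventuallyRealizable Z' := by
  obtain ⟨N, hN⟩ := hZ
  exact ⟨N, fun n hn hadm => (hN n hn fun p hp => hadm p (h.subset hp)).perm (h.map _)⟩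

theorem Glueable.eventuallyRealizable {b : Bool} {n t : ℕ} {K : List (ℕ × Multiset ℕ)}
    {p q : ℕ × Multiset ℕ}
    (h : Glueable b n (K.map (familyPart n)) (familyPart n p) (familyPart n q))
    (ht : IsTile b t (K.map fun x => familyPart t (x.1, 0)) (familyPart t (p.1, 0))
      (familyPart t (q.1, 0)))
    (hadm : ∀ x ∈ K ++ [p, q], x.2.sum ≤ n ∧ x.1 ∣ n - x.2.sum ∧ x.1 ∣ t)
    (hmem : ∃ x ∈ K ++ [p, q], x.1 = t) : EventuallyRealizable (K ++ [p, q]) := by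
  have hsum : ∀ x ∈ K ++ [p, q], ∀ m, familyPart (n + m * t) x + familyPart t (x.1, 0) =
      familyPart (n + (m + 1) * t) x := fun x hx m => by
    rw [familyPart_add ((hadm x hx).1.trans (Nat.le_add_right _ _)) (hadm x hx).2.2, add_assoc,
      Nat.succ_mul]
  have key : ∀ m, Glueable b (n + m * t) (K.map (familyPart (n + m * t)))
      (familyPart (n + m * t) p) (familyPart (n + m * t) q) := by
    intro m
    induction m with
    | zero => simpa using h
    | succ m ih =>
      have := ih.add ht (by simp)
      rw [hsum p (by simp), hsum q (by simp), List.zipWith_map, List.zipWith_self, add_assoc,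
        ← Nat.succ_mul] at this
      convert this using 1
      exact List.map_congr_left fun x hx => (hsum x (by simp [hx]) m).symm
  refine ⟨n, fun N hN hadmN => ?_⟩
  obtain ⟨x, hx, rfl⟩ := hmem
  obtain ⟨h₁, h₂, -⟩ := hadm x hx
  obtain ⟨-, h₄⟩ := hadmN x hx
  obtain ⟨m, hm⟩ : x.1 ∣ N - n := by
    have := Nat.dvd_sub h₄ h₂
    rwa [show N - x.2.sum - (n - x.2.sum) = N - n by omega] at this
  obtain rfl : N = n + m * x.1 := by rw [mul_comm, ← hm]; omega
  simpa using (key m).realizable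

end Realizable

section Certificate

/-- A regular part `k` together with the cycles of a permutation. -/
abbrev MarkedCycles := ℕ × List (List ℕ)

/-- Replaces the list of irregular parts by the multiset. -/
def toPair (p : ℕ × List ℕ) : ℕ × Multiset ℕ := (p.1, p.2)

/-- Explicit permutations of `Fin (top + 1)` realizing one member of an almost-regular family of
type given by the first components. -/
structure Certificate where
  top : ℕ
  kept : List MarkedCycles
  e : MarkedCycles
  f : MarkedCycles

namespace Certificate

variable (c : Certificate)

/-- All the permutations of the certificate, given by their cycles. -/
def cycles : List MarkedCycles := c.kept ++ [c.e, c.f]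

/-- The permutation of `Fin (c.top + 1)` with the given cycles. -/
def perm (x : MarkedCycles) : Perm (Fin (c.top + 1)) := ofCycles c.top x.2

/-- The pair of the regular part and the list of irregular parts. -/
def key (x : MarkedCycles) : ℕ × List ℕ := (x.1, (x.2.map List.length).filter (· ≠ x.1))

/-- The cycle lists are well-formed and the product of the permutations is trivial. -/
def WellFormed : Prop :=
  (∀ x ∈ c.cycles, 0 < x.1 ∧ IsCycleList c.top x.2) ∧
    ∀ i, (c.kept.map c.perm).prod (c.perm c.e (c.perm c.f i)) = i

/-- Every nonzero element is mapped to a smaller one by some element of `S`. -/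
def Descends {m : ℕ} (S : List (Perm (Fin (m + 1)))) : Prop :=
  ∀ i, i ≠ 0 → ∃ g ∈ S, g i < i

/-- The certificate gives a tile of the smallest degree, with all parts regular. -/
def ValidTile (b : Bool) : Prop :=
  c.WellFormed ∧ Descends (c.kept.map c.perm) ∧ WeakSite b (c.perm c.e) (c.perm c.f) ∧
    (∀ x ∈ c.cycles, x.1 ∣ c.top + 1 ∧ (key x).2 = []) ∧ ∃ x ∈ c.cycles, x.1 = c.top + 1

/-- The certificate gives permutations into which tiles can be spliced. -/
def Valid (b : Bool) : Prop :=
  c.WellFormed ∧ Descends ((c.e :: c.kept).map c.perm) ∧ Site b (c.perm c.e) (c.perm c.f)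

instance (m : ℕ) (L : List (List ℕ)) : Decidable (IsCycleList m L) :=
  inferInstanceAs (Decidable (_ ∧ _))

instance : Decidable c.WellFormed := inferInstanceAs (Decidable (_ ∧ _))

instance {m : ℕ} (S : List (Perm (Fin (m + 1)))) : Decidable (Descends S) :=
  inferInstanceAs (Decidable (∀ _, _))

instance {m : ℕ} (b : Bool) (E F : Perm (Fin m)) : Decidable (Site b E F) :=
  inferInstanceAs (Decidable (if b then _ else _))

instance {m : ℕ} (b : Bool) (E F : Perm (Fin m)) : Decidable (WeakSite b E F) :=
  inferInstanceAs (Decidable (if b then _ else _))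

instance (b : Bool) : Decidable (c.ValidTile b) := inferInstanceAs (Decidable (_ ∧ _))

instance (b : Bool) : Decidable (c.Valid b) := inferInstanceAs (Decidable (_ ∧ _))

theorem Descends.connected {m : ℕ} {S : List (Perm (Fin (m + 1)))} (h : Descends S) :
    Connected S := by
  intro r hr
  have h0 : ∀ i, r i 0 := by
    intro i
    induction i using WellFoundedLT.induction with
    | ind i ih =>
      by_cases hi : i = 0
      · exact hi ▸ r.refl _
      · obtain ⟨g, hg, hlt⟩ := h i hi
        exact r.trans (hr g hg i) (ih _ hlt)
  exact fun x y => r.trans (h0 x) (r.symm (h0 y))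

variable {c}

theorem coe_eq_familyPart {k : ℕ} (hk : 0 < k) (l : List ℕ) :
    (l : Multiset ℕ) = familyPart l.sum (k, (l.filter (· ≠ k) : List ℕ)) ∧
      (l.filter (· ≠ k)).sum ≤ l.sum ∧ k ∣ l.sum - (l.filter (· ≠ k)).sum := by
  have h : (l : Multiset ℕ) =
      (l.filter (· ≠ k) : List ℕ) + Multiset.replicate (Multiset.count k l) k := by
    rw [← Multiset.filter_eq', ← Multiset.filter_coe, add_comm]
    exact (Multiset.filter_add_not _ _).symm
  have hs := congrArg Multiset.sum h
  simp only [Multiset.sum_add, Multiset.sum_replicate, Multiset.sum_coe, smul_eq_mul] at hs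
  have hd : l.sum - (l.filter (· ≠ k)).sum = Multiset.count k (l : Multiset ℕ) * k := by omega
  refine ⟨?_, by omega, hd ▸ Dvd.intro_left _ rfl⟩
  rw [familyPart, Multiset.sum_coe, hd, Nat.mul_div_cancel _ hk]
  exact h

theorem WellFormed.fullCycleType (h : c.WellFormed) {x : MarkedCycles} (hx : x ∈ c.cycles) :
    fullCycleType (c.perm x) = familyPart (c.top + 1) (toPair (key x)) ∧
      (toPair (key x)).2.sum ≤ c.top + 1 ∧
      (toPair (key x)).1 ∣ c.top + 1 - (toPair (key x)).2.sum := by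
  obtain ⟨hk, hL⟩ := h.1 x hx
  have := coe_eq_familyPart hk (x.2.map List.length)
  rw [← List.length_flatten, hL.2.1] at this
  rw [perm, fullCycleType_ofCycles hL]
  exact this

theorem WellFormed.prod (h : c.WellFormed) :
    (c.kept.map c.perm).prod * c.perm c.e * c.perm c.f = 1 :=
  Equiv.ext h.2

theorem eventuallyRealizable {b : Bool} {T : Certificate} (hc : c.Valid b) (hT : T.ValidTile b)
    (hcT : c.cycles.map Prod.fst = T.cycles.map Prod.fst)
    (hlen : c.kept.length = T.kept.length) :
    EventuallyRealizable ((c.cycles.map key).map toPair) := by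
  obtain ⟨hwf, hdesc, hsite⟩ := hc
  obtain ⟨hwf', hdesc', hsite', hdvd, x₀, hx₀, ht⟩ := hT
  have hmem : ∀ (d : Certificate), d.e ∈ d.cycles ∧ d.f ∈ d.cycles ∧ ∀ x ∈ d.kept, x ∈ d.cycles :=
    fun d => ⟨by simp [cycles], by simp [cycles], fun x hx => by simp [cycles, hx]⟩
  have hG : Glueable b (c.top + 1)
      ((c.kept.map fun x => toPair (key x)).map (familyPart (c.top + 1)))
      (familyPart (c.top + 1) (toPair (key c.e))) (familyPart (c.top + 1) (toPair (key c.f))) := by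
    refine ⟨_, inferInstance, inferInstance, c.kept.map c.perm, c.perm c.e, c.perm c.f,
      Fintype.card_fin _, ?_, (hwf.fullCycleType (hmem c).1).1,
      (hwf.fullCycleType (hmem c).2.1).1, hwf.prod, hdesc.connected, hsite⟩
    rw [List.map_map, List.map_map]
    exact List.map_congr_left fun x hx => (hwf.fullCycleType ((hmem c).2.2 x hx)).1
  have htype : ∀ x ∈ T.cycles, _root_.fullCycleType (T.perm x) = familyPart (T.top + 1) (x.1, 0) :=
    fun x hx => by
      rw [(hwf'.fullCycleType hx).1, toPair, (hdvd x hx).2]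
      rfl
  obtain ⟨hkept, hef⟩ := List.append_inj
    (by simpa only [cycles, List.map_append] using hcT) (by simpa using hlen)
  simp only [List.map_cons, List.map_nil, List.cons.injEq, and_true] at hef
  have hT : IsTile b (T.top + 1)
      ((c.kept.map fun x => toPair (key x)).map fun x => familyPart (T.top + 1) (x.1, 0))
      (familyPart (T.top + 1) ((toPair (key c.e)).1, 0))
      (familyPart (T.top + 1) ((toPair (key c.f)).1, 0)) := by
    refine ⟨_, inferInstance, inferInstance, T.kept.map T.perm, T.perm T.e, T.perm T.f,
      Fintype.card_fin _, ?_, ?_, ?_, hwf'.prod, hdesc'.connected, hsite'⟩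
    · rw [List.map_map, List.map_map]
      have := congrArg (List.map fun k => familyPart (T.top + 1) (k, 0)) hkept
      rw [List.map_map, List.map_map] at this
      refine Eq.trans ?_ this.symm
      exact List.map_congr_left fun x hx => htype x ((hmem T).2.2 x hx)
    · exact (htype _ (hmem T).1).trans (by rw [← hef.1]; rfl)
    · exact (htype _ (hmem T).2.1).trans (by rw [← hef.2]; rfl)
  have hfst : ∀ x ∈ c.cycles, ∃ y ∈ T.cycles, y.1 = x.1 := fun x hx =>
    List.mem_map.1 (hcT ▸ List.mem_map_of_mem hx)
  have heq : (c.cycles.map key).map toPair =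
      (c.kept.map fun x => toPair (key x)) ++ [toPair (key c.e), toPair (key c.f)] := by
    simp [cycles]
  rw [heq]
  refine hG.eventuallyRealizable hT ?_ ?_
  all_goals rw [← heq, List.map_map]
  · intro y hy
    obtain ⟨x, hx, rfl⟩ := List.mem_map.1 hy
    obtain ⟨z, hz, hzx⟩ := hfst x hx
    exact ⟨(hwf.fullCycleType hx).2.1, (hwf.fullCycleType hx).2.2, hzx ▸ (hdvd z hz).1⟩
  · obtain ⟨x, hx, hxk⟩ := List.mem_map.1 (hcT ▸ List.mem_map_of_mem (f := Prod.fst) hx₀)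
    exact ⟨_, List.mem_map_of_mem hx, hxk.trans ht⟩

end Certificate

/-- Certificates for the families to be treated, grouped by their type, each group with a tile. -/
def table : List (Bool × Certificate × List Certificate) :=
  [(true, ⟨1, [(2,[[0,1]]), (2,[[0,1]])], (2,[[0,1]]), (2,[[0,1]])⟩,
    [⟨1, [(2,[[0,1]]),
      (2,[[0,1]])],
      (2,[[0,1]]),
      (2,[[0,1]])⟩,
    ⟨5, [(2,[[0,1],[2,4],[3,5]]),
      (2,[[0,2],[1,4],[3,5]])],
      (2,[[0,5,4,3],[1],[2]]),
      (2,[[0,5],[1,2],[3,4]])⟩,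
    ⟨9, [(2,[[0,1],[2,5],[3,6],[4,7],[8,9]]),
      (2,[[0,2],[1,4],[3,6],[5,9],[7,8]])],
      (2,[[0,3],[1,2],[4,8],[5,6],[7,9]]),
      (2,[[0,8,6,5,3],[2,7],[1],[4],[9]])⟩,
    ⟨7, [(2,[[0,1],[2,6],[3,5],[4,7]]),
      (2,[[0,2],[1,4],[3,5],[6,7]])],
      (2,[[0,3],[1,5],[2,7],[4,6]]),
      (2,[[0,6,3],[1,7,5],[2],[4]])⟩,
    ⟨11, [(2,[[0,1],[2,4],[3,5],[6,9],[7,10],[8,11]]),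
      (2,[[0,2],[1,4],[3,6],[5,9],[7,10],[8,11]])],
      (2,[[0,8,4,9,7,3],[10,11],[1],[2],[5],[6]]),
      (2,[[0,8],[1,2],[3,4],[5,6],[7,9],[10,11]])⟩,
    ⟨11, [(2,[[0,1],[2,5],[3,4],[6,10],[7,8],[9,11]]),
      (2,[[0,1,6,2],[3,4,8],[7,11],[5],[9],[10]])],
      (2,[[0,3],[1,4],[2,7],[5,9],[6,11],[8,10]]),
      (2,[[0,3],[1,7],[2,9],[4,10],[5,11],[6,8]])⟩,
    ⟨3, [(2,[[0,3,2,1]]),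
      (2,[[0,1],[2,3]])],
      (2,[[0,2],[1],[3]]),
      (2,[[0,2],[1,3]])⟩,
    ⟨5, [(2,[[0,1],[2,5],[3,4]]),
      (2,[[0,2],[3,4],[1],[5]])],
      (2,[[0,3],[1,4],[2,5]]),
      (2,[[0,4,1,5,3],[2]])⟩,
    ⟨5, [(2,[[0,3,1],[2,5,4]]),
      (2,[[0,1],[2,4],[3],[5]])],
      (2,[[0,2],[1,4],[3,5]]),
      (2,[[0,2],[1,5],[3,4]])⟩,
    ⟨7, [(2,[[0,1],[2,5],[3,6],[4,7]]),
      (2,[[1,3],[2,5],[6,7],[0],[4]])],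
      (2,[[0,5,3,4,1,2],[6],[7]]),
      (2,[[0,5],[1,2],[3,7],[4,6]])⟩,
    ⟨7, [(2,[[0,1],[2,4],[3,5],[6,7]]),
      (2,[[0,2],[1,3],[6,7],[4],[5]])],
      (2,[[0,6,3,1],[2,7,4],[5]]),
      (2,[[0,6],[1,4],[2,7],[3,5]])⟩,
    ⟨5, [(2,[[0,2,1],[3],[4],[5]]),
      (2,[[0,1,4,2],[3,5]])],
      (2,[[0,2],[1,3],[4,5]]),
      (2,[[0,2],[1,5],[3,4]])⟩,
    ⟨3, [(2,[[0,2,1],[3]]),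
      (2,[[0,2],[1,3]])],
      (2,[[0,2,3],[1]]),
      (2,[[0,2],[1,3]])⟩,
    ⟨5, [(2,[[0,2,1],[3,4],[5]]),
      (2,[[0,2],[1,3],[4,5]])],
      (2,[[0,2],[1,4],[3,5]]),
      (2,[[0,5,1,2],[3],[4]])⟩,
    ⟨7, [(2,[[0,1],[2,5],[3,4],[6,7]]),
      (2,[[0,2],[3,4],[1],[5],[6],[7]])],
      (2,[[0,3],[1,4],[2,6],[5,7]]),
      (2,[[0,4,1,6,5,3],[2,7]])⟩,
    ⟨5, [(2,[[1,3],[4,5],[0],[2]]),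
      (2,[[0,1],[4,5],[2],[3]])],
      (2,[[0,2],[1,4],[3,5]]),
      (2,[[0,4,1,5,3,2]])⟩,
    ⟨3, [(2,[[0,1],[2,3]]),
      (2,[[0,3,1],[2]])],
      (2,[[0,1,3,2]]),
      (2,[[0,1],[2],[3]])⟩,
    ⟨4, [(2,[[1,3],[2,4],[0]]),
      (2,[[0,1],[2,4],[3]])],
      (2,[[0,2],[1,4],[3]]),
      (2,[[0,4,1,3,2]])⟩,
    ⟨6, [(2,[[0,6,5,4,3,1],[2]]),
      (2,[[0,1],[3,4],[5,6],[2]])],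
      (2,[[0,2],[1,4],[3,5],[6]]),
      (2,[[0,2],[3,5],[4,6],[1]])⟩,
    ⟨6, [(2,[[0,4,2,1],[3,6,5]]),
      (2,[[0,1],[2,4],[5,6],[3]])],
      (2,[[0,2],[1,3],[4,6],[5]]),
      (2,[[0,2],[1,6],[3,4],[5]])⟩,
    ⟨2, [(2,[[0,1],[2]]),
      (2,[[0,2,1]])],
      (2,[[0,1,2]]),
      (2,[[0,1],[2]])⟩,
    ⟨4, [(2,[[0,1],[2,3],[4]]),
      (2,[[0,3,2,1],[4]])],
      (2,[[0,1,2],[3,4]]),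
      (2,[[0,1],[3,4],[2]])⟩]),
  (false, ⟨2, [(3,[[0,2,1]])], (3,[[0,2,1]]), (3,[[0,2,1]])⟩,
    [⟨5, [(3,[[0,3,1],[2,5,4]])],
      (3,[[0,3,2],[1,5,4]]),
      (3,[[0,4,1],[2,5,3]])⟩,
    ⟨11, [(3,[[0,5,3,2,1],[4,8,7],[6,10,9],[11]])],
      (3,[[0,4,2],[1,6,3],[5,9,8],[7,11,10]]),
      (3,[[0,3,8],[1,4,10],[2,6,5],[7,9,11]])⟩,
    ⟨14, [(3,[[0,8,4,2,6,3,1],[5,12,10],[9,11,13],[7],[14]])],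
      (3,[[0,5,2],[1,9,4],[3,11,7],[6,14,10],[8,13,12]]),
      (3,[[0,4,12],[1,7,11],[2,9,8],[3,10,13],[5,14,6]])⟩,
    ⟨8, [(3,[[0,8,7,6,3,1],[2,4],[5]])],
      (3,[[0,5,2],[1,6,4],[3,8,7]]),
      (3,[[0,4,5],[1,7,3],[2,6,8]])⟩,
    ⟨8, [(3,[[0,5,3,2,1],[4,7],[6,8]])],
      (3,[[0,4,2],[1,6,3],[5,8,7]]),
      (3,[[0,3,7],[1,4,8],[2,6,5]])⟩,
    ⟨8, [(3,[[0,3,1],[2,5,4],[6,7,8]])],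
      (3,[[0,3,2],[1,6,4],[5,8,7]]),
      (3,[[0,4,7,1],[2,6,5,3],[8]])⟩,
    ⟨5, [(3,[[0,5,4,2,3,1]])],
      (3,[[0,5,2],[1,3,4]]),
      (3,[[2,3,5],[0,4],[1]])⟩,
    ⟨9, [(3,[[0,9,8,5,6,3,1],[2,7,4]])],
      (3,[[0,5,2],[1,8,4],[3,6,7],[9]]),
      (3,[[0,4,6],[1,7,5],[2,8,9],[3]])⟩,
    ⟨6, [(3,[[0,3,1],[2,6,4],[5]])],
      (3,[[0,3,5,2],[1,6,4]]),
      (3,[[2,6,5,3],[0,4,1]])⟩,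
    ⟨4, [(3,[[0,4,3,2,1]])],
      (3,[[0,4,2],[1,3]]),
      (3,[[1,4,2],[0,3]])⟩]),
  (false, ⟨3, [(4,[[0,3,2,1]])], (4,[[0,3,2,1]]), (2,[[0,2],[1,3]])⟩,
    [⟨3, [(4,[[0,3,2,1]])],
      (4,[[0,3,2,1]]),
      (2,[[0,2],[1,3]])⟩]),
  (false, ⟨3, [(4,[[0,3,2,1]])], (2,[[0,2],[1,3]]), (4,[[0,3,2,1]])⟩,
    [⟨7, [(4,[[0,5,3,1],[2,6,7,4]])],
      (2,[[0,5,2],[1,4],[3,6],[7]]),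
      (4,[[0,4,7,3],[1,6,5,2]])⟩,
    ⟨7, [(4,[[0,5,3,1],[2,7,6,4]])],
      (2,[[1,5,3,4],[0,2],[6],[7]]),
      (4,[[0,4,6,7],[1,5,2,3]])⟩]),
  (false, ⟨5, [(6,[[0,5,4,3,2,1]])], (3,[[0,4,2],[1,5,3]]), (2,[[0,3],[1,4],[2,5]])⟩,
    [⟨5, [(6,[[0,5,4,3,2,1]])],
      (3,[[0,4,2],[1,5,3]]),
      (2,[[0,3],[1,4],[2,5]])⟩,
    ⟨5, [(6,[[0,5,4,2,3,1]])],
      (3,[[0,5,4,1,2],[3]]),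
      (2,[[0,4],[1,3],[2,5]])⟩,
    ⟨11, [(6,[[0,8,7,6,3,1],[2,11,10,9,5,4]])],
      (3,[[3,11,9,7],[0,5,2],[1,8,4],[6,10]]),
      (2,[[0,4],[1,7],[2,8],[3,10],[5,11],[6,9]])⟩,
    ⟨5, [(6,[[0,5,4,2,3,1]])],
      (3,[[0,5,2],[1,3,4]]),
      (2,[[2,3,5],[0,4],[1]])⟩]),
  (false, ⟨5, [(6,[[0,5,4,3,2,1]])], (2,[[0,3],[1,4],[2,5]]), (3,[[0,4,2],[1,5,3]])⟩,
    [⟨8, [(6,[[0,7,5,6,3,1],[2,8,4]])],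
      (2,[[0,5,2],[1,4],[3,7],[6,8]]),
      (3,[[0,4,6],[1,7,2],[3,8,5]])⟩,
    ⟨5, [(6,[[0,5,4,3,2,1]])],
      (2,[[0,4,2,1],[3],[5]]),
      (3,[[0,2,3],[1,4,5]])⟩])]

theorem valid_of_mem_table : ∀ x ∈ table, x.2.1.ValidTile x.1 ∧ ∀ c ∈ x.2.2, c.Valid x.1 ∧
    c.cycles.map Prod.fst = x.2.1.cycles.map Prod.fst ∧ c.kept.length = x.2.1.kept.length := by
  decide +kernel

end Certificate

section Enumeration

/-- Descending lists of length at most `fuel` of positive integers which are at most `b`, with sum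
at most `m`. -/
def descendingLists : ℕ → ℕ → ℕ → List (List ℕ)
  | 0, _, _ => [[]]
  | fuel + 1, m, b => [] :: (List.range (min b m)).flatMap fun i =>
      (descendingLists fuel (m - (i + 1)) (i + 1)).map fun l => (i + 1) :: l

theorem mem_descendingLists {fuel m b : ℕ} {l : List ℕ} (hfuel : l.length ≤ fuel)
    (hm : l.sum ≤ m) (hb : ∀ a ∈ l, 0 < a ∧ a ≤ b) (hl : l.Pairwise (· ≥ ·)) :
    l ∈ descendingLists fuel m b := by
  induction fuel generalizing m b l with
  | zero => simp_all [descendingLists]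
  | succ fuel ih =>
    cases l with
    | nil => simp [descendingLists]
    | cons a l =>
      rw [List.pairwise_cons] at hl
      rw [List.sum_cons] at hm
      obtain ⟨h0, hab⟩ := hb a List.mem_cons_self
      obtain ⟨i, rfl⟩ := Nat.exists_eq_add_one.2 h0
      simp only [descendingLists, List.mem_cons, List.mem_flatMap, List.mem_range, List.mem_map]
      refine Or.inr ⟨i, by omega, l, ih (by simpa using hfuel) (by omega)
        (fun x hx => ⟨(hb x (List.mem_cons_of_mem _ hx)).1, hl.1 x hx⟩) hl.2, rfl⟩

/-- Whether all almost-regular families of type `ks` and error at most `m` which have admissible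
degrees congruent to `r` satisfy `P`. -/
def allFamilies (r : ℕ) : List ℕ → ℕ → (List (ℕ × List ℕ) → Bool) → Bool
  | [], _, P => P []
  | k :: ks, m, P => (descendingLists m m m).all fun l =>
      decide (l.sum % k = r % k → k ∉ l → allFamilies r ks (m - l.sum) fun K => P ((k, l) :: K))

theorem exists_of_allFamilies {r : ℕ} {ks : List ℕ} {A : List (Multiset ℕ)} {m : ℕ}
    {P : List (ℕ × List ℕ) → Bool} (hP : allFamilies r ks m P) (hlen : A.length = ks.length)
    (hA : ∀ p ∈ ks.zip A, ∀ a ∈ p.2, 0 < a ∧ a ≠ p.1)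
    (hr : ∀ p ∈ ks.zip A, p.2.sum % p.1 = r % p.1) (hm : (A.map Multiset.sum).sum ≤ m) :
    ∃ K, P K ∧ ks.zip A = K.map toPair := by
  induction ks generalizing A m P with
  | nil => exact ⟨[], hP, by simp⟩
  | cons k ks ih =>
    obtain _ | ⟨s, A⟩ := A
    · simp at hlen
    rw [List.zip_cons_cons, List.forall_mem_cons] at hA hr
    rw [List.map_cons, List.sum_cons] at hm
    set l := s.sort (· ≥ ·)
    have hs : (l : Multiset ℕ) = s := s.sort_eq _
    have hsum : l.sum = s.sum := by rw [← hs, Multiset.sum_coe]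
    have hmem : ∀ a ∈ l, 0 < a ∧ a ≠ k := fun a ha => hA.1 a (by rwa [← hs])
    have hlist : l ∈ descendingLists m m m := by
      refine mem_descendingLists ?_ (by omega) (fun a ha => ⟨(hmem a ha).1, ?_⟩)
        (s.pairwise_sort _)
      · have := List.length_le_sum_of_one_le l fun a ha => (hmem a ha).1
        omega
      · have := List.single_le_sum (l := l) (fun _ _ => Nat.zero_le _) a ha
        omega
    have hP' := List.all_eq_true.1 hP l hlist
    rw [decide_eq_true_eq] at hP'
    obtain ⟨K, hK, hZ⟩ := ih (hP' (hsum ▸ hr.1) fun h => (hmem k h).2 rfl) (by simpa using hlen)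
      hA.2 hr.2 (by omega)
    exact ⟨(k, l) :: K, hK, by rw [List.zip_cons_cons, hZ, List.map_cons, toPair, hs]⟩

/-- The genus condition on the family `K`, where `t` is a common multiple of the regular parts. -/
def GenusOne (t : ℕ) (K : List (ℕ × List ℕ)) : Prop :=
  (K.map fun p => t / p.1 * p.2.sum).sum = t * (K.map fun p => p.2.length).sum

instance (t : ℕ) (K : List (ℕ × List ℕ)) : Decidable (GenusOne t K) :=
  inferInstanceAs (Decidable (_ = _))

/-- The exceptional families. -/
def exceptional : List (List (ℕ × List ℕ)) :=
  [[(2, [3, 1]), (2, []), (2, []), (2, [])], [(3, [4, 2]), (3, []), (3, [])],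
    [(2, []), (4, [5, 3]), (4, [])], [(2, []), (3, []), (6, [7, 5])]]

/-- The families with a certificate in `table`. -/
def certified : List (List (ℕ × List ℕ)) :=
  [[(2, []), (2, []), (2, []), (2, [])],
    [(2, []), (2, []), (2, [4, 1, 1]), (2, [])],
    [(2, []), (2, []), (2, []), (2, [5, 1, 1, 1])],
    [(2, []), (2, []), (2, []), (2, [3, 3, 1, 1])],
    [(2, []), (2, []), (2, [6, 1, 1, 1, 1]), (2, [])],
    [(2, []), (2, [4, 3, 1, 1, 1]), (2, []), (2, [])],
    [(2, [4]), (2, []), (2, [1, 1]), (2, [])],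
    [(2, []), (2, [1, 1]), (2, []), (2, [5, 1])],
    [(2, [3, 3]), (2, [1, 1]), (2, []), (2, [])],
    [(2, []), (2, [1, 1]), (2, [6, 1, 1]), (2, [])],
    [(2, []), (2, [1, 1]), (2, [4, 3, 1]), (2, [])],
    [(2, [3, 1, 1, 1]), (2, [4]), (2, []), (2, [])],
    [(2, [3, 1]), (2, []), (2, [3, 1]), (2, [])],
    [(2, [3, 1]), (2, []), (2, []), (2, [4, 1, 1])],
    [(2, []), (2, [1, 1, 1, 1]), (2, []), (2, [6])],
    [(2, [1, 1]), (2, [1, 1]), (2, []), (2, [6])],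
    [(2, []), (2, [3, 1]), (2, [4]), (2, [1, 1])],
    [(2, [1]), (2, [1]), (2, [1]), (2, [5])],
    [(2, [6, 1]), (2, [1]), (2, [1]), (2, [1])],
    [(2, [4, 3]), (2, [1]), (2, [1]), (2, [1])],
    [(2, [1]), (2, [3]), (2, [3]), (2, [1])],
    [(2, [1]), (2, [4, 1]), (2, [3]), (2, [1])],
    [(3, []), (3, []), (3, [])],
    [(3, [5, 1]), (3, []), (3, [])],
    [(3, [7, 1, 1]), (3, []), (3, [])],
    [(3, [6, 2, 1]), (3, []), (3, [])],
    [(3, [5, 2, 2]), (3, []), (3, [])],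
    [(3, []), (3, []), (3, [4, 4, 1])],
    [(3, [6]), (3, []), (3, [2, 1])],
    [(3, [7]), (3, [1]), (3, [1])],
    [(3, [1]), (3, [4]), (3, [4])],
    [(3, [5]), (3, [2]), (3, [2])],
    [(4, []), (4, []), (2, [])],
    [(4, []), (2, [3, 1]), (4, [])],
    [(4, []), (2, [4, 1, 1]), (4, [])],
    [(6, []), (3, []), (2, [])],
    [(6, []), (3, [5, 1]), (2, [])],
    [(6, []), (3, [4, 2]), (2, [])],
    [(6, []), (3, []), (2, [3, 1])],
    [(6, [3]), (2, [3]), (3, [])],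
    [(6, []), (2, [4, 1, 1]), (3, [])]]

theorem certified_eq : certified = table.flatMap fun x =>
    x.2.2.map fun c => c.cycles.map Certificate.key := by
  decide +kernel

/-- The family `K` is exceptional or has a certificate, up to order. -/
def Covered (K : List (ℕ × List ℕ)) : Prop :=
  (∃ X ∈ exceptional, X.Perm K) ∨ ∃ X ∈ certified, X.Perm K

instance (K : List (ℕ × List ℕ)) : Decidable (Covered K) := inferInstanceAs (Decidable (_ ∨ _))

theorem Covered.eventuallyRealizable {K : List (ℕ × List ℕ)} (h : Covered K)
    (hexc : ¬ ∃ X ∈ exceptional, X.Perm K) : EventuallyRealizable (K.map toPair) := by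
  obtain ⟨X, hX, hperm⟩ := h.resolve_left hexc
  rw [certified_eq, List.mem_flatMap] at hX
  obtain ⟨x, hx, hX⟩ := hX
  obtain ⟨c, hc, rfl⟩ := List.mem_map.1 hX
  obtain ⟨hT, hv⟩ := valid_of_mem_table x hx
  obtain ⟨h₁, h₂, h₃⟩ := hv c hc
  exact (Certificate.eventuallyRealizable h₁ hT h₂ h₃).perm (hperm.map _)

theorem covered_of_genusOne : ∀ x ∈ [([2, 2, 2, 2], 2, 10), ([3, 3, 3], 3, 10),
    ([2, 4, 4], 4, 6), ([2, 3, 6], 6, 6)],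
    ∀ r < x.2.1, allFamilies r x.1 x.2.2 fun K => decide (GenusOne x.2.1 K → Covered K) := by
  decide +kernel

end Enumeration

section Genus

theorem sum_map_pred_add_card (s : Multiset ℕ) (hs : ∀ a ∈ s, 0 < a) :
    (s.map fun a => a - 1).sum + Multiset.card s = s.sum := by
  induction s using Multiset.induction with
  | empty => rfl
  | cons a s ih =>
    rw [Multiset.forall_mem_cons] at hs
    have := ih hs.2
    simp only [Multiset.map_cons, Multiset.sum_cons, Multiset.card_cons]
    omega

theorem sum_familyPart_identities {n t : ℕ} (K : List (ℕ × List ℕ))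
    (hK : ∀ p ∈ K, 0 < p.1 ∧ p.1 ∣ t ∧ ∀ a ∈ p.2, 0 < a)
    (hadm : ∀ p ∈ K, p.2.sum ≤ n ∧ p.1 ∣ n - p.2.sum) :
    (K.map fun p => t / p.1 * p.2.sum).sum + t * (K.map fun p => (n - p.2.sum) / p.1).sum =
        n * (K.map fun p => t / p.1).sum ∧
      (K.map fun p => ((familyPart n (toPair p)).map fun e => e - 1).sum).sum +
        (K.map fun p => p.2.length).sum + (K.map fun p => (n - p.2.sum) / p.1).sum =
        n * K.length := by
  induction K with
  | nil => simp
  | cons p K ih =>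
    rw [List.forall_mem_cons] at hK hadm
    obtain ⟨ih₁, ih₂⟩ := ih hK.2 hadm.2
    obtain ⟨⟨hk, ⟨c, hc⟩, hpos⟩, -⟩ := hK
    obtain ⟨⟨hle, q, hq⟩, -⟩ := hadm
    have hn : n = p.2.sum + p.1 * q := by omega
    have hcard := sum_map_pred_add_card (familyPart n (toPair p)) (by
      intro a ha
      rcases Multiset.mem_add.1 ha with ha | ha
      · exact hpos a ha
      · exact (Multiset.eq_of_mem_replicate ha) ▸ hk)
    have hsum : (familyPart n (toPair p)).sum = n := by
      simp only [familyPart, toPair, Multiset.sum_add, Multiset.sum_replicate, Multiset.sum_coe,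
        smul_eq_mul]
      rw [hq, Nat.mul_div_cancel_left _ hk, mul_comm q, ← hn]
    have hcard' : Multiset.card (familyPart n (toPair p)) = p.2.length + q := by
      simp only [familyPart, toPair, Multiset.card_add, Multiset.card_replicate,
        Multiset.coe_card, Multiset.sum_coe]
      rw [hq, Nat.mul_div_cancel_left _ hk]
    simp only [List.map_cons, List.sum_cons, List.length_cons]
    have hdiv : t / p.1 = c := by rw [hc, Nat.mul_div_cancel_left _ hk]
    rw [hq, hdiv, Nat.mul_div_cancel_left _ hk]
    constructor
    · have : c * p.2.sum + t * q = n * c := by rw [hn, hc]; ring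
      linarith
    · linarith

theorem genusOne_of_sum_eq {n t : ℕ} {K : List (ℕ × List ℕ)}
    (hK : ∀ p ∈ K, 0 < p.1 ∧ p.1 ∣ t ∧ ∀ a ∈ p.2, 0 < a)
    (hflat : (K.map fun p => t / p.1).sum + 2 * t = t * K.length)
    (hadm : ∀ p ∈ K, p.2.sum ≤ n ∧ p.1 ∣ n - p.2.sum)
    (hgenus : (K.map fun p => ((familyPart n (toPair p)).map fun e => e - 1).sum).sum = 2 * n) :
    GenusOne t K := by
  obtain ⟨h₁, h₂⟩ := sum_familyPart_identities K hK hadm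
  rw [hgenus] at h₂
  have h₃ := congrArg (n * ·) hflat
  have h₄ := congrArg (t * ·) h₂
  simp only [mul_add] at h₃ h₄
  rw [GenusOne]
  linarith

theorem exists_realizable {k : List ℕ} {A : List (Multiset ℕ)} {t m : ℕ}
    (hcheck : ∀ r < t, allFamilies r k m fun K => decide (GenusOne t K → Covered K))
    (hlen : A.length = k.length) (ht : 0 < t) (hk : ∀ a ∈ k, 0 < a ∧ a ∣ t)
    (hflat : (k.map fun a => t / a).sum + 2 * t = t * k.length)
    (hA : ∀ p ∈ k.zip A, ∀ a ∈ p.2, 0 < a ∧ a ≠ p.1)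
    (hgenus : ∀ n, Admissible k A n →
      2 * 1 + 2 * n = 2 + ((familyData k A n).map fun E => (E.map fun e => e - 1).sum).sum)
    (hexc : ∀ X ∈ exceptional, (k.zip A : Multiset (ℕ × Multiset ℕ)) ≠ X.map toPair)
    (heps : (A.map Multiset.sum).sum ≤ m) :
    ∃ N, ∀ n ≥ N, Admissible k A n → Realizable n (familyData k A n) := by
  by_cases hne : ∃ n, Admissible k A n
  · obtain ⟨n, hn⟩ := hne
    have hmod : ∀ p ∈ k.zip A, p.2.sum % p.1 = n % t % p.1 := fun p hp => by
      rw [Nat.mod_mod_of_dvd _ (hk p.1 (List.of_mem_zip hp).1).2]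
      exact (Nat.modEq_iff_dvd' (hn p hp).1).2 (hn p hp).2
    obtain ⟨K, hK, hZ⟩ :=
      exists_of_allFamilies (hcheck (n % t) (Nat.mod_lt _ ht)) hlen hA hmod heps
    have hfst : k = K.map Prod.fst := by
      rw [← List.map_fst_zip hlen.ge, hZ, List.map_map]
      rfl
    have hcov : Covered K := by
      refine of_decide_eq_true hK (genusOne_of_sum_eq (n := n) (fun p hp => ?_) ?_
        (fun p hp => ?_) ?_)
      · have hp' := hk p.1 (hfst ▸ List.mem_map_of_mem hp)
        exact ⟨hp'.1, hp'.2, fun a ha =>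
          (hA (toPair p) (hZ ▸ List.mem_map_of_mem hp) a ha).1⟩
      · rw [hfst, List.map_map, List.length_map] at hflat
        exact hflat
      · exact hn (toPair p) (hZ ▸ List.mem_map_of_mem hp)
      · have := hgenus n hn
        rw [familyData, hZ, List.map_map, List.map_map] at this
        exact (Nat.add_left_cancel this).symm
    have hreal := hcov.eventuallyRealizable fun ⟨X, hX, hperm⟩ =>
      hexc X hX (by rw [hZ]; exact Multiset.coe_eq_coe.2 (hperm.map _).symm)
    rw [← hZ] at hreal
    exact hreal
  · exact ⟨0, fun n _ hn => (hne ⟨n, hn⟩).elim⟩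

end Genus

end AlmostRegular

/-- Theorem 1.2 (strong form, genus 1): for an almost-regular family of one of the four regular
genus-1 types, not one of the four exceptional families (A)-(D) (up to reordering among indices
with equal `k j`, which is exactly equality of the multiset of pairs `(k j, A j)`), with error
at most 6 (or at most 10 in the cases [2,2,2,2] and [3,3,3]), all members of sufficiently large
admissible degree are realizable. -/
theorem stmt0
    (k : List ℕ) (A : List (Multiset ℕ))
    (hlen : A.length = k.length)
    (hk : k = [2, 2, 2, 2] ∨ k = [3, 3, 3] ∨ k = [2, 4, 4] ∨ k = [2, 3, 6])
    (hA : ∀ p ∈ k.zip A, ∀ a ∈ p.2, 0 < a ∧ a ≠ p.1)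
    (hgenus : ∀ n, Admissible k A n →
      2 * 1 + 2 * n = 2 + ((familyData k A n).map fun E => (E.map fun e => e - 1).sum).sum)
    (hexc : ¬ ((↑(k.zip A) : Multiset (ℕ × Multiset ℕ)) =
          {(2, ({1, 3} : Multiset ℕ)), (2, 0), (2, 0), (2, 0)} ∨
        (↑(k.zip A) : Multiset (ℕ × Multiset ℕ)) =
          {(3, ({2, 4} : Multiset ℕ)), (3, 0), (3, 0)} ∨
        (↑(k.zip A) : Multiset (ℕ × Multiset ℕ)) =
          {(2, (0 : Multiset ℕ)), (4, ({3, 5} : Multiset ℕ)), (4, 0)} ∨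
        (↑(k.zip A) : Multiset (ℕ × Multiset ℕ)) =
          {(2, (0 : Multiset ℕ)), (3, 0), (6, ({5, 7} : Multiset ℕ))}))
    (heps : (A.map Multiset.sum).sum ≤ 6 ∨
      ((k = [2, 2, 2, 2] ∨ k = [3, 3, 3]) ∧ (A.map Multiset.sum).sum ≤ 10)) :
    ∃ N, ∀ n ≥ N, Admissible k A n → Realizable n (familyData k A n) := by
  have hexc' : ∀ X ∈ AlmostRegular.exceptional,
      (k.zip A : Multiset (ℕ × Multiset ℕ)) ≠ X.map AlmostRegular.toPair := by
    have h₁ : ({1, 3} : Multiset ℕ) = ↑[3, 1] := by decide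
    have h₂ : ({2, 4} : Multiset ℕ) = ↑[4, 2] := by decide
    have h₃ : ({3, 5} : Multiset ℕ) = ↑[5, 3] := by decide
    have h₄ : ({5, 7} : Multiset ℕ) = ↑[7, 5] := by decide
    rw [h₁, h₂, h₃, h₄] at hexc
    simp only [not_or] at hexc
    obtain ⟨e₁, e₂, e₃, e₄⟩ := hexc
    simp only [AlmostRegular.exceptional, List.forall_mem_cons]
    exact ⟨e₁, e₂, e₃, e₄, by simp⟩
  have hcheck := AlmostRegular.covered_of_genusOne
  simp only [List.forall_mem_cons] at hcheck
  obtain ⟨c₁, c₂, c₃, c₄, -⟩ := hcheck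
  rcases hk with rfl | rfl | rfl | rfl
  · exact AlmostRegular.exists_realizable c₁ hlen (by decide) (by decide) (by decide) hA hgenus
      hexc' (by omega)
  · exact AlmostRegular.exists_realizable c₂ hlen (by decide) (by decide) (by decide) hA hgenus
      hexc' (by omega)
  · exact AlmostRegular.exists_realizable c₃ hlen (by decide) (by decide) (by decide) hA hgenus
      hexc' (by simpa using heps)
  · exact AlmostRegular.exists_realizable c₄ hlen (by decide) (by decide) (by decide) hA hgenus
      hexc' (by simpa using heps)
end

section
/- Let α be a finite set with n elements and let x, y be fixed-point-free involutions of α such that the subgroup generated by x and y acts transitively on α. Then n is even and the product x·y has exactly two cycles, each of length n/2; that is, the full cycle type of x·y is the multiset {n/2, n/2}. -/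
/-- A fixed-point-free involution: a permutation of order 2 without fixed points. -/
def IsFpfInvolution {α : Type*} (σ : Equiv.Perm α) : Prop :=
  orderOf σ = 2 ∧ ∀ a, σ a ≠ a

open Equiv.Perm in
/-- Two involutions without fixed points never move a point along its own cycle of the product. -/
theorem IsFpfInvolution.not_sameCycle_mul {α : Type*} {x y : Equiv.Perm α}
    (hx : IsFpfInvolution x) (hy : IsFpfInvolution y) (a : α) :
    ¬ SameCycle (x * y) a (x a) := by
  have hxx : x * x = 1 := by rw [← pow_two, ← hx.1, pow_orderOf_eq_one]
  have hyy : y * y = 1 := by rw [← pow_two, ← hy.1, pow_orderOf_eq_one]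
  have hxi : x⁻¹ = x := inv_eq_of_mul_eq_one_left hxx
  have hyi : y⁻¹ = y := inv_eq_of_mul_eq_one_left hyy
  have hconj : x * (x * y) * x⁻¹ = (x * y)⁻¹ := by
    rw [mul_inv_rev, hxi, hyi, ← mul_assoc, hxx, one_mul]
  have hpow (j : ℤ) (b : α) : x (((x * y) ^ j) b) = ((x * y) ^ (-j)) (x b) := by
    have h : x * (x * y) ^ j * x⁻¹ = (x * y) ^ (-j) := by
      rw [← conj_zpow, hconj, inv_zpow']
    rw [← h]
    simp
  rintro ⟨k, hk⟩
  obtain ⟨j, rfl | rfl⟩ := k.even_or_odd'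
  · apply hx.2 (((x * y) ^ j) a)
    rw [hpow, ← hk, ← mul_apply, ← zpow_add]
    congr 2
    ring
  · apply hy.2 (((x * y) ^ j) a)
    have h : y = x * (x * y) := by rw [← mul_assoc, hxx, one_mul]
    have hz : (x * y) (((x * y) ^ j) a) = ((x * y) ^ (1 + j)) a := by
      rw [zpow_add, zpow_one, mul_apply (x * y)]
    calc y (((x * y) ^ j) a) = x ((x * y) (((x * y) ^ j) a)) := by
          conv_lhs => rw [show y (((x * y) ^ j) a) = (x * (x * y)) (((x * y) ^ j) a) by rw [← h]]
          rfl
      _ = ((x * y) ^ j) a := by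
          rw [hz, hpow, ← hk, ← mul_apply, ← zpow_add]
          congr 2
          ring

open Equiv.Perm in
/-- If two involutions generate a transitive group, then their product has at most two orbits,
exchanged by the first involution. -/
theorem IsTransitiveSet.sameCycle_mul_or {α : Type*} {x y : Equiv.Perm α}
    (hxx : x * x = 1) (hyy : y * y = 1) (htrans : IsTransitiveSet {x, y}) (a b : α) :
    SameCycle (x * y) a b ∨ SameCycle (x * y) a (x b) := by
  have hxa (b : α) : x (x b) = b := by rw [← mul_apply, hxx, one_apply]
  have hya (b : α) : y (y b) = b := by rw [← mul_apply, hyy, one_apply]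
  have key : ∀ g ∈ Subgroup.closure ({x, y} : Set (Equiv.Perm α)), ∀ b,
      (SameCycle (x * y) a b ∨ SameCycle (x * y) a (x b)) ↔
        (SameCycle (x * y) a (g b) ∨ SameCycle (x * y) a (x (g b))) := by
    intro g hg
    induction hg using Subgroup.closure_induction with
    | mem g hg =>
      rintro b
      rcases hg with rfl | rfl
      · rw [hxa, or_comm]
      · have h₁ : SameCycle (x * g) a (x (g b)) ↔ SameCycle (x * g) a b :=
          sameCycle_apply_right (f := x * g)
        have h₂ : SameCycle (x * g) a (x b) ↔ SameCycle (x * g) a (g b) := by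
          rw [← sameCycle_apply_right (y := g b), mul_apply, hya]
        rw [h₁, h₂, or_comm]
    | one => simp
    | mul g h _ _ hg hh => intro b; rw [hh b, hg (h b), mul_apply]
    | inv g _ hg => intro b; rw [hg (g⁻¹ b), ← mul_apply, mul_inv_cancel, one_apply]
  obtain ⟨g, hg, rfl⟩ := htrans a b
  exact (key g hg a).1 (Or.inl (SameCycle.refl _ _))

open Equiv.Perm in
/-- If x, y are fixed-point-free involutions of a finite set α of n elements generating a
transitive subgroup, then n is even and x·y has exactly two cycles, both of length n/2. -/
theorem stmt4 {α : Type*} [Fintype α] [DecidableEq α]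
    (x y : Equiv.Perm α)
    (hx : IsFpfInvolution x) (hy : IsFpfInvolution y)
    (htrans : IsTransitiveSet {x, y}) :
    Even (Fintype.card α) ∧
      fullCycleType (x * y) = {Fintype.card α / 2, Fintype.card α / 2} := by
  have hxx : x * x = 1 := by rw [← pow_two, ← hx.1, pow_orderOf_eq_one]
  have hyy : y * y = 1 := by rw [← pow_two, ← hy.1, pow_orderOf_eq_one]
  have hxi : x⁻¹ = x := inv_eq_of_mul_eq_one_left hxx
  have hyi : y⁻¹ = y := inv_eq_of_mul_eq_one_left hyy
  have hxa (b : α) : x (x b) = b := by rw [← mul_apply, hxx, one_apply]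
  have hw (b : α) : x ((x * y)⁻¹ (x b)) = (x * y) b := by
    rw [mul_inv_rev, hxi, hyi, mul_apply, hxa, mul_apply]
  have hne : Nonempty α := by
    by_contra h
    rw [not_nonempty_iff] at h
    have h1 := hx.1
    rw [Subsingleton.elim x 1, orderOf_one] at h1
    omega
  obtain ⟨a⟩ := hne
  have hor := htrans.sameCycle_mul_or hxx hyy a
  have hnot (b : α) (h : SameCycle (x * y) a b) : ¬ SameCycle (x * y) a (x b) := fun h' =>
    hx.not_sameCycle_mul hy b (h.symm.trans h')
  generalize x * y = w at hw hor hnot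
  by_cases hwa : w a = a
  · have hsame (b : α) (h : SameCycle w a b) : b = a := by
      obtain ⟨k, rfl⟩ := h
      exact zpow_apply_eq_self_of_apply_eq_self hwa k
    have huniv : (Finset.univ : Finset α) = {a, x a} := by
      ext b
      simp only [Finset.mem_univ, Finset.mem_insert, Finset.mem_singleton, true_iff]
      refine (hor b).imp (hsame b) fun h => ?_
      rw [← hsame _ h, hxa]
    have hcard : Fintype.card α = 2 := by
      rw [← Finset.card_univ, huniv, Finset.card_pair (hx.2 a).symm]
    have hwinv : w⁻¹ a = a := by rw [inv_eq_iff_eq, hwa]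
    have hw1 : w = 1 := by
      ext b
      rcases hor b with h | h
      · rw [hsame b h, hwa, one_apply]
      · rw [← hw, hsame _ h, hwinv, ← hsame _ h, hxa, one_apply]
    subst hw1
    simp [fullCycleType, hcard, Multiset.replicate_succ]
  · have hmoved (b : α) : w b ≠ b := by
      rcases hor b with h | h
      · exact fun hb => hwa (h.apply_eq_self_iff.2 hb)
      · intro hb
        refine hwa (h.apply_eq_self_iff.2 ?_)
        have h' := hw b
        rw [hb] at h'
        rw [← inv_eq_iff_eq.1 (x.injective (h'.trans (hxa b).symm))]
    have hcycle : (w.cycleOf a).IsCycle := isCycle_cycleOf w hwa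
    have hp (b : α) (h : SameCycle w a b) : x ((w.cycleOf a)⁻¹ (x b)) = b := by
      rw [cycleOf_inv, cycleOf_apply_of_not_sameCycle, hxa]
      rw [sameCycle_inv]
      exact hnot b h
    have hdisj : Disjoint (w.cycleOf a) (x * (w.cycleOf a)⁻¹ * x⁻¹) := by
      intro b
      by_cases h : SameCycle w a b
      · right
        rw [hxi]
        exact hp b h
      · exact Or.inl (cycleOf_apply_of_not_sameCycle h)
    have hprod : w.cycleOf a * (x * (w.cycleOf a)⁻¹ * x⁻¹) = w := by
      ext b
      rw [hxi]
      simp only [mul_apply]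
      by_cases h : SameCycle w a b
      · rw [hp b h, h.cycleOf_apply]
      · have h' := (hor b).resolve_left h
        rw [cycleOf_inv, (sameCycle_inv.2 h').cycleOf_apply, hw,
          cycleOf_apply_of_not_sameCycle (by rwa [sameCycle_apply_right])]
    have htype : w.cycleType = {(w.cycleOf a).support.card, (w.cycleOf a).support.card} := by
      conv_lhs => rw [← hprod]
      rw [hdisj.cycleType_mul, cycleType_conj, cycleType_inv, hcycle.cycleType]
      rfl
    have hsum : w.cycleType.sum = Fintype.card α := by
      rw [sum_cycleType, ← Finset.card_univ]
      congr 1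
      ext b
      simp [hmoved b]
    have hcard : Fintype.card α = (w.cycleOf a).support.card + (w.cycleOf a).support.card := by
      rw [← hsum, htype]
      simp
    refine ⟨⟨_, hcard⟩, ?_⟩
    rw [fullCycleType, hsum, Nat.sub_self, Multiset.replicate_zero, add_zero, htype]
    congr 1 <;> [skip; congr 1] <;> omega
end

section
/- There exists a positive integer N such that for every integer n ≥ N there exist vectors v = (v₁,v₂) and w = (w₁,w₂) in ℤ² with: v₁·w₂ − v₂·w₁ = n; the Euclidean norms satisfy ‖v‖ ≥ √n − 1 and ‖w‖ ≥ √n − 1; and the inner product satisfies |v·w| ≤ (1/√2 + 1/10)·‖v‖·‖w‖. (Hence the plane lattice admits, for every sufficiently large index n, a fundamental parallelogram of index n whose side lengths tend to infinity and whose angle is bounded away from 0; this yields tilings of the torus by n hexagons, or by n squares, containing disks of arbitrarily large radius as n → ∞.) -/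
/-- A bound on the squared cosine by `1 / 2` bounds the cosine itself by `1 / √2`. -/
theorem abs_le_div_sqrt_two_mul_of_two_mul_sq_le {d A B : ℝ} (hA : 0 ≤ A)
    (h : 2 * d ^ 2 ≤ A * B) : |d| ≤ 1 / √2 * (√A * √B) := by
  rw [← Real.sqrt_mul hA, one_div_mul_eq_div, ← Real.sqrt_div' _ (by norm_num)]
  exact Real.abs_le_sqrt (by linarith)

/-- Integer vectors `(k, 1)` and `(x, y)` spanning a parallelogram of area `n < (k + 1) ^ 2`, with
`k ≤ y` and squared cosine at most `1 / 2`, satisfy the real bounds on side lengths and angle. -/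
theorem exists_parallelogram_of_int_bounds {n : ℕ} {k x y : ℤ} (hk : 0 ≤ k)
    (hn : (n : ℤ) ≤ (k + 1) ^ 2) (hdet : k * y - 1 * x = n) (hy : k ≤ y)
    (hcos : 2 * (k * x + 1 * y) ^ 2 ≤ (k ^ 2 + 1 ^ 2) * (x ^ 2 + y ^ 2)) :
    ∃ v w : ℤ × ℤ,
        v.1 * w.2 - v.2 * w.1 = (n : ℤ) ∧
        Real.sqrt n - 1 ≤ Real.sqrt ((v.1 : ℝ) ^ 2 + (v.2 : ℝ) ^ 2) ∧
        Real.sqrt n - 1 ≤ Real.sqrt ((w.1 : ℝ) ^ 2 + (w.2 : ℝ) ^ 2) ∧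
        |(v.1 : ℝ) * (w.1 : ℝ) + (v.2 : ℝ) * (w.2 : ℝ)| ≤
          (1 / Real.sqrt 2 + 1 / 10) *
            (Real.sqrt ((v.1 : ℝ) ^ 2 + (v.2 : ℝ) ^ 2) *
              Real.sqrt ((w.1 : ℝ) ^ 2 + (w.2 : ℝ) ^ 2)) := by
  have hk' : (0 : ℝ) ≤ k := by exact_mod_cast hk
  have hy' : (k : ℝ) ≤ y := by exact_mod_cast hy
  have hsqrt : √(n : ℝ) - 1 ≤ k := by
    have : √(n : ℝ) ≤ k + 1 := Real.sqrt_le_iff.2 ⟨by linarith, by exact_mod_cast hn⟩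
    linarith
  refine ⟨(k, 1), (x, y), hdet, hsqrt.trans (Real.le_sqrt_of_sq_le ?_),
    hsqrt.trans (Real.le_sqrt_of_sq_le ?_), ?_⟩
  · nlinarith
  · nlinarith [sq_nonneg (x : ℝ)]
  · have hcosR : 2 * ((k : ℝ) * x + (1 : ℤ) * y) ^ 2 ≤
        ((k : ℝ) ^ 2 + ((1 : ℤ) : ℝ) ^ 2) * ((x : ℝ) ^ 2 + (y : ℝ) ^ 2) := by
      exact_mod_cast hcos
    refine (abs_le_div_sqrt_two_mul_of_two_mul_sq_le (by positivity) hcosR).trans ?_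
    gcongr
    linarith


/-- Lemma (tilings of the torus with disks of large radius): for every sufficiently large n
there is a sublattice of ℤ² of index n whose generating vectors both have Euclidean norm at
least √n − 1 and meet at an angle whose cosine is at most 1/√2 + 1/10 in absolute value. -/
theorem stmt6 :
    ∃ N : ℕ, 0 < N ∧ ∀ n : ℕ, N ≤ n →
      ∃ v w : ℤ × ℤ,
        v.1 * w.2 - v.2 * w.1 = (n : ℤ) ∧
        Real.sqrt n - 1 ≤ Real.sqrt ((v.1 : ℝ) ^ 2 + (v.2 : ℝ) ^ 2) ∧
        Real.sqrt n - 1 ≤ Real.sqrt ((w.1 : ℝ) ^ 2 + (w.2 : ℝ) ^ 2) ∧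
        |(v.1 : ℝ) * (w.1 : ℝ) + (v.2 : ℝ) * (w.2 : ℝ)| ≤
          (1 / Real.sqrt 2 + 1 / 10) *
            (Real.sqrt ((v.1 : ℝ) ^ 2 + (v.2 : ℝ) ^ 2) *
              Real.sqrt ((w.1 : ℝ) ^ 2 + (w.2 : ℝ) ^ 2)) := by
  refine ⟨4, by norm_num, fun n hn => ?_⟩
  obtain ⟨k, hk⟩ : ∃ k : ℤ, k = (Nat.sqrt n : ℤ) := ⟨_, rfl⟩
  have hk2 : 2 ≤ k := by
    rw [hk]
    exact_mod_cast Nat.le_sqrt.2 hn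
  have hlow : k * k ≤ n := by
    rw [hk]
    exact_mod_cast Nat.sqrt_le n
  have hupp : (n : ℤ) < (k + 1) * (k + 1) := by
    rw [hk]
    exact_mod_cast Nat.lt_succ_sqrt n
  obtain ⟨r, hr⟩ : ∃ r : ℤ, (n : ℤ) = k * k + r := ⟨n - k * k, by ring⟩
  rcases le_or_gt r k with hrk | hrk
  · refine exists_parallelogram_of_int_bounds (k := k) (x := -r) (y := k) (by linarith)
      (by linarith) (by linarith) le_rfl ?_
    have hr0 : 0 ≤ r := by linarith
    have h : 2 * (1 - r) ^ 2 ≤ r ^ 2 + k ^ 2 := by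
      rcases hr0.eq_or_lt with rfl | hr1 <;> nlinarith
    nlinarith [mul_le_mul_of_nonneg_left h (sq_nonneg k), sq_nonneg r, sq_nonneg k]
  · obtain ⟨s, rfl⟩ : ∃ s : ℤ, r = k + s := ⟨r - k, by ring⟩
    refine exists_parallelogram_of_int_bounds (k := k) (x := -s) (y := k + 1) (by linarith)
      (by linarith) (by linarith) (by linarith) ?_
    have hs1 : 1 ≤ s := by linarith
    have hsk : s ≤ k := by linarith
    have h : (k * -s + 1 * (k + 1)) ^ 2 ≤ (k * s) ^ 2 := by
      apply sq_le_sq' <;> nlinarith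
    have h' : s ^ 2 ≤ (k + 1) ^ 2 := by nlinarith
    nlinarith [mul_le_mul_of_nonneg_left h' (sq_nonneg k), sq_nonneg s, sq_nonneg (k + 1)]
end

section
/- Let r ≥ 3 and let σ₁,…,σ_r be permutations of {1,…,n} with σ₁σ₂⋯σ_r = 1, generating a subgroup that acts transitively on {1,…,n}. Suppose there is a point x ∈ {1,…,n} such that the cycle of σ₁ containing x has length a and the cycle of σ₂ containing x has length b. Then for every integer k ≥ 0 there exist permutations τ₁,…,τ_r of {1,…,n+k} with τ₁τ₂⋯τ_r = 1, generating a subgroup acting transitively on {1,…,n+k}, such that: the full cycle type of τ₁ is obtained from that of σ₁ by replacing one cycle of length a by one of length a+k; the full cycle type of τ₂ is obtained from that of σ₂ by replacing one cycle of length b by one of length b+k; and for every j with 3 ≤ j ≤ r, the full cycle type of τ_j is that of σ_j together with k additional copies of 1. -/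
/-- The length of the cycle of σ containing x (a fixed point counts as a cycle of length 1). -/
def cycleLengthAt {α : Type*} [Fintype α] [DecidableEq α] (σ : Equiv.Perm α) (x : α) : ℕ :=
  if σ x = x then 1 else (σ.cycleOf x).support.card

namespace Equiv.Perm

section

variable {α : Type*} [DecidableEq α] {σ : Perm α} {x y : α}

/-- Inserting a fixed point `y` of `σ` after `x` keeps every `z ≠ y` in the cycle of `σ z`. -/
theorem sameCycle_mul_swap_apply (hxy : x ≠ y) (hy : σ y = y) {z : α} (hz : z ≠ y) :
    SameCycle (σ * swap x y) z (σ z) := by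
  by_cases hzx : z = x
  · subst hzx
    exact ⟨2, by simp [zpow_ofNat, pow_two, hy]⟩
  · exact ⟨1, by simp [swap_apply_of_ne_of_ne hzx hz]⟩

theorem sameCycle_mul_swap_self (hy : σ y = y) : SameCycle (σ * swap x y) x y :=
  ⟨1, by simp [hy]⟩

theorem SameCycle.mul_swap [Finite α] (hxy : x ≠ y) (hy : σ y = y) {z : α}
    (h : SameCycle σ x z) : SameCycle (σ * swap x y) x z := by
  obtain ⟨i, rfl⟩ := h.exists_nat_pow_eq
  clear h
  induction i with
  | zero => exact SameCycle.rfl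
  | succ i ih =>
    rw [pow_succ', mul_apply]
    refine ih.trans (sameCycle_mul_swap_apply hxy hy fun h => hxy ?_)
    rw [← (σ ^ i).injective.eq_iff, h, pow_apply_eq_self_of_apply_eq_self hy]

end

section

variable {α : Type*} [Fintype α] [DecidableEq α] {σ : Perm α} {x y : α}

theorem cycleOf_apply_eq_self (hy : σ y = y) (x : α) : σ.cycleOf x y = y := by
  rw [cycleOf_apply, hy, ite_self]

theorem support_cycleOf_mul_swap (hxy : x ≠ y) (hy : σ y = y) :
    (σ.cycleOf x * swap x y).support = insert y (insert x (σ.cycleOf x).support) := by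
  have hcy : σ.cycleOf x y = y := cycleOf_apply_eq_self hy x
  have hne : ∀ z, z ≠ y → σ.cycleOf x z ≠ y := fun z hz h =>
    hz ((σ.cycleOf x).injective (h.trans hcy.symm))
  ext z
  rw [mem_support, mul_apply, Finset.mem_insert, Finset.mem_insert, mem_support]
  by_cases hzy : z = y
  · subst hzy
    simpa using hne x hxy
  by_cases hzx : z = x
  · subst hzx
    simp [hcy, hxy.symm]
  · simp [swap_apply_of_ne_of_ne hzx hzy, hzx, hzy]

theorem isCycle_cycleOf_mul_swap (hxy : x ≠ y) (hy : σ y = y) :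
    IsCycle (σ.cycleOf x * swap x y) := by
  have hcy : σ.cycleOf x y = y := cycleOf_apply_eq_self hy x
  refine ⟨x, by simpa [hcy] using hxy.symm, fun z hz => ?_⟩
  rw [← mem_support, support_cycleOf_mul_swap hxy hy, Finset.mem_insert, Finset.mem_insert,
    mem_support_cycleOf_iff] at hz
  rcases hz with rfl | rfl | hz
  · exact sameCycle_mul_swap_self hcy
  · exact SameCycle.rfl
  · refine SameCycle.mul_swap hxy hcy ?_
    obtain ⟨i, hi⟩ := hz.1
    exact ⟨i, by rw [cycleOf_zpow_apply_self, hi]⟩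

theorem disjoint_mul_inv_cycleOf (σ : Perm α) (x : α) :
    Disjoint (σ * (σ.cycleOf x)⁻¹) (σ.cycleOf x) := by
  by_cases hx : σ x = x
  · rw [(cycleOf_eq_one_iff σ).2 hx]
    exact disjoint_one_right _
  · exact disjoint_mul_inv_of_mem_cycleFactorsFinset
      (cycleOf_mem_cycleFactorsFinset_iff.2 (mem_support.2 hx))

theorem mul_inv_cycleOf_apply_self (σ : Perm α) (x : α) : (σ * (σ.cycleOf x)⁻¹) x = x := by
  rcases disjoint_mul_inv_cycleOf σ x x with h | h
  · exact h
  · rw [cycleOf_apply_self] at h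
    simp [(cycleOf_eq_one_iff σ).2 h, h]

theorem disjoint_mul_inv_cycleOf_mul_swap (hxy : x ≠ y) (hy : σ y = y) :
    Disjoint (σ * (σ.cycleOf x)⁻¹) (σ.cycleOf x * swap x y) := by
  have hcy : (σ.cycleOf x)⁻¹ y = y := inv_eq_iff_eq.2 (cycleOf_apply_eq_self hy x).symm
  intro z
  rw [← notMem_support (f := _ * swap x y), support_cycleOf_mul_swap hxy hy]
  rcases disjoint_mul_inv_cycleOf σ x z with h | h
  · exact .inl h
  by_cases hzy : z = y
  · subst hzy
    exact .inl (by rw [mul_apply, hcy, hy])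
  by_cases hzx : z = x
  · subst hzx
    exact .inl (mul_inv_cycleOf_apply_self _ _)
  · exact .inr (by simp only [Finset.mem_insert, notMem_support.2 h, hzy, hzx, or_self,
      not_false_eq_true])

theorem mul_swap_eq (σ : Perm α) (x y : α) :
    σ * swap x y = σ * (σ.cycleOf x)⁻¹ * (σ.cycleOf x * swap x y) := by
  group

theorem cycleOf_mul_swap (hxy : x ≠ y) (hy : σ y = y) :
    (σ * swap x y).cycleOf x = σ.cycleOf x * swap x y := by
  have hd := disjoint_mul_inv_cycleOf_mul_swap hxy hy
  have hx : (σ.cycleOf x * swap x y) x ≠ x := by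
    rw [← mem_support, support_cycleOf_mul_swap hxy hy]
    simp
  conv_lhs => rw [mul_swap_eq, hd.commute.eq]
  rw [cycleOf_mul_of_apply_right_eq_self hd.commute.symm x (mul_inv_cycleOf_apply_self σ x),
    (isCycle_cycleOf_mul_swap hxy hy).cycleOf_eq hx]

end

end Equiv.Perm

section

open Equiv Equiv.Perm

variable {α : Type*} {s : Set (Perm α)}

theorem exists_mem_closure_of_sameCycle {g : Perm α} (hg : g ∈ s) {z w : α}
    (h : SameCycle g z w) : ∃ k ∈ Subgroup.closure s, k z = w := by
  obtain ⟨i, hi⟩ := h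
  exact ⟨g ^ i, zpow_mem (Subgroup.subset_closure hg) i, hi⟩

theorem exists_mem_closure_trans {u v w : α}
    (h₁ : ∃ g ∈ Subgroup.closure s, g u = v) (h₂ : ∃ g ∈ Subgroup.closure s, g v = w) :
    ∃ g ∈ Subgroup.closure s, g u = w := by
  obtain ⟨g, hg, rfl⟩ := h₁
  obtain ⟨h, hh, rfl⟩ := h₂
  exact ⟨h * g, mul_mem hh hg, rfl⟩

theorem exists_mem_closure_symm {u v : α}
    (h : ∃ g ∈ Subgroup.closure s, g u = v) : ∃ g ∈ Subgroup.closure s, g v = u := by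
  obtain ⟨g, hg, rfl⟩ := h
  exact ⟨g⁻¹, inv_mem hg, by simp⟩

end

section

open Equiv Equiv.Perm

variable {α β : Type*} [Fintype α] [DecidableEq α] [Fintype β] [DecidableEq β]

theorem cycleLengthAt_eq_card_filter (σ : Perm α) (x : α) :
    cycleLengthAt σ x = (Finset.univ.filter fun z => SameCycle σ x z).card := by
  unfold cycleLengthAt
  split_ifs with h
  · rw [eq_comm, Finset.card_eq_one]
    refine ⟨x, ?_⟩
    ext z
    simp only [Finset.mem_filter_univ, Finset.mem_singleton]
    exact ⟨fun hz => (hz.eq_of_left h).symm, fun hz => hz ▸ SameCycle.rfl⟩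
  · congr 1
    ext z
    simp [mem_support_cycleOf_iff' h]

theorem cycleLengthAt_inv (σ : Perm α) (x : α) : cycleLengthAt σ⁻¹ x = cycleLengthAt σ x := by
  simp only [cycleLengthAt_eq_card_filter, sameCycle_inv]

theorem fullCycleType_inv (σ : Perm α) : fullCycleType σ⁻¹ = fullCycleType σ := by
  simp only [fullCycleType, cycleType_inv]

theorem cycleLengthAt_extendDomain {p : β → Prop} [DecidablePred p] (f : α ≃ Subtype p)
    (σ : Perm α) (x : α) :
    cycleLengthAt (σ.extendDomain f) (f x : β) = cycleLengthAt σ x := by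
  simp only [cycleLengthAt_eq_card_filter]
  symm
  refine Finset.card_bij (fun z _ => (f z : β)) (fun z hz => ?_) (fun z _ w _ h => ?_)
    fun w hw => ?_
  · simpa using hz
  · exact f.injective (Subtype.ext h)
  · rw [Finset.mem_filter_univ] at hw
    have hp : p w := by
      by_contra hp
      have := hw.symm.eq_of_left (extendDomain_apply_not_subtype _ _ hp)
      exact hp (this ▸ (f x).2)
    refine ⟨f.symm ⟨w, hp⟩, ?_, by simp⟩
    rw [Finset.mem_filter_univ, ← sameCycle_extendDomain (f := f)]
    simpa using hw

theorem fullCycleType_extendDomain {p : β → Prop} [DecidablePred p] (f : α ≃ Subtype p)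
    (σ : Perm α) :
    fullCycleType (σ.extendDomain f) =
      fullCycleType σ + Multiset.replicate (Fintype.card β - Fintype.card α) 1 := by
  have hle : Fintype.card α ≤ Fintype.card β :=
    Fintype.card_le_of_injective (fun z => (f z : β))
      (Subtype.val_injective.comp f.injective)
  have := sum_cycleType_le σ
  rw [fullCycleType, fullCycleType, cycleType_extendDomain, add_assoc, ← Multiset.replicate_add]
  congr 2
  omega

theorem cycleLengthAt_eq_support_card {σ : Perm α} {x : α} (hx : σ x ≠ x) :
    cycleLengthAt σ x = (σ.cycleOf x).support.card :=
  if_neg hx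

theorem cycleLengthAt_mem_fullCycleType (σ : Perm α) (x : α) :
    cycleLengthAt σ x ∈ fullCycleType σ := by
  by_cases hx : σ x = x
  · have hlt : σ.support.card < Fintype.card α :=
      Finset.card_lt_univ_of_notMem (notMem_support.2 hx)
    have h1 : cycleLengthAt σ x = 1 := if_pos hx
    rw [fullCycleType, h1, Multiset.mem_add, Multiset.mem_replicate, sum_cycleType]
    exact .inr ⟨by omega, rfl⟩
  · rw [cycleLengthAt_eq_support_card hx, fullCycleType, Multiset.mem_add, cycleType_def]
    exact .inl (Multiset.mem_map_of_mem _
      (cycleOf_mem_cycleFactorsFinset_iff.2 (mem_support.2 hx)))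

theorem card_support_cycleOf_mul_swap {σ : Perm α} {x y : α} (hxy : x ≠ y) (hy : σ y = y) :
    (σ.cycleOf x * swap x y).support.card = cycleLengthAt σ x + 1 := by
  rw [support_cycleOf_mul_swap hxy hy, Finset.card_insert_of_notMem]
  · congr 1
    unfold cycleLengthAt
    split_ifs with h
    · simp [(cycleOf_eq_one_iff σ).2 h]
    · rw [Finset.insert_eq_of_mem]
      rwa [mem_support, cycleOf_apply_self]
  · simpa only [Finset.mem_insert, hxy.symm, false_or, notMem_support] using
      cycleOf_apply_eq_self hy x

theorem cycleLengthAt_mul_swap {σ : Perm α} {x y : α} (hxy : x ≠ y) (hy : σ y = y) :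
    cycleLengthAt (σ * swap x y) x = cycleLengthAt σ x + 1 := by
  rw [cycleLengthAt_eq_support_card (by simpa [hy] using hxy.symm), cycleOf_mul_swap hxy hy,
    card_support_cycleOf_mul_swap hxy hy]

/-- Inserting a fixed point into the cycle through `x` lengthens that cycle by one. -/
theorem exists_fullCycleType_mul_swap {σ : Perm α} {x y : α} (hxy : x ≠ y) (hy : σ y = y) :
    ∃ M, fullCycleType σ = 1 ::ₘ cycleLengthAt σ x ::ₘ M ∧
      fullCycleType (σ * swap x y) = (cycleLengthAt σ x + 1) ::ₘ M := by
  set ρ := σ * (σ.cycleOf x)⁻¹ with hρ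
  have hg : (σ * swap x y).cycleType = ρ.cycleType + {cycleLengthAt σ x + 1} := by
    rw [mul_swap_eq, (disjoint_mul_inv_cycleOf_mul_swap hxy hy).cycleType_mul,
      (isCycle_cycleOf_mul_swap hxy hy).cycleType, card_support_cycleOf_mul_swap hxy hy]
  have hle := sum_cycleType_le (σ * swap x y)
  rw [hg, Multiset.sum_add, Multiset.sum_singleton] at hle
  refine ⟨ρ.cycleType +
    Multiset.replicate (Fintype.card α - (ρ.cycleType.sum + (cycleLengthAt σ x + 1))) 1, ?_, ?_⟩
  · by_cases hx : σ x = x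
    · have hσ : ρ = σ := by rw [hρ, (cycleOf_eq_one_iff σ).2 hx, inv_one, mul_one]
      have h1 : cycleLengthAt σ x = 1 := if_pos hx
      rw [h1] at hle ⊢
      rw [hσ] at hle ⊢
      rw [fullCycleType, ← Multiset.add_cons, ← Multiset.add_cons, ← Multiset.replicate_succ,
        ← Multiset.replicate_succ]
      congr 2
      omega
    · have hσ : σ.cycleType = ρ.cycleType + {cycleLengthAt σ x} := by
        conv_lhs => rw [← inv_mul_cancel_right σ (σ.cycleOf x)]
        rw [(disjoint_mul_inv_cycleOf σ x).cycleType_mul, (isCycle_cycleOf σ hx).cycleType,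
          cycleLengthAt_eq_support_card hx]
      rw [fullCycleType, hσ, Multiset.sum_add, Multiset.sum_singleton, Multiset.cons_swap,
        ← Multiset.add_cons, ← Multiset.replicate_succ, add_assoc, Multiset.singleton_add,
        Multiset.add_cons]
      congr 3
      omega
  · rw [fullCycleType, hg, Multiset.sum_add, Multiset.sum_singleton, add_assoc,
      Multiset.singleton_add, Multiset.add_cons]

/-- Inserting the last point of `Fin (n + 1)` into the cycle of `σ` through `x`. -/
theorem fullCycleType_extendDomain_mul_swap {n : ℕ} (σ : Perm (Fin n)) (x : Fin n) :
    fullCycleType (σ.extendDomain (finSuccAboveEquiv (Fin.last n)) *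
        swap x.castSucc (Fin.last n)) =
      (cycleLengthAt σ x + 1) ::ₘ (fullCycleType σ).erase (cycleLengthAt σ x) ∧
    cycleLengthAt (σ.extendDomain (finSuccAboveEquiv (Fin.last n)) *
        swap x.castSucc (Fin.last n)) x.castSucc = cycleLengthAt σ x + 1 := by
  have hx : x.castSucc ≠ Fin.last n := (Fin.castSucc_lt_last x).ne
  have hy : σ.extendDomain (finSuccAboveEquiv (Fin.last n)) (Fin.last n) = Fin.last n :=
    extendDomain_apply_not_subtype _ _ (by simp)
  have hlen : cycleLengthAt (σ.extendDomain (finSuccAboveEquiv (Fin.last n))) x.castSucc =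
      cycleLengthAt σ x := by
    have h := cycleLengthAt_extendDomain (finSuccAboveEquiv (Fin.last n)) σ x
    simpa only [finSuccAboveEquiv_apply, Fin.succAbove_last] using h
  obtain ⟨M, h1, h2⟩ := exists_fullCycleType_mul_swap hx hy
  rw [fullCycleType_extendDomain, hlen, Fintype.card_fin, Fintype.card_fin,
    Nat.add_sub_cancel_left, Multiset.replicate_one, add_comm, Multiset.singleton_add,
    Multiset.cons_inj_right] at h1
  rw [h2, cycleLengthAt_mul_swap hx hy, hlen, h1, Multiset.erase_cons_head]
  exact ⟨rfl, rfl⟩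

theorem extendDomain_finSuccAboveEquiv_last_castSucc {n : ℕ} (σ : Perm (Fin n)) (z : Fin n) :
    σ.extendDomain (finSuccAboveEquiv (Fin.last n)) z.castSucc = (σ z).castSucc := by
  have h := extendDomain_apply_image σ (finSuccAboveEquiv (Fin.last n)) z
  simpa only [finSuccAboveEquiv_apply, Fin.succAbove_last] using h

/-- Adding one point to a transitive tuple with product `1` by inserting it into the cycles of
the first two permutations at `x`. -/
theorem exists_insert_point {m n : ℕ} (σ : Fin (m + 2) → Perm (Fin n))
    (hprod : (List.ofFn σ).prod = 1) (htrans : IsTransitiveSet (Set.range σ)) (x : Fin n) :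
    ∃ (τ : Fin (m + 2) → Perm (Fin (n + 1))) (x' : Fin (n + 1)),
      (List.ofFn τ).prod = 1 ∧
      IsTransitiveSet (Set.range τ) ∧
      cycleLengthAt (τ 0) x' = cycleLengthAt (σ 0) x + 1 ∧
      cycleLengthAt (τ 1) x' = cycleLengthAt (σ 1) x + 1 ∧
      fullCycleType (τ 0) =
        (cycleLengthAt (σ 0) x + 1) ::ₘ (fullCycleType (σ 0)).erase (cycleLengthAt (σ 0) x) ∧
      fullCycleType (τ 1) =
        (cycleLengthAt (σ 1) x + 1) ::ₘ (fullCycleType (σ 1)).erase (cycleLengthAt (σ 1) x) ∧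
      ∀ j : Fin (m + 2), 2 ≤ (j : ℕ) → fullCycleType (τ j) = fullCycleType (σ j) + {1} := by
  set E := extendDomainHom (finSuccAboveEquiv (Fin.last n)) with hE
  have hEc : ∀ (g : Perm (Fin n)) (z : Fin n), E g z.castSucc = (g z).castSucc :=
    extendDomain_finSuccAboveEquiv_last_castSucc
  have hEl : ∀ g : Perm (Fin n), E g (Fin.last n) = Fin.last n := fun g =>
    extendDomain_apply_not_subtype _ _ (by simp)
  set s : Perm (Fin (n + 1)) := swap x.castSucc (Fin.last n) with hs
  have hxl : x.castSucc ≠ Fin.last n := (Fin.castSucc_lt_last x).ne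
  let τ : Fin (m + 2) → Perm (Fin (n + 1)) :=
    Fin.cons (E (σ 0) * s) (Fin.cons (s * E (σ 1)) fun j => E (σ j.succ.succ))
  have h0 : τ 0 = E (σ 0) * s := rfl
  have h1 : τ 1 = (E (σ 1)⁻¹ * s)⁻¹ := by
    rw [map_inv, mul_inv_rev, inv_inv, hs, swap_inv]
    rfl
  have hj : ∀ j : Fin m, τ j.succ.succ = E (σ j.succ.succ) := fun _ => rfl
  have hcase : ∀ j : Fin (m + 2), j = 0 ∨ j = 1 ∨ ∃ i : Fin m, j = i.succ.succ := by
    intro j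
    refine Fin.cases (.inl rfl) (fun j => ?_) j
    exact Fin.cases (.inr (.inl rfl)) (fun i => .inr (.inr ⟨i, rfl⟩)) j
  refine ⟨τ, x.castSucc, ?_, ?_, ?_, ?_, ?_, ?_, ?_⟩
  · rw [← map_one E, ← hprod, map_list_prod, List.map_ofFn]
    simp only [List.ofFn_succ, List.prod_cons, Function.comp_apply]
    have h1' : τ (Fin.succ 0) = s * E (σ (Fin.succ 0)) := rfl
    rw [h0, h1', mul_assoc, mul_assoc, ← mul_assoc s s, hs, swap_mul_self, one_mul]
    rfl
  · have hx : ∃ g ∈ Subgroup.closure (Set.range τ), g x.castSucc = Fin.last n :=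
      exists_mem_closure_of_sameCycle (Set.mem_range_self 0) (h0 ▸ sameCycle_mul_swap_self (hEl _))
    have hgen : ∀ (j : Fin (m + 2)) (z : Fin n),
        ∃ g ∈ Subgroup.closure (Set.range τ), g z.castSucc = (σ j z).castSucc := by
      intro j z
      have hz : z.castSucc ≠ Fin.last n := (Fin.castSucc_lt_last z).ne
      rcases hcase j with rfl | rfl | ⟨i, rfl⟩
      · refine exists_mem_closure_of_sameCycle (Set.mem_range_self 0) ?_
        rw [h0, ← hEc]
        exact sameCycle_mul_swap_apply hxl (hEl _) hz
      · refine exists_mem_closure_of_sameCycle (Set.mem_range_self 1) ?_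
        rw [h1, sameCycle_inv]
        refine SameCycle.symm ?_
        have := sameCycle_mul_swap_apply hxl (hEl (σ 1)⁻¹)
          (Fin.castSucc_lt_last (σ 1 z)).ne
        rwa [hEc, ← mul_apply, inv_mul_cancel, one_apply] at this
      · exact ⟨τ i.succ.succ, Subgroup.subset_closure ⟨_, rfl⟩, by rw [hj, hEc]⟩
    have hold : ∀ g ∈ Subgroup.closure (Set.range σ), ∀ z : Fin n,
        ∃ k ∈ Subgroup.closure (Set.range τ), k z.castSucc = (g z).castSucc := by
      intro g hg
      induction hg using Subgroup.closure_induction with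
      | mem g hg =>
        obtain ⟨j, rfl⟩ := hg
        exact hgen j
      | one => exact fun z => ⟨1, one_mem _, rfl⟩
      | mul g h _ _ ihg ihh => exact fun z => exists_mem_closure_trans (ihh z) (ihg (h z))
      | inv g _ ih =>
        intro z
        have := ih (g⁻¹ z)
        rw [← mul_apply, mul_inv_cancel, one_apply] at this
        exact exists_mem_closure_symm this
    have hbase : ∀ z : Fin (n + 1),
        ∃ g ∈ Subgroup.closure (Set.range τ), g x.castSucc = z := by
      intro z
      refine Fin.lastCases hx (fun z => ?_) z
      obtain ⟨g, hg, rfl⟩ := htrans x z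
      exact hold g hg x
    exact fun u v => exists_mem_closure_trans (exists_mem_closure_symm (hbase u)) (hbase v)
  · exact h0 ▸ (fullCycleType_extendDomain_mul_swap (σ 0) x).2
  · rw [h1, cycleLengthAt_inv, ← cycleLengthAt_inv (σ 1)]
    exact (fullCycleType_extendDomain_mul_swap (σ 1)⁻¹ x).2
  · exact h0 ▸ (fullCycleType_extendDomain_mul_swap (σ 0) x).1
  · rw [h1, fullCycleType_inv, ← fullCycleType_inv (σ 1), ← cycleLengthAt_inv (σ 1)]
    exact (fullCycleType_extendDomain_mul_swap (σ 1)⁻¹ x).1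
  · intro j h2
    rcases hcase j with rfl | rfl | ⟨i, rfl⟩
    · simp at h2
    · simp at h2
    · rw [hj, hE, extendDomainHom_apply, fullCycleType_extendDomain]
      simp

theorem exists_insert_points {m n : ℕ} (σ : Fin (m + 2) → Perm (Fin n))
    (hprod : (List.ofFn σ).prod = 1) (htrans : IsTransitiveSet (Set.range σ)) (x : Fin n)
    (k : ℕ) :
    ∃ (τ : Fin (m + 2) → Perm (Fin (n + k))) (x' : Fin (n + k)),
      (List.ofFn τ).prod = 1 ∧
      IsTransitiveSet (Set.range τ) ∧
      cycleLengthAt (τ 0) x' = cycleLengthAt (σ 0) x + k ∧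
      cycleLengthAt (τ 1) x' = cycleLengthAt (σ 1) x + k ∧
      fullCycleType (τ 0) =
        (cycleLengthAt (σ 0) x + k) ::ₘ (fullCycleType (σ 0)).erase (cycleLengthAt (σ 0) x) ∧
      fullCycleType (τ 1) =
        (cycleLengthAt (σ 1) x + k) ::ₘ (fullCycleType (σ 1)).erase (cycleLengthAt (σ 1) x) ∧
      ∀ j : Fin (m + 2), 2 ≤ (j : ℕ) →
        fullCycleType (τ j) = fullCycleType (σ j) + Multiset.replicate k 1 := by
  induction k with
  | zero =>
    exact ⟨σ, x, hprod, htrans, rfl, rfl,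
      (Multiset.cons_erase (cycleLengthAt_mem_fullCycleType _ _)).symm,
      (Multiset.cons_erase (cycleLengthAt_mem_fullCycleType _ _)).symm, fun j _ => by simp⟩
  | succ k ih =>
    obtain ⟨τ, x', hp, ht, ha, hb, h0, h1, hj⟩ := ih
    obtain ⟨τ', x'', hp', ht', ha', hb', h0', h1', hj'⟩ := exists_insert_point τ hp ht x'
    refine ⟨τ', x'', hp', ht', by rw [ha', ha, add_assoc], by rw [hb', hb, add_assoc], ?_, ?_, ?_⟩
    · rw [h0', ha, h0, Multiset.erase_cons_head, add_assoc]
    · rw [h1', hb, h1, Multiset.erase_cons_head, add_assoc]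
    · intro j h2
      rw [hj' j h2, hj j h2, add_assoc, Multiset.replicate_add, Multiset.replicate_one]

end

/-- Lemma 3.2 in permutation form: from a transitive product-one tuple (σ₁,…,σ_r) on n points
with a point x lying in a cycle of σ₁ of length a and in a cycle of σ₂ of length b, one obtains,
for every k, a transitive product-one tuple (τ₁,…,τ_r) on n+k points where one cycle of
length a of τ₁ is replaced by one of length a+k, one cycle of length b of τ₂ by one of length
b+k, and each τ_j for j ≥ 3 gains k extra fixed points. -/
theorem stmt11 (r n : ℕ) (hr : 3 ≤ r)
    (σ : Fin r → Equiv.Perm (Fin n))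
    (hprod : (List.ofFn σ).prod = 1)
    (htrans : IsTransitiveSet (Set.range σ))
    (x : Fin n) (a b : ℕ)
    (ha : cycleLengthAt (σ ⟨0, by omega⟩) x = a)
    (hb : cycleLengthAt (σ ⟨1, by omega⟩) x = b)
    (k : ℕ) :
    ∃ τ : Fin r → Equiv.Perm (Fin (n + k)),
      (List.ofFn τ).prod = 1 ∧
      IsTransitiveSet (Set.range τ) ∧
      fullCycleType (τ ⟨0, by omega⟩) =
        (a + k) ::ₘ (fullCycleType (σ ⟨0, by omega⟩)).erase a ∧
      fullCycleType (τ ⟨1, by omega⟩) =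
        (b + k) ::ₘ (fullCycleType (σ ⟨1, by omega⟩)).erase b ∧
      ∀ j : Fin r, 2 ≤ (j : ℕ) →
        fullCycleType (τ j) = fullCycleType (σ j) + Multiset.replicate k 1 := by
  obtain ⟨m, rfl⟩ : ∃ m, r = m + 2 := ⟨r - 2, by omega⟩
  subst ha hb
  obtain ⟨τ, -, hp, ht, -, -, h0, h1, hj⟩ := exists_insert_points σ hprod htrans x k
  exact ⟨τ, hp, ht, h0, h1, hj⟩
end

section
/- For every integer m ≥ 1 there exist permutations σ₁, σ₂, σ₃, σ₄ of {1,…,2m}, each a fixed-point-free involution (full cycle type consisting of m copies of 2), such that σ₁σ₂σ₃σ₄ = 1 and the subgroup generated by σ₁, σ₂, σ₃, σ₄ acts transitively on {1,…,2m}. (That is, the regular genus-1 ramification data [2^m][2^m][2^m][2^m] is realizable in every even degree; these realizations come from tilings of the torus by squares.) -/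
open Equiv in
theorem fullCycleType_of_fixedPointFree_involution {m : ℕ} (σ : Perm (Fin (2 * m)))
    (hσ : σ * σ = 1) (hfix : ∀ x, σ x ≠ x) :
    fullCycleType σ = Multiset.replicate m 2 := by
  have hmem : ∀ c ∈ σ.cycleType, c = 2 := fun c hc =>
    le_antisymm
      (Nat.le_of_dvd two_pos ((Perm.dvd_of_mem_cycleType hc).trans
        (orderOf_dvd_of_pow_eq_one (by rw [pow_two, hσ]))))
      (Perm.two_le_of_mem_cycleType hc)
  have hrep := Multiset.eq_replicate_of_mem hmem
  have hsupp : σ.support = Finset.univ := by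
    ext x
    simpa using hfix x
  have hsum : σ.cycleType.sum = 2 * m := by
    rw [Perm.sum_cycleType, hsupp, Finset.card_univ, Fintype.card_fin]
  have hcard : σ.cycleType.card = m := by
    have h := hsum
    rw [hrep, Multiset.sum_replicate, smul_eq_mul] at h
    omega
  rw [fullCycleType, hsum, Fintype.card_fin, Nat.sub_self, Multiset.replicate_zero, add_zero,
    hrep, hcard]

theorem isTransitiveSet_of_forall_exists {α : Type*} {s : Set (Equiv.Perm α)} (x₀ : α)
    (h : ∀ y, ∃ g ∈ Subgroup.closure s, g x₀ = y) : IsTransitiveSet s := by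
  intro x y
  obtain ⟨g, hg, rfl⟩ := h x
  obtain ⟨k, hk, rfl⟩ := h y
  exact ⟨k * g⁻¹, mul_mem hk (inv_mem hg), by simp⟩

theorem fin_val_add_self_mod_two {m : ℕ} (x : Fin (2 * m)) : (x + x).val % 2 = 0 := by
  rw [Fin.val_add, Nat.mod_mod_of_dvd _ (dvd_mul_right 2 m)]
  omega

open Fin.NatCast Fin.CommRing in
theorem fin_sub_rev {n : ℕ} [NeZero n] (x : Fin n) : 1 - x.rev = x + 2 := by
  have h : x.rev + x + 1 = 0 := by
    apply Fin.ext
    have hx := x.isLt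
    simp only [Fin.val_add, Fin.val_rev, Fin.coe_ofNat_eq_mod, Nat.mod_add_mod,
      Nat.add_mod_mod]
    rw [show n - (x.val + 1) + x.val + 1 = n by omega, Nat.mod_self, Nat.zero_mod]
  linear_combination -h

/-- The regular genus-1 ramification data [2^m][2^m][2^m][2^m] is realizable in every even
degree 2m (from tilings of the torus by squares). -/
theorem stmt12 (m : ℕ) (hm : 1 ≤ m) :
    Realizable (2 * m)
      [Multiset.replicate m 2, Multiset.replicate m 2,
        Multiset.replicate m 2, Multiset.replicate m 2] := by
  open Fin.NatCast Fin.CommRing in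
  have : NeZero (2 * m) := ⟨by omega⟩
  let a : Equiv.Perm (Fin (2 * m)) := Equiv.subLeft 1
  let b : Equiv.Perm (Fin (2 * m)) := Fin.revPerm
  have haa : a * a = 1 := by
    ext x
    simp [a]
  have hbb : b * b = 1 := by
    ext x
    simp [b]
  have ha : fullCycleType a = Multiset.replicate m 2 := by
    refine fullCycleType_of_fixedPointFree_involution a haa fun x hx => ?_
    have h := fin_val_add_self_mod_two x
    rw [← sub_eq_iff_eq_add.mp (show 1 - x = x from hx), Fin.val_one',
      Nat.mod_mod_of_dvd _ (dvd_mul_right 2 m)] at h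
    omega
  have hb : fullCycleType b = Multiset.replicate m 2 := by
    refine fullCycleType_of_fixedPointFree_involution b hbb fun x hx => ?_
    have h := congrArg Fin.val (show x.rev = x from hx)
    rw [Fin.val_rev] at h
    omega
  have hab : ∀ (k : ℕ) (x : Fin (2 * m)), ((a * b) ^ k) x = x + ((2 * k : ℕ) : Fin (2 * m)) := by
    intro k x
    induction k with
    | zero => simp
    | succ k ih =>
      rw [pow_succ', Equiv.Perm.mul_apply, ih]
      refine (fin_sub_rev _).trans ?_
      push_cast
      ring
  refine ⟨[a, a, b, b], by simp [ha, hb], by simp [haa, hbb], ?_⟩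
  have hma : a ∈ Subgroup.closure {g | g ∈ [a, a, b, b]} := Subgroup.subset_closure (by simp)
  have hmb : b ∈ Subgroup.closure {g | g ∈ [a, a, b, b]} := Subgroup.subset_closure (by simp)
  refine isTransitiveSet_of_forall_exists 0 fun y => ?_
  have hk := pow_mem (mul_mem hma hmb) (y.val / 2)
  rcases Nat.mod_two_eq_zero_or_one y.val with hy | hy
  · refine ⟨_, hk, ?_⟩
    rw [hab, show 2 * (y.val / 2) = y.val by omega, zero_add, Fin.cast_val_eq_self]
  · refine ⟨_, mul_mem hk hma, ?_⟩
    have hy' : ((2 * (y.val / 2) + 1 : ℕ) : Fin (2 * m)) = y := by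
      rw [show 2 * (y.val / 2) + 1 = y.val by omega, Fin.cast_val_eq_self]
    rw [Equiv.Perm.mul_apply, hab, show a 0 = 1 from sub_zero 1, add_comm]
    rw [Nat.cast_add, Nat.cast_one] at hy'
    exact hy'
end

section
/- For every integer m ≥ 1 there exist permutations σ₁, σ₂, σ₃ of {1,…,3m}, each with full cycle type consisting of m copies of 3, such that σ₁σ₂σ₃ = 1 and the subgroup generated by σ₁, σ₂, σ₃ acts transitively on {1,…,3m}. (That is, the regular genus-1 ramification data [3^m][3^m][3^m] is realizable in every degree divisible by 3; these realizations come from tilings of the torus by m hexagons.) -/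
/-- A fixed-point-free permutation with trivial cube on `3 * m` points is a product of `m`
disjoint 3-cycles. -/
theorem fullCycleType_eq_replicate_three {α : Type*} [Fintype α] [DecidableEq α] {m : ℕ}
    (hcard : Fintype.card α = 3 * m) {σ : Equiv.Perm α} (hpow : σ ^ 3 = 1)
    (hfix : ∀ x, σ x ≠ x) : fullCycleType σ = Multiset.replicate m 3 := by
  have hmem : ∀ k ∈ σ.cycleType, k = 3 := fun k hk =>
    (Nat.prime_three.eq_one_or_self_of_dvd k
      ((Equiv.Perm.dvd_of_mem_cycleType hk).trans (orderOf_dvd_of_pow_eq_one hpow))).resolve_left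
      (Equiv.Perm.one_lt_of_mem_cycleType hk).ne'
  have hsum : σ.cycleType.sum = 3 * m := by
    rw [Equiv.Perm.sum_cycleType, ← hcard, ← Finset.card_univ]
    congr 1
    ext x
    simp [hfix x]
  have hrep := Multiset.eq_replicate_card.mpr hmem
  have hc : Multiset.card σ.cycleType = m := by
    rw [hrep, Multiset.sum_replicate, smul_eq_mul] at hsum
    omega
  rw [hc] at hrep
  rw [fullCycleType, hsum, hcard, hrep]
  simp

/-- The permutation of `Fin 3 × G` that rotates the first coordinate and translates the fibre
over `i` by `a i`. -/
def skewRotation {G : Type*} [AddGroup G] (a : Fin 3 → G) : Equiv.Perm (Fin 3 × G) where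
  toFun p := (p.1 + 1, p.2 + a p.1)
  invFun p := (p.1 - 1, p.2 - a (p.1 - 1))
  left_inv p := by simp
  right_inv p := by simp

@[simp]
theorem skewRotation_apply {G : Type*} [AddGroup G] (a : Fin 3 → G) (p : Fin 3 × G) :
    skewRotation a p = (p.1 + 1, p.2 + a p.1) :=
  rfl

theorem skewRotation_apply_ne {G : Type*} [AddGroup G] (a : Fin 3 → G) (p : Fin 3 × G) :
    skewRotation a p ≠ p := fun h => by
  simpa using congrArg Prod.fst h

theorem skewRotation_mul_mul_eq_one {G : Type*} [AddGroup G] {a b c : Fin 3 → G}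
    (h : ∀ i, c i + b (i + 1) + a (i + 2) = 0) :
    skewRotation a * skewRotation b * skewRotation c = 1 := by
  ext1 ⟨i, x⟩
  have h1 : i + 1 + 1 = i + 2 := by rw [add_assoc]; rfl
  have h2 : i + 2 + 1 = i := by rw [add_assoc]; exact add_zero i
  simp [h1, h2, add_assoc, ← h i]

/-- A transitive triple of products of `m` disjoint 3-cycles on any set with `3 * m` elements
gives a realization. -/
theorem realizable_replicate_three {α : Type*} [Fintype α] {m : ℕ}
    (hcard : Fintype.card α = 3 * m) {σ τ ρ : Equiv.Perm α}
    (hσ : σ ^ 3 = 1) (hτ : τ ^ 3 = 1) (hρ : ρ ^ 3 = 1)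
    (hσ' : ∀ x, σ x ≠ x) (hτ' : ∀ x, τ x ≠ x) (hρ' : ∀ x, ρ x ≠ x)
    (hprod : σ * τ * ρ = 1) (htrans : IsTransitiveSet {g | g ∈ [σ, τ, ρ]}) :
    Realizable (3 * m)
      [Multiset.replicate m 3, Multiset.replicate m 3, Multiset.replicate m 3] := by
  let e : α ≃ Fin (3 * m) := Fintype.equivFinOfCardEq hcard
  let φ := e.permCongrHom
  have hφ : ∀ g x, φ g x = e (g (e.symm x)) := fun _ _ => rfl
  have htype : ∀ g : Equiv.Perm α, g ^ 3 = 1 → (∀ x, g x ≠ x) →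
      fullCycleType (φ g) = Multiset.replicate m 3 := by
    intro g hg hg'
    refine fullCycleType_eq_replicate_three (by simp) (by rw [← map_pow, hg, map_one]) ?_
    intro x hx
    exact hg' (e.symm x) (e.eq_symm_apply.mpr hx)
  refine ⟨[σ, τ, ρ].map φ, ?_, ?_, ?_⟩
  · simp [htype σ hσ hσ', htype τ hτ hτ', htype ρ hρ hρ']
  · rw [← map_list_prod]
    simp [← mul_assoc, hprod]
  · intro x y
    obtain ⟨g, hg, hgx⟩ := htrans (e.symm x) (e.symm y)
    refine ⟨φ g, ?_, by rw [hφ, hgx, e.apply_symm_apply]⟩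
    have hmap := Subgroup.mem_map_of_mem φ.toMonoidHom hg
    rw [MonoidHom.map_closure] at hmap
    refine Subgroup.closure_mono ?_ hmap
    rintro _ ⟨h, hh, rfl⟩
    exact List.mem_map_of_mem hh

/-- Two skew rotations, one of them untwisted and the other translating the fibre over `0` by a
generator, generate a transitive group. -/
theorem isTransitiveSet_of_skewRotation_mem {m : ℕ} {s : Set (Equiv.Perm (Fin 3 × ZMod m))}
    {b : Fin 3 → ZMod m} (hb : b 0 = 1) (h0 : skewRotation 0 ∈ s) (h1 : skewRotation b ∈ s) :
    IsTransitiveSet s := by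
  have hr := Subgroup.subset_closure h0
  have ht := Subgroup.mul_mem _ (Subgroup.inv_mem _ hr) (Subgroup.subset_closure h1)
  set t : Equiv.Perm (Fin 3 × ZMod m) := (skewRotation 0)⁻¹ * skewRotation b with ht_def
  have hfib : ∀ n : ℤ, (t ^ n) (0, 0) = (0, (n : ZMod m)) := by
    have hstep : ∀ x : ZMod m, t (0, x) = (0, x + 1) := by
      intro x
      rw [ht_def, Equiv.Perm.mul_apply, Equiv.Perm.inv_eq_iff_eq]
      simp [hb]
    intro n
    induction n with
    | zero => simp
    | succ n ih => rw [add_comm, zpow_add, Equiv.Perm.mul_apply, ih, zpow_one, hstep]; simp [add_comm]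
    | pred n ih =>
      rw [sub_eq_neg_add, zpow_add, Equiv.Perm.mul_apply, ih, zpow_neg_one,
        Equiv.Perm.inv_eq_iff_eq, hstep]
      simp
  have hrot : ∀ (i : Fin 3) (x : ZMod m), ∃ k : ℕ,
      (skewRotation (0 : Fin 3 → ZMod m) ^ k) (0, x) = (i, x) := by
    intro i x
    refine ⟨i.val, ?_⟩
    fin_cases i <;> simp [pow_two]
  have hbase : ∀ p : Fin 3 × ZMod m, ∃ g ∈ Subgroup.closure s, g (0, 0) = p := by
    rintro ⟨i, x⟩
    obtain ⟨n, rfl⟩ := ZMod.intCast_surjective x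
    obtain ⟨k, hk⟩ := hrot i n
    refine ⟨_, Subgroup.mul_mem _ (Subgroup.pow_mem _ hr k) (Subgroup.zpow_mem _ ht n), ?_⟩
    rw [Equiv.Perm.mul_apply, hfib, hk]
  intro p q
  obtain ⟨g, hg, rfl⟩ := hbase p
  obtain ⟨h, hh, rfl⟩ := hbase q
  exact ⟨h * g⁻¹, Subgroup.mul_mem _ hh (Subgroup.inv_mem _ hg), by simp⟩

/-- The regular genus-1 ramification data [3^m][3^m][3^m] is realizable in every degree 3m
(from tilings of the torus by m hexagons). -/
theorem stmt13 (m : ℕ) (hm : 1 ≤ m) :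
    Realizable (3 * m)
      [Multiset.replicate m 3, Multiset.replicate m 3, Multiset.replicate m 3] := by
  have : NeZero m := ⟨by omega⟩
  have hcube : ∀ a : Fin 3 → ZMod m, a 0 + a 1 + a 2 = 0 → skewRotation a ^ 3 = 1 := by
    intro a ha
    rw [pow_succ, pow_two]
    refine skewRotation_mul_mul_eq_one fun i => ?_
    fin_cases i <;> rw [← ha] <;> simp <;> ring
  refine realizable_replicate_three (α := Fin 3 × ZMod m) (by simp)
    (σ := skewRotation 0) (τ := skewRotation ![1, -1, 0]) (ρ := skewRotation ![1, 0, -1])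
    (hcube _ (by simp)) (hcube _ (by simp)) (hcube _ (by simp))
    (skewRotation_apply_ne _) (skewRotation_apply_ne _) (skewRotation_apply_ne _)
    (skewRotation_mul_mul_eq_one fun i => ?_)
    (isTransitiveSet_of_skewRotation_mem (b := ![1, -1, 0]) rfl (by simp) (by simp))
  fin_cases i <;> simp
end

section
/- For every integer m ≥ 1 there exist permutations σ₁, σ₂, σ₃ of {1,…,4m} such that σ₁σ₂σ₃ = 1, the subgroup generated by σ₁, σ₂, σ₃ acts transitively on {1,…,4m}, the full cycle type of σ₁ consists of 2m copies of 2, and the full cycle types of σ₂ and σ₃ each consist of m copies of 4. (That is, the regular genus-1 ramification data [2^{2m}][4^m][4^m] is realizable in every degree divisible by 4; these realizations come from tilings of the torus by m squares.) -/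
open Equiv Equiv.Perm in
/-- A permutation of order dividing `d` that shifts a label in an additive group by a constant of
additive order `d` has all its cycles of length `d`. -/
theorem fullCycleType_of_label {α : Type*} [Fintype α] [DecidableEq α] (g : Perm α)
    {A : Type*} [AddGroup A] (s : α → A) (a : A) {d r : ℕ} (hd : 1 < d) (ha : addOrderOf a = d)
    (hs : ∀ x, s (g x) = s x + a) (hg : g ^ d = 1) (hcard : Fintype.card α = r * d) :
    fullCycleType g = Multiset.replicate r d := by
  have label_pow : ∀ (n : ℕ) x, s ((g ^ n) x) = s x + n • a := by
    intro n
    induction n with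
    | zero => simp
    | succ n ih => intro x; rw [pow_succ', mul_apply, hs, ih, succ_nsmul, add_assoc]
  have dvd_of_fixed : ∀ (n : ℕ) x, (g ^ n) x = x → d ∣ n := by
    intro n x hx
    have h := label_pow n x
    rw [hx, left_eq_add] at h
    exact ha ▸ addOrderOf_dvd_of_nsmul_eq_zero h
  have hsupp : g.support = Finset.univ := by
    ext x
    simp only [mem_support, Finset.mem_univ, iff_true]
    intro hx
    have := Nat.le_of_dvd one_pos (dvd_of_fixed 1 x (by simpa using hx))
    omega
  have hsum : g.cycleType.sum = Fintype.card α := by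
    rw [sum_cycleType, hsupp, Finset.card_univ]
  have hall : ∀ c ∈ g.cycleType, c = d := by
    intro c hc
    refine Nat.dvd_antisymm ((dvd_of_mem_cycleType hc).trans (orderOf_dvd_of_pow_eq_one hg)) ?_
    rw [cycleType_def, Multiset.mem_map] at hc
    obtain ⟨τ, hτ, rfl⟩ := hc
    have hτ' : τ ∈ g.cycleFactorsFinset := hτ
    have hcyc := (mem_cycleFactorsFinset_iff.mp hτ').1
    obtain ⟨x, hx, -⟩ := id hcyc
    have hxs : x ∈ τ.support := mem_support.mpr hx
    refine dvd_of_fixed _ x ?_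
    have hgx : τ = g.cycleOf x := cycle_is_cycleOf hxs hτ'
    rw [Function.comp_apply, ← hcyc.orderOf, ← cycleOf_pow_apply_self, ← hgx, pow_orderOf_eq_one,
      one_apply]
  have hrep := Multiset.eq_replicate_card.mpr hall
  have hcount : Multiset.card g.cycleType = r := by
    rw [hrep, Multiset.sum_replicate, smul_eq_mul, hcard] at hsum
    exact Nat.eq_of_mul_eq_mul_right (by omega) hsum
  rw [fullCycleType, hsum, Nat.sub_self, Multiset.replicate_zero, add_zero, hrep, hcount]

namespace SquareTorus

/-- The change of square when crossing a side; the sides are numbered counterclockwise starting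
from the east side. -/
def shift (m : ℕ) (k : ZMod 4) : ZMod m :=
  if k = 0 then 1 else if k = 2 then -1 else 0

theorem shift_add_two (m : ℕ) (k : ZMod 4) : shift m (k + 2) = -shift m k := by
  have h : ∀ k : ZMod 4, (k + 2 = 0 ↔ k = 2) ∧ (k + 2 = 2 ↔ k = 0) ∧ (k = 0 → k ≠ 2) := by
    decide
  obtain ⟨h₁, h₂, h₃⟩ := h k
  simp only [shift, h₁, h₂]
  split_ifs <;> simp_all

/-- The involution exchanging the two sides glued along each edge of the torus tiled by a
horizontal strip of `m` squares. -/
def edge (m : ℕ) : Equiv.Perm (ZMod m × ZMod 4) :=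
  Function.Involutive.toPerm (fun x => (x.1 + shift m x.2, x.2 + 2)) fun x => by
    have h : ∀ k : ZMod 4, k + 2 + 2 = k := by decide
    ext1
    · simp [shift_add_two]
    · exact h x.2

/-- The counterclockwise rotation of the sides of each square. -/
def face (m : ℕ) : Equiv.Perm (ZMod m × ZMod 4) :=
  Equiv.prodCongr (Equiv.refl _) (Equiv.addRight 1)

theorem edge_apply (m : ℕ) (x : ZMod m × ZMod 4) :
    edge m x = (x.1 + shift m x.2, x.2 + 2) := rfl

theorem face_apply (m : ℕ) (x : ZMod m × ZMod 4) : face m x = (x.1, x.2 + 1) := rfl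

theorem edge_sq (m : ℕ) : edge m ^ 2 = 1 := by
  ext1 x
  rw [pow_two]
  exact Function.Involutive.toPerm_involutive _ x

theorem face_pow_apply (m n : ℕ) (x : ZMod m × ZMod 4) : (face m ^ n) x = (x.1, x.2 + n) := by
  induction n with
  | zero => simp
  | succ n ih => rw [pow_succ', Equiv.Perm.mul_apply, ih, face_apply]; simp [add_assoc]

theorem face_pow_four (m : ℕ) : face m ^ 4 = 1 := by
  ext1 x
  rw [face_pow_apply, show ((4 : ℕ) : ZMod 4) = 0 by decide, add_zero]
  rfl

/-- The rotation of the sides around each vertex. -/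
def vertex (m : ℕ) : Equiv.Perm (ZMod m × ZMod 4) := (face m)⁻¹ * edge m

theorem vertex_apply (m : ℕ) (x : ZMod m × ZMod 4) :
    vertex m x = (x.1 + shift m x.2, x.2 + 1) := by
  rw [vertex, Equiv.Perm.mul_apply, Equiv.Perm.inv_eq_iff_eq, edge_apply, face_apply, add_assoc]
  rfl

theorem vertex_pow_four (m : ℕ) : vertex m ^ 4 = 1 := by
  ext1 x
  have h : ∀ k : ZMod 4, k + 1 + 1 = k + 2 ∧ k + 2 + 1 = k + 1 + 2 ∧ k + 1 + 2 + 1 = k := by decide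
  obtain ⟨h₁, h₂, h₃⟩ := h x.2
  simp only [pow_succ, pow_zero, one_mul, Equiv.Perm.mul_apply, vertex_apply, h₁, h₂, h₃,
    shift_add_two, Equiv.Perm.one_apply]
  ext1
  · ring
  · rfl

theorem edge_mul_face_mul_vertex (m : ℕ) : edge m * (face m * vertex m) = 1 := by
  rw [vertex, mul_inv_cancel_left, ← pow_two, edge_sq]

theorem translation_pow_apply (m n : ℕ) :
    ((face m ^ 2 * edge m) ^ n) (0, 0) = ((n : ZMod m), 0) := by
  induction n with
  | zero => simp
  | succ n ih =>
    rw [pow_succ', Equiv.Perm.mul_apply, ih, Equiv.Perm.mul_apply, edge_apply, face_pow_apply]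
    ext1
    · simp [shift]
    · exact (by decide : (0 : ZMod 4) + 2 + (2 : ℕ) = 0)

theorem exists_word (m : ℕ) [NeZero m] (x : ZMod m × ZMod 4) :
    ∃ j n : ℕ, (face m ^ j * (face m ^ 2 * edge m) ^ n) (0, 0) = x := by
  refine ⟨x.2.val, x.1.val, ?_⟩
  rw [Equiv.Perm.mul_apply, translation_pow_apply, face_pow_apply]
  simp

end SquareTorus

open SquareTorus in
/-- The regular genus-1 ramification data [2^{2m}][4^m][4^m] is realizable in every degree 4m
(from tilings of the torus by m squares). -/
theorem stmt14 (m : ℕ) (hm : 1 ≤ m) :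
    Realizable (4 * m)
      [Multiset.replicate (2 * m) 2, Multiset.replicate m 4, Multiset.replicate m 4] := by
  have : NeZero m := ⟨by omega⟩
  let φ : ZMod m × ZMod 4 ≃ Fin (4 * m) :=
    Fintype.equivFinOfCardEq (by rw [Fintype.card_prod, ZMod.card, ZMod.card, mul_comm])
  let Φ : Equiv.Perm (ZMod m × ZMod 4) ≃* Equiv.Perm (Fin (4 * m)) := φ.permCongrHom
  have hΦ : ∀ g x, Φ g x = φ (g (φ.symm x)) := fun _ _ => rfl
  have order_one : addOrderOf (1 : ZMod 4) = 4 := ZMod.addOrderOf_one 4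
  have order_two : addOrderOf (2 : ZMod 4) = 2 :=
    addOrderOf_eq_prime (by decide) (by decide)
  refine ⟨[Φ (edge m), Φ (face m), Φ (vertex m)], ?_, ?_, ?_⟩
  · have hE : fullCycleType (Φ (edge m)) = Multiset.replicate (2 * m) 2 :=
      fullCycleType_of_label _ (fun x => (φ.symm x).2) 2 (by norm_num) order_two
        (fun x => by simp [hΦ, edge_apply]) (by rw [← map_pow, edge_sq, map_one])
        (by rw [Fintype.card_fin]; ring)
    have hF : fullCycleType (Φ (face m)) = Multiset.replicate m 4 :=
      fullCycleType_of_label _ (fun x => (φ.symm x).2) 1 (by norm_num) order_one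
        (fun x => by simp [hΦ, face_apply]) (by rw [← map_pow, face_pow_four, map_one])
        (by rw [Fintype.card_fin]; ring)
    have hV : fullCycleType (Φ (vertex m)) = Multiset.replicate m 4 :=
      fullCycleType_of_label _ (fun x => (φ.symm x).2) 1 (by norm_num) order_one
        (fun x => by simp [hΦ, vertex_apply]) (by rw [← map_pow, vertex_pow_four, map_one])
        (by rw [Fintype.card_fin]; ring)
    simp only [List.map_cons, List.map_nil, hE, hF, hV]
  · simp only [List.prod_cons, List.prod_nil, mul_one, ← map_mul, edge_mul_face_mul_vertex,
      map_one]
  · set S : Set (Equiv.Perm (Fin (4 * m))) := {g | g ∈ [Φ (edge m), Φ (face m), Φ (vertex m)]}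
    have edge_mem : Φ (edge m) ∈ Subgroup.closure S := Subgroup.subset_closure (by simp [S])
    have face_mem : Φ (face m) ∈ Subgroup.closure S := Subgroup.subset_closure (by simp [S])
    have reach : ∀ x, ∃ g ∈ Subgroup.closure S, g (φ (0, 0)) = x := by
      intro x
      obtain ⟨j, n, h⟩ := exists_word m (φ.symm x)
      refine ⟨Φ (face m ^ j * (face m ^ 2 * edge m) ^ n), ?_, ?_⟩
      · simp only [map_mul, map_pow]
        exact mul_mem (pow_mem face_mem _) (pow_mem (mul_mem (pow_mem face_mem _) edge_mem) _)
      · rw [hΦ, φ.symm_apply_apply, h, φ.apply_symm_apply]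
    intro x y
    obtain ⟨g, hg, rfl⟩ := reach x
    obtain ⟨h, hh, rfl⟩ := reach y
    exact ⟨h * g⁻¹, mul_mem hh (inv_mem hg), by simp⟩
end

section
/- For every integer m ≥ 1 there exist permutations σ₁, σ₂, σ₃ of {1,…,6m} such that σ₁σ₂σ₃ = 1, the subgroup generated by σ₁, σ₂, σ₃ acts transitively on {1,…,6m}, the full cycle type of σ₁ consists of 3m copies of 2, the full cycle type of σ₂ consists of 2m copies of 3, and the full cycle type of σ₃ consists of m copies of 6. (That is, the regular genus-1 ramification data [2^{3m}][3^{2m}][6^m] is realizable in every degree divisible by 6; these realizations come from tilings of the torus by m hexagons.) -/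
open Equiv Equiv.Perm

/-- If all orbits of a permutation have length exactly `d`, its full cycle type is constant. -/
theorem fullCycleType_eq_replicate {α : Type*} [Fintype α] [DecidableEq α] (σ : Perm α)
    (d k : ℕ) (hd : 2 ≤ d) (hcard : Fintype.card α = k * d) (hpow : σ ^ d = 1)
    (hfix : ∀ j, 0 < j → j < d → ∀ x, (σ ^ j) x ≠ x) :
    fullCycleType σ = Multiset.replicate k d := by
  have hsupp : σ.support = Finset.univ := by
    ext x
    simpa using hfix 1 one_pos (by omega) x
  have hmem : ∀ c ∈ σ.cycleType, c = d := by
    intro c hc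
    have hdvd : c ∣ d := (dvd_of_mem_cycleType hc).trans (orderOf_dvd_of_pow_eq_one hpow)
    have hle : c ≤ d := Nat.le_of_dvd (by omega) hdvd
    have hpos : 2 ≤ c := two_le_of_mem_cycleType hc
    by_contra hne
    rw [cycleType_def, Multiset.mem_map] at hc
    obtain ⟨τ, hτ, rfl⟩ := hc
    obtain ⟨x, hx⟩ := ((mem_cycleFactorsFinset_iff.mp hτ).1).nonempty_support
    have hτx : τ = σ.cycleOf x := cycle_is_cycleOf hx hτ
    refine hfix _ (by omega) (lt_of_le_of_ne hle hne) x ?_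
    rw [← cycleOf_pow_apply_self, ← hτx]
    have hord : orderOf τ = τ.support.card := (mem_cycleFactorsFinset_iff.mp hτ).1.orderOf
    simp [← hord, pow_orderOf_eq_one]
  have hrep : σ.cycleType = Multiset.replicate (Multiset.card σ.cycleType) d :=
    Multiset.eq_replicate_card.mpr hmem
  have hsum : σ.cycleType.sum = k * d := by
    rw [sum_cycleType, hsupp, Finset.card_univ, hcard]
  have hk : Multiset.card σ.cycleType = k := by
    rw [hrep, Multiset.sum_replicate, smul_eq_mul] at hsum
    exact Nat.eq_of_mul_eq_mul_right (by omega) hsum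
  rw [fullCycleType, hsum, hcard, Nat.sub_self, Multiset.replicate_zero, add_zero, hrep, hk]

/-- The displacement from a hexagon to its neighbour across each of the six edges. -/
def hexShift (m : ℕ) (j : ZMod 6) : ZMod m :=
  (![1, 0, -1, -1, 0, 1] : Fin 6 → ZMod m) j

theorem hexShift_add_three (m : ℕ) (j : ZMod 6) : hexShift m (j + 3) = -hexShift m j := by
  fin_cases j <;> simp [hexShift] <;> rfl

theorem hexShift_add_add (m : ℕ) (j : ZMod 6) :
    hexShift m j + hexShift m (j + 4) + hexShift m (j + 4 + 4) = 0 := by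
  fin_cases j
  · change (1 : ZMod m) + 0 + -1 = 0; ring
  · change (0 : ZMod m) + 1 + -1 = 0; ring
  · change (-1 : ZMod m) + 1 + 0 = 0; ring
  · change (-1 : ZMod m) + 0 + 1 = 0; ring
  · change (0 : ZMod m) + -1 + 1 = 0; ring
  · change (1 : ZMod m) + -1 + 0 = 0; ring

/-- Rotation of the sides of every hexagon. -/
def hexRotate (m : ℕ) : Perm (ZMod m × ZMod 6) :=
  (Equiv.refl _).prodCongr (Equiv.addRight 1)

/-- The involution exchanging the two sides of every edge of the hexagonal tiling. -/
def hexFlip (m : ℕ) : Perm (ZMod m × ZMod 6) :=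
  Function.Involutive.toPerm (fun x => (x.1 + hexShift m x.2, x.2 + 3)) fun x => by
    ext
    · simp [hexShift_add_three]
    · simp only [add_assoc, add_eq_left]
      rfl

@[simp]
theorem hexRotate_apply (m : ℕ) (x : ZMod m × ZMod 6) : hexRotate m x = (x.1, x.2 + 1) := rfl

@[simp]
theorem hexFlip_apply (m : ℕ) (x : ZMod m × ZMod 6) :
    hexFlip m x = (x.1 + hexShift m x.2, x.2 + 3) := rfl

theorem pow_apply_snd {A B : Type*} [AddCommMonoid B] (g : Perm (A × B)) (t : B)
    (hg : ∀ x, (g x).2 = x.2 + t) (k : ℕ) (x : A × B) : ((g ^ k) x).2 = x.2 + k • t := by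
  induction k with
  | zero => simp
  | succ k ih => rw [pow_succ', Perm.mul_apply, hg, ih, succ_nsmul, add_assoc]

theorem hexFlip_sq (m : ℕ) : hexFlip m ^ 2 = 1 := by
  ext x : 1
  exact (hexFlip m).left_inv x

theorem hexRotate_pow_apply (m k : ℕ) (x : ZMod m × ZMod 6) :
    (hexRotate m ^ k) x = (x.1, x.2 + k) := by
  induction k with
  | zero => simp
  | succ k ih => rw [pow_succ', Perm.mul_apply, ih]; simp [add_assoc]

theorem hexRotate_pow_six (m : ℕ) : hexRotate m ^ 6 = 1 := by
  ext x : 1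
  rw [hexRotate_pow_apply, show ((6 : ℕ) : ZMod 6) = 0 from rfl, add_zero]
  rfl

theorem hexRotate_mul_hexFlip_apply (m : ℕ) (x : ZMod m × ZMod 6) :
    (hexRotate m * hexFlip m) x = (x.1 + hexShift m x.2, x.2 + 4) := by
  simp only [Perm.mul_apply, hexFlip_apply, hexRotate_apply, add_assoc]
  rfl

theorem hexRotate_mul_hexFlip_pow_three (m : ℕ) : (hexRotate m * hexFlip m) ^ 3 = 1 := by
  ext x : 1
  rw [pow_succ, pow_two, Perm.mul_apply, Perm.mul_apply]
  simp only [hexRotate_mul_hexFlip_apply]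
  ext
  · have := hexShift_add_add m x.2
    simp only [Perm.one_apply]
    linear_combination this
  · simp only [add_assoc, Perm.one_apply, add_eq_left]
    rfl

theorem hexFlip_inv_mul_hexRotate_inv_snd (m : ℕ) (x : ZMod m × ZMod 6) :
    (((hexFlip m)⁻¹ * (hexRotate m)⁻¹) x).2 = x.2 + 2 := by
  rw [← mul_inv_rev]
  have h := hexRotate_mul_hexFlip_apply m ((hexRotate m * hexFlip m)⁻¹ x)
  rw [show (hexRotate m * hexFlip m) ((hexRotate m * hexFlip m)⁻¹ x) = x from
    Equiv.apply_symm_apply _ x] at h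
  conv_rhs => rw [h]
  simp only [add_assoc]
  exact (add_zero _).symm

theorem exists_pow_hexRotate_mul_pow (m : ℕ) [NeZero m] (x : ZMod m × ZMod 6) :
    ∃ i j : ℕ, (hexRotate m ^ j * (hexRotate m ^ 3 * hexFlip m) ^ i) (0, 0) = x := by
  have h (i : ℕ) : ((hexRotate m ^ 3 * hexFlip m) ^ i) (0, 0) = ((i : ZMod m), 0) := by
    induction i with
    | zero => simp
    | succ i ih =>
      rw [pow_succ', Perm.mul_apply, ih, Perm.mul_apply, hexRotate_pow_apply, hexFlip_apply,
        Nat.cast_succ i]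
      rfl
  refine ⟨x.1.val, x.2.val, ?_⟩
  rw [Perm.mul_apply, h, hexRotate_pow_apply]
  simp

theorem fullCycleType_permCongrHom_eq_replicate {m n : ℕ} (e : ZMod m × ZMod 6 ≃ Fin n)
    (g : Perm (ZMod m × ZMod 6)) (t : ZMod 6) (d k : ℕ) (hd : 2 ≤ d) (hn : n = k * d)
    (hpow : g ^ d = 1) (hg : ∀ x, (g x).2 = x.2 + t) (ht : ∀ j < d, 0 < j → j • t ≠ 0) :
    fullCycleType (e.permCongrHom g) = Multiset.replicate k d := by
  refine fullCycleType_eq_replicate _ d k hd (by simpa using hn) ?_ ?_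
  · rw [← map_pow, hpow, map_one]
  · intro j hj hjd x hx
    rw [← map_pow] at hx
    have hx' : (g ^ j) (e.symm x) = e.symm x := e.injective (by simpa using hx)
    have := pow_apply_snd g t hg j (e.symm x)
    rw [hx', left_eq_add] at this
    exact ht j hjd hj this

/-- The regular genus-1 ramification data [2^{3m}][3^{2m}][6^m] is realizable in every degree 6m
(from tilings of the torus by m hexagons). -/
theorem stmt15 (m : ℕ) (hm : 1 ≤ m) :
    Realizable (6 * m)
      [Multiset.replicate (3 * m) 2, Multiset.replicate (2 * m) 3,
        Multiset.replicate m 6] := by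
  have : NeZero m := ⟨by omega⟩
  let e : ZMod m × ZMod 6 ≃ Fin (6 * m) :=
    Fintype.equivFinOfCardEq (by rw [Fintype.card_prod, ZMod.card, ZMod.card, mul_comm])
  let φ := e.permCongrHom
  refine ⟨[φ (hexFlip m), φ ((hexFlip m)⁻¹ * (hexRotate m)⁻¹), φ (hexRotate m)], ?_, ?_, ?_⟩
  · simp only [List.map_cons, List.map_nil]
    congr
    · exact fullCycleType_permCongrHom_eq_replicate e _ 3 2 _ le_rfl (by ring) (hexFlip_sq m)
        (fun _ => rfl) (by decide)
    · exact fullCycleType_permCongrHom_eq_replicate e _ 2 3 _ (by norm_num) (by ring)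
        (by rw [← mul_inv_rev, inv_pow, hexRotate_mul_hexFlip_pow_three, inv_one])
        (hexFlip_inv_mul_hexRotate_inv_snd m) (by decide)
    · exact fullCycleType_permCongrHom_eq_replicate e _ 1 6 _ (by norm_num) (by ring)
        (hexRotate_pow_six m) (fun _ => rfl) (by decide)
  · simp only [List.prod_cons, List.prod_nil, ← map_mul, mul_one]
    simp
  · set S := {g | g ∈ [φ (hexFlip m), φ ((hexFlip m)⁻¹ * (hexRotate m)⁻¹), φ (hexRotate m)]}
    have hF : φ (hexFlip m) ∈ Subgroup.closure S := Subgroup.subset_closure (by simp [S])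
    have hR : φ (hexRotate m) ∈ Subgroup.closure S := Subgroup.subset_closure (by simp [S])
    have key (x : Fin (6 * m)) : ∃ g ∈ Subgroup.closure S, g (e (0, 0)) = x := by
      obtain ⟨i, j, hij⟩ := exists_pow_hexRotate_mul_pow m (e.symm x)
      refine ⟨φ (hexRotate m ^ j * (hexRotate m ^ 3 * hexFlip m) ^ i), ?_, ?_⟩
      · simp only [map_mul, map_pow]
        exact mul_mem (pow_mem hR j) (pow_mem (mul_mem (pow_mem hR 3) hF) i)
      · change e ((hexRotate m ^ j * (hexRotate m ^ 3 * hexFlip m) ^ i)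
          (e.symm (e (0, 0)))) = x
        rw [e.symm_apply_apply, hij, e.apply_symm_apply]
    intro x y
    obtain ⟨g, hg, rfl⟩ := key x
    obtain ⟨h, hh, rfl⟩ := key y
    exact ⟨h * g⁻¹, mul_mem hh (inv_mem hg), by simp⟩
end

section
/- There exists N such that for every integer n ≥ N with n ≡ 1 (mod 3) there exist permutations σ₁, σ₂, σ₃ of {1,…,n} with σ₁σ₂σ₃ = 1, generating a subgroup that acts transitively on {1,…,n}, such that the full cycle types of σ₁ and σ₂ each consist of one 1 and (n−1)/3 copies of 3, and the full cycle type of σ₃ consists of one 7 and (n−7)/3 copies of 3. (That is, the genus-1 ramification data [1,3^*][1,3^*][7,3^*] is realizable in every sufficiently large compatible degree.) -/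
open Equiv

theorem cycleType_permCongr {α β : Type*} [Fintype α] [DecidableEq α] [Fintype β] [DecidableEq β]
    (e : α ≃ β) (g : Perm α) : (e.permCongr g).cycleType = g.cycleType := by
  let f : α ≃ {b : β // True} := e.trans (Equiv.subtypeUnivEquiv fun _ => trivial).symm
  rw [← Perm.cycleType_extendDomain f (g := g)]
  congr 1

theorem cycleType_sumCongr {α β : Type*} [Fintype α] [DecidableEq α] [Fintype β] [DecidableEq β]
    (g : Perm α) (h : Perm β) :
    (Perm.sumCongr g h).cycleType = g.cycleType + h.cycleType := by
  have hl : (Perm.sumCongr g (1 : Perm β)).cycleType = g.cycleType := by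
    rw [← Perm.cycleType_extendDomain (Equiv.ofInjective (Sum.inl : α → α ⊕ β) Sum.inl_injective)
      (g := g)]
    congr 1
    ext (a | b)
    · exact (Perm.extendDomain_apply_image g
        (Equiv.ofInjective (Sum.inl : α → α ⊕ β) Sum.inl_injective) a).symm
    · rw [Perm.extendDomain_apply_not_subtype _ _ (by simp)]
      rfl
  have hr : (Perm.sumCongr (1 : Perm α) h).cycleType = h.cycleType := by
    rw [← Perm.cycleType_extendDomain (Equiv.ofInjective (Sum.inr : β → α ⊕ β) Sum.inr_injective)
      (g := h)]
    congr 1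
    ext (a | b)
    · rw [Perm.extendDomain_apply_not_subtype _ _ (by simp)]
      rfl
    · exact (Perm.extendDomain_apply_image h
        (Equiv.ofInjective (Sum.inr : β → α ⊕ β) Sum.inr_injective) b).symm
  have hd : (Perm.sumCongr g (1 : Perm β)).Disjoint (Perm.sumCongr (1 : Perm α) h) := by
    rintro (a | b) <;> simp
  have hm : Perm.sumCongr g h = Perm.sumCongr g (1 : Perm β) * Perm.sumCongr (1 : Perm α) h := by
    rw [Perm.sumCongr_mul, mul_one, one_mul]
  rw [hm, hd.cycleType_mul, hl, hr]

/-- A pair of permutations realizing the ramification data on `3 * k + 7` points, together with a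
point sent to the same image by both of them, where a ring of three points can be inserted. -/
structure RingPair {α : Type} [Fintype α] [DecidableEq α] (k : ℕ) (x y : Perm α) (a s c : α) :
    Prop where
  card : Fintype.card α = 3 * k + 7
  cycleType_left : x.cycleType = Multiset.replicate (k + 2) 3
  cycleType_right : y.cycleType = Multiset.replicate (k + 2) 3
  cycleType_mul : (x * y).cycleType = 7 ::ₘ Multiset.replicate k 3
  transitive : IsTransitiveSet {x, y}
  ne_as : a ≠ s
  ne_sc : s ≠ c
  ne_ca : c ≠ a
  right_a : y a = s
  right_s : y s = c
  right_c : y c = a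
  left_c : x c = a

theorem isTransitiveSet_of_orbit {α : Type*} {t : Set (Perm α)} (a : α)
    (h : ∀ v, v ∈ MulAction.orbit (Subgroup.closure t) a) : IsTransitiveSet t := by
  intro v w
  obtain ⟨⟨g, hg⟩, rfl⟩ := h v
  obtain ⟨⟨g', hg'⟩, rfl⟩ := h w
  exact ⟨g' * g⁻¹, mul_mem hg' (inv_mem hg), by simp [Subgroup.smul_def]⟩

theorem RingPair.insert {α : Type} [Fintype α] [DecidableEq α] {k : ℕ} {x y : Perm α} {a s c : α}
    (h : RingPair k x y a s c) :
    RingPair (k + 1) (Perm.sumCongr x (finRotate 3))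
      (swap (Sum.inl s) (Sum.inr 1) * Perm.sumCongr y (finRotate 3) *
        (swap (Sum.inl s) (Sum.inr 1))⁻¹)
      (Sum.inl a : α ⊕ Fin 3) (Sum.inr 1) (Sum.inl c) := by
  obtain ⟨hcard, hx, hy, hxy, htr, has, hsc, hca, ya, ys, yc, xc⟩ := h
  have h3 : (finRotate 3).cycleType = {3} := cycleType_finRotate
  have h3' : ((finRotate 3)⁻¹).cycleType = {3} := by rw [Perm.cycleType_inv, h3]
  set x' := Perm.sumCongr x (finRotate 3) with hx'
  set y' := swap (Sum.inl s) (Sum.inr 1) * Perm.sumCongr y (finRotate 3) *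
        (swap (Sum.inl s) (Sum.inr 1))⁻¹ with hy'
  have x0 : x' (Sum.inr 0) = Sum.inr 1 := rfl
  have x1 : x' (Sum.inr 1) = Sum.inr 2 := rfl
  have x2 : x' (Sum.inr 2) = Sum.inr 0 := rfl
  have xl (v : α) : x' (Sum.inl v) = Sum.inl (x v) := rfl
  have r0 : finRotate 3 0 = 1 := rfl
  have r1 : finRotate 3 1 = 2 := rfl
  have r2 : finRotate 3 2 = 0 := rfl
  have y0 : y' (Sum.inr 0) = Sum.inl s := by
    simp [hy', swap_apply_def, r0]
  have y1 : y' (Sum.inr 1) = Sum.inl c := by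
    simp [hy', swap_apply_def, ys, hsc.symm]
  have y2 : y' (Sum.inr 2) = Sum.inr 0 := by
    simp [hy', swap_apply_def, r2]
  have yla : y' (Sum.inl a) = Sum.inr 1 := by
    simp [hy', swap_apply_def, has, ya]
  have yls : y' (Sum.inl s) = Sum.inr 2 := by
    simp [hy', swap_apply_def, r1]
  have yl (v : α) (hva : v ≠ a) (hvs : v ≠ s) : y' (Sum.inl v) = Sum.inl (y v) := by
    have : y v ≠ s := fun e => hva (y.injective (e.trans ya.symm))
    simp [hy', swap_apply_def, hvs, this]
  have hmul : x' * y' = swap (Sum.inl a) (Sum.inr 0) * Perm.sumCongr (x * y) (finRotate 3)⁻¹ *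
      (swap (Sum.inl a) (Sum.inr 0))⁻¹ := by
    have xinj (v : α) : x v = a ↔ v = c := by rw [← xc, x.injective.eq_iff]
    have yinj (v : α) : y v = c ↔ v = s := by rw [← ys, y.injective.eq_iff]
    refine Equiv.ext ?_
    rintro (v | v)
    · by_cases hva : v = a
      · subst hva
        simp [yla, x1, swap_apply_def]
        rfl
      by_cases hvs : v = s
      · subst hvs
        simp [yls, x2, swap_apply_def, hva, ys, xc]
      · simp [yl v hva hvs, xl, swap_apply_def, hva, xinj, yinj, hvs]
    · fin_cases v
      · simp [y0, xl, swap_apply_def, ya, xinj, hsc]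
      · simp [y1, xl, swap_apply_def, xc]
      · simp [y2, x0, swap_apply_def]
  refine ⟨?_, ?_, ?_, ?_, ?_, ?_, ?_, ?_, yla, y1, ?_, ?_⟩
  · simp [hcard]; ring
  · rw [hx', cycleType_sumCongr, hx, h3, Multiset.replicate_succ _ (k + 2), add_comm]; rfl
  · rw [hy', Perm.cycleType_conj, cycleType_sumCongr, hy, h3, add_comm]; rfl
  · rw [hmul, Perm.cycleType_conj, cycleType_sumCongr, hxy, h3', Multiset.cons_add,
      Multiset.replicate_succ, add_comm]; rfl
  · set G := Subgroup.closure ({x', y'} : Set (Perm (α ⊕ Fin 3)))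
    have hxG (v) : MulAction.orbit G (x' v) = MulAction.orbit G v :=
      MulAction.orbit_eq_iff.2 ⟨⟨x', Subgroup.subset_closure (by simp)⟩, rfl⟩
    have hyG (v) : MulAction.orbit G (y' v) = MulAction.orbit G v :=
      MulAction.orbit_eq_iff.2 ⟨⟨y', Subgroup.subset_closure (by simp)⟩, rfl⟩
    have e1 : MulAction.orbit G (Sum.inr 1 : α ⊕ Fin 3) = MulAction.orbit G (Sum.inl a) := by
      rw [← yla, hyG]
    have e2 : MulAction.orbit G (Sum.inr 2 : α ⊕ Fin 3) = MulAction.orbit G (Sum.inl a) := by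
      rw [← x1, hxG, e1]
    have e0 : MulAction.orbit G (Sum.inr 0 : α ⊕ Fin 3) = MulAction.orbit G (Sum.inl a) := by
      rw [← x2, hxG, e2]
    have es : MulAction.orbit G (Sum.inl s : α ⊕ Fin 3) = MulAction.orbit G (Sum.inl a) := by
      rw [← y0, hyG, e0]
    have ec : MulAction.orbit G (Sum.inl c : α ⊕ Fin 3) = MulAction.orbit G (Sum.inl a) := by
      rw [← y1, hyG, e1]
    have key : ∀ g ∈ Subgroup.closure ({x, y} : Set (Perm α)), ∀ v : α,
        MulAction.orbit G (Sum.inl (g v) : α ⊕ Fin 3) = MulAction.orbit G (Sum.inl v) := by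
      intro g hg
      induction hg using Subgroup.closure_induction with
      | mem g hg =>
        intro v
        rcases hg with rfl | rfl
        · rw [← xl, hxG]
        · by_cases hva : v = a
          · rw [hva, ya, es]
          by_cases hvs : v = s
          · rw [hvs, ys, ec, es]
          · rw [← yl v hva hvs, hyG]
      | one => exact fun v => rfl
      | mul g h _ _ hg hh => exact fun v => (hg (h v)).trans (hh v)
      | inv g _ hg => exact fun v => by simpa using (hg (g⁻¹ v)).symm
    refine isTransitiveSet_of_orbit (Sum.inl a) fun v => MulAction.orbit_eq_iff.1 ?_
    rcases v with v | v
    · obtain ⟨g, hg, rfl⟩ := htr a v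
      exact key g hg a
    · fin_cases v
      exacts [e0, e1, e2]
  · simp
  · simp
  · simpa using hca
  · rw [yl c hca hsc.symm, yc]
  · rw [xl, xc]

theorem ringPair_seven : RingPair 0 (c[0, 1, 2] * c[3, 4, 5] : Perm (Fin 7))
    (c[0, 5, 6] * c[1, 2, 4]) 2 4 1 := by
  refine ⟨by decide, by decide +kernel, by decide +kernel, by decide +kernel, ?_, by decide,
    by decide, by decide, by decide, by decide, by decide, by decide⟩
  set x : Perm (Fin 7) := c[0, 1, 2] * c[3, 4, 5]
  set y : Perm (Fin 7) := c[0, 5, 6] * c[1, 2, 4]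
  refine isTransitiveSet_of_orbit 0 fun v => ?_
  have hg : x * y ∈ Subgroup.closure {x, y} :=
    mul_mem (Subgroup.subset_closure (by simp)) (Subgroup.subset_closure (by simp))
  have hv : ∀ v : Fin 7, ∃ m : Fin 7, ((x * y) ^ (m : ℕ)) 0 = v := by decide +kernel
  obtain ⟨m, hm⟩ := hv v
  exact ⟨⟨_, pow_mem hg m⟩, hm⟩

theorem exists_ringPair (k : ℕ) : ∃ (α : Type) (_ : Fintype α) (_ : DecidableEq α)
    (x y : Perm α) (a s c : α), RingPair k x y a s c := by
  induction k with
  | zero => exact ⟨_, _, _, _, _, _, _, _, ringPair_seven⟩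
  | succ k ih =>
    obtain ⟨α, _, _, x, y, a, s, c, h⟩ := ih
    exact ⟨_, _, _, _, _, _, _, _, h.insert⟩

theorem RingPair.realizable {α : Type} [Fintype α] [DecidableEq α] {k : ℕ} {x y : Perm α}
    {a s c : α} (h : RingPair k x y a s c) :
    Realizable (3 * k + 7) [1 ::ₘ Multiset.replicate (k + 2) 3,
      1 ::ₘ Multiset.replicate (k + 2) 3, 7 ::ₘ Multiset.replicate k 3] := by
  obtain e := Fintype.equivFinOfCardEq h.card
  let φ : Perm α ≃* Perm (Fin (3 * k + 7)) := e.permCongrHom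
  have hφ (g : Perm α) : (φ g).cycleType = g.cycleType := cycleType_permCongr e g
  refine ⟨[φ x, φ y, φ (x * y)⁻¹], ?_, ?_, ?_⟩
  · have e1 : 3 * k + 7 - (k + 2) * 3 = 1 := by omega
    have e2 : 3 * k + 7 - (7 + k * 3) = 0 := by omega
    simp only [List.map_cons, List.map_nil, fullCycleType, hφ, Perm.cycleType_inv,
      h.cycleType_left, h.cycleType_right, h.cycleType_mul, Fintype.card_fin,
      Multiset.sum_replicate, Multiset.sum_cons, smul_eq_mul, e1, e2]
    simp [add_comm _ ({1} : Multiset ℕ), Multiset.cons_swap 1 3]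
  · simp [← map_mul]
  · have hle : (Subgroup.closure {x, y}).map φ.toMonoidHom ≤
        Subgroup.closure {g | g ∈ [φ x, φ y, φ (x * y)⁻¹]} := by
      rw [MonoidHom.map_closure]
      refine Subgroup.closure_mono ?_
      rintro _ ⟨g, rfl | rfl, rfl⟩ <;> simp
    intro v w
    obtain ⟨g, hg, hgv⟩ := h.transitive (e.symm v) (e.symm w)
    exact ⟨φ g, hle ⟨g, hg, rfl⟩, by simp [φ, Equiv.permCongrHom, hgv]⟩

/-- The genus-1 ramification data [1,3^*][1,3^*][7,3^*] (type NR4) is realizable in every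
sufficiently large degree n ≡ 1 (mod 3). -/
theorem stmt16 :
    ∃ N : ℕ, ∀ n : ℕ, N ≤ n → n % 3 = 1 →
      Realizable n
        [1 ::ₘ Multiset.replicate ((n - 1) / 3) 3,
          1 ::ₘ Multiset.replicate ((n - 1) / 3) 3,
          7 ::ₘ Multiset.replicate ((n - 7) / 3) 3] := by
  refine ⟨7, fun n hn hmod => ?_⟩
  obtain ⟨k, rfl⟩ : ∃ k, n = 3 * k + 7 := ⟨(n - 7) / 3, by omega⟩
  obtain ⟨α, _, _, x, y, a, s, c, h⟩ := exists_ringPair k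
  have e1 : (3 * k + 7 - 1) / 3 = k + 2 := by omega
  have e2 : (3 * k + 7 - 7) / 3 = k := by omega
  rw [e1, e2]
  exact h.realizable
end

section
/- There exists N such that for every odd integer n ≥ N there exist permutations σ₁, σ₂, σ₃, σ₄ of {1,…,n} with σ₁σ₂σ₃σ₄ = 1, generating a subgroup that acts transitively on {1,…,n}, such that the full cycle types of σ₁, σ₂, σ₃ each consist of one 1 and (n−1)/2 copies of 2, and the full cycle type of σ₄ consists of one 5 and (n−5)/2 copies of 2. (That is, the genus-1 ramification data [1,2^*][1,2^*][1,2^*][5,2^*] is realizable in every sufficiently large odd degree.) -/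
open Equiv in
/-- A permutation of order dividing two that moves exactly `2 * m` points is a product of `m`
disjoint transpositions. -/
theorem cycleType_eq_replicate_two {α : Type*} [Fintype α] [DecidableEq α] {σ : Perm α}
    (h : Function.Involutive σ) {m : ℕ} (hm : σ.support.card = 2 * m) :
    σ.cycleType = Multiset.replicate m 2 := by
  have : Fact (Nat.Prime 2) := ⟨Nat.prime_two⟩
  have h2 : σ ^ 2 = 1 := by
    ext x
    simp [pow_two, h x]
  have hc := Perm.cycleType_of_pow_prime_eq_one h2
  have hs := σ.sum_cycleType
  rw [hc, Multiset.sum_replicate, smul_eq_mul, hm] at hs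
  rw [hc]
  congr 1
  omega

open Equiv in
/-- An involution of a set of odd cardinality with a unique fixed point has full cycle type
`[1, 2, …, 2]`. -/
theorem fullCycleType_of_involutive {α : Type*} [Fintype α] [DecidableEq α] {σ : Perm α}
    (h : Function.Involutive σ) {m : ℕ} (hα : Fintype.card α = 2 * m + 1) (p : α)
    (hp : ∀ x, σ x = x ↔ x = p) :
    fullCycleType σ = 1 ::ₘ Multiset.replicate m 2 := by
  have hs : σ.support = {p}ᶜ := by
    ext x
    simp [hp]
  have hcard : σ.support.card = 2 * m := by
    rw [hs, Finset.card_compl, Finset.card_singleton, hα, Nat.add_sub_cancel]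
  rw [fullCycleType, σ.sum_cycleType, cycleType_eq_replicate_two h hcard, hcard, hα,
    Nat.add_sub_cancel_left, Multiset.replicate_one, add_comm, Multiset.singleton_add]

namespace PillowcaseCover

variable (k : ℕ)

/-- The involution `i ↦ -i` of `ℤ/(2k+5)`. -/
def negPerm : Equiv.Perm (Fin (2 * k + 5)) :=
  Function.Involutive.toPerm
    (fun i => ⟨if i.1 = 0 then 0 else 2 * k + 5 - i.1, by split_ifs <;> omega⟩) (by
      intro i
      ext
      dsimp only
      split_ifs <;> omega)

/-- The involution `i ↦ -1 - i` of `ℤ/(2k+5)`. -/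
def revPerm : Equiv.Perm (Fin (2 * k + 5)) :=
  Function.Involutive.toPerm (fun i => ⟨2 * k + 4 - i.1, by omega⟩) (by
      intro i
      ext
      dsimp only
      omega)

/-- The involution exchanging `0 ↔ 2` and `1 ↔ 3`, and reversing the remaining points. -/
def gluePerm : Equiv.Perm (Fin (2 * k + 5)) :=
  Function.Involutive.toPerm
    (fun i => ⟨if i.1 < 2 then i.1 + 2 else if i.1 < 4 then i.1 - 2 else 2 * k + 8 - i.1, by
      split_ifs <;> omega⟩) (by
      intro i
      ext
      dsimp only
      split_ifs <;> omega)

/-- The involution fixing `0, …, 4` and reversing the remaining points. -/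
def tailPerm : Equiv.Perm (Fin (2 * k + 5)) :=
  Function.Involutive.toPerm
    (fun i => ⟨if i.1 < 5 then i.1 else 2 * k + 9 - i.1, by split_ifs <;> omega⟩) (by
      intro i
      ext
      dsimp only
      split_ifs <;> omega)

/-- The cycle `(0 4 1 2 3)`. -/
def fiveCycle : Equiv.Perm (Fin (2 * k + 5)) where
  toFun i := ⟨if i.1 = 0 then 4 else if i.1 = 4 then 1 else if i.1 = 3 then 0 else
    if i.1 < 3 then i.1 + 1 else i.1, by split_ifs <;> omega⟩
  invFun i := ⟨if i.1 = 4 then 0 else if i.1 = 1 then 4 else if i.1 = 0 then 3 else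
    if i.1 < 4 then i.1 - 1 else i.1, by split_ifs <;> omega⟩
  left_inv i := by
    ext
    grind
  right_inv i := by
    ext
    grind

theorem negPerm_val (i : Fin (2 * k + 5)) :
    (negPerm k i).1 = if i.1 = 0 then 0 else 2 * k + 5 - i.1 := rfl

theorem revPerm_val (i : Fin (2 * k + 5)) : (revPerm k i).1 = 2 * k + 4 - i.1 := rfl

theorem gluePerm_val (i : Fin (2 * k + 5)) :
    (gluePerm k i).1 =
      if i.1 < 2 then i.1 + 2 else if i.1 < 4 then i.1 - 2 else 2 * k + 8 - i.1 := rfl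

theorem tailPerm_val (i : Fin (2 * k + 5)) :
    (tailPerm k i).1 = if i.1 < 5 then i.1 else 2 * k + 9 - i.1 := rfl

theorem fiveCycle_val (i : Fin (2 * k + 5)) :
    (fiveCycle k i).1 = if i.1 = 0 then 4 else if i.1 = 4 then 1 else if i.1 = 3 then 0 else
      if i.1 < 3 then i.1 + 1 else i.1 := rfl

theorem fullCycleType_negPerm :
    fullCycleType (negPerm k) = 1 ::ₘ Multiset.replicate (k + 2) 2 := by
  refine fullCycleType_of_involutive (σ := negPerm k) (Function.Involutive.toPerm_involutive _)
    (by rw [Fintype.card_fin]; ring) ⟨0, by omega⟩ fun x => ?_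
  simp only [Fin.ext_iff, negPerm_val]
  split_ifs <;> omega

theorem fullCycleType_revPerm :
    fullCycleType (revPerm k) = 1 ::ₘ Multiset.replicate (k + 2) 2 := by
  refine fullCycleType_of_involutive (σ := revPerm k) (Function.Involutive.toPerm_involutive _)
    (by rw [Fintype.card_fin]; ring) ⟨k + 2, by omega⟩ fun x => ?_
  simp only [Fin.ext_iff, revPerm_val]
  omega

theorem fullCycleType_gluePerm :
    fullCycleType (gluePerm k) = 1 ::ₘ Multiset.replicate (k + 2) 2 := by
  refine fullCycleType_of_involutive (σ := gluePerm k) (Function.Involutive.toPerm_involutive _)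
    (by rw [Fintype.card_fin]; ring) ⟨k + 4, by omega⟩ fun x => ?_
  simp only [Fin.ext_iff, gluePerm_val]
  split_ifs <;> omega

/-- The set of points `0, …, 4`. -/
def head : Finset (Fin (2 * k + 5)) := Finset.univ.map (Fin.castLEEmb (by omega : 5 ≤ 2 * k + 5))

theorem card_head : (head k).card = 5 := by simp [head]

theorem mem_head (x : Fin (2 * k + 5)) : x ∈ head k ↔ x.1 < 5 := by
  simp only [head, Finset.mem_map, Finset.mem_univ, true_and]
  constructor
  · rintro ⟨y, rfl⟩
    exact y.2
  · exact fun h => ⟨⟨x.1, h⟩, rfl⟩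

theorem cycleType_tailPerm : (tailPerm k).cycleType = Multiset.replicate k 2 := by
  refine cycleType_eq_replicate_two (σ := tailPerm k) (Function.Involutive.toPerm_involutive _) ?_
  have hs : (tailPerm k).support = (head k)ᶜ := by
    ext x
    rw [Equiv.Perm.mem_support, Finset.mem_compl, mem_head, Ne, Fin.ext_iff, tailPerm_val]
    split_ifs <;> omega
  rw [hs, Finset.card_compl, card_head, Fintype.card_fin, Nat.add_sub_cancel]

theorem cycleType_fiveCycle : (fiveCycle k).cycleType = {5} := by
  have hs : (fiveCycle k).support = head k := by
    ext x
    rw [Equiv.Perm.mem_support, mem_head, Ne, Fin.ext_iff, fiveCycle_val]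
    split_ifs <;> omega
  have hpow : fiveCycle k ^ 5 = 1 := by
    ext x
    have hx : x.1 = 0 ∨ x.1 = 1 ∨ x.1 = 2 ∨ x.1 = 3 ∨ x.1 = 4 ∨ 5 ≤ x.1 := by omega
    simp only [pow_succ, pow_zero, one_mul, Equiv.Perm.mul_apply, Equiv.Perm.one_apply,
      fiveCycle_val]
    rcases hx with h | h | h | h | h | h
    iterate 5 simp [h]
    have h0 : x.1 ≠ 0 := by omega
    have h3 : x.1 ≠ 3 := by omega
    have h4 : x.1 ≠ 4 := by omega
    have h3' : ¬ x.1 < 3 := by omega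
    simp [h0, h3, h4, h3']
  have hne : fiveCycle k ≠ 1 := by
    rw [Ne, ← Equiv.Perm.support_eq_empty_iff, hs, ← Finset.card_eq_zero, card_head]
    decide
  have : Fact (Nat.Prime 5) := ⟨by norm_num⟩
  have hord : orderOf (fiveCycle k) = 5 := orderOf_eq_prime hpow hne
  have hcyc : (fiveCycle k).IsCycle := by
    refine Equiv.Perm.isCycle_of_prime_order (by rw [hord]; norm_num) ?_
    rw [hord, hs, card_head]
    norm_num
  rw [hcyc.cycleType, hs, card_head]

theorem fullCycleType_fiveCycle_mul_tailPerm :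
    fullCycleType (fiveCycle k * tailPerm k) = 5 ::ₘ Multiset.replicate k 2 := by
  have hd : (fiveCycle k).Disjoint (tailPerm k) := by
    intro x
    simp only [Fin.ext_iff, fiveCycle_val, tailPerm_val]
    by_cases h : x.1 < 5
    · exact Or.inr (if_pos h)
    · left
      split_ifs <;> omega
  have hsum : Fintype.card (Fin (2 * k + 5)) - (5 + k * 2) = 0 := by
    rw [Fintype.card_fin]
    omega
  rw [fullCycleType, hd.cycleType_mul, cycleType_fiveCycle, cycleType_tailPerm, Multiset.sum_add,
    Multiset.sum_singleton, Multiset.sum_replicate, smul_eq_mul, hsum, Multiset.replicate_zero,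
    add_zero, Multiset.singleton_add]

theorem prod_eq_one :
    negPerm k * (revPerm k * (gluePerm k * (fiveCycle k * tailPerm k))) = 1 := by
  ext x
  simp only [Equiv.Perm.mul_apply, Equiv.Perm.one_apply]
  have ht := tailPerm_val k x
  generalize tailPerm k x = y at ht ⊢
  have hf := fiveCycle_val k y
  generalize fiveCycle k y = z at hf ⊢
  have hg := gluePerm_val k z
  generalize gluePerm k z = w at hg ⊢
  rw [negPerm_val, revPerm_val]
  grind

theorem negPerm_mul_revPerm_pow (m : ℕ) (hm : m < 2 * k + 5) :
    ((negPerm k * revPerm k) ^ m) ⟨0, by omega⟩ = ⟨m, hm⟩ := by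
  induction m with
  | zero => rfl
  | succ m ih =>
    rw [pow_succ', Equiv.Perm.mul_apply, ih (by omega), Equiv.Perm.mul_apply, Fin.ext_iff,
      negPerm_val, revPerm_val]
    dsimp only
    split_ifs <;> omega

theorem isTransitiveSet {s : Set (Equiv.Perm (Fin (2 * k + 5)))} (hn : negPerm k ∈ s)
    (hr : revPerm k ∈ s) : IsTransitiveSet s := by
  intro x y
  have hmem : negPerm k * revPerm k ∈ Subgroup.closure s :=
    mul_mem (Subgroup.subset_closure hn) (Subgroup.subset_closure hr)
  refine ⟨(negPerm k * revPerm k) ^ y.1 * ((negPerm k * revPerm k) ^ x.1)⁻¹,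
    mul_mem (pow_mem hmem _) (inv_mem (pow_mem hmem _)), ?_⟩
  have hx := Equiv.Perm.inv_eq_iff_eq.mpr (negPerm_mul_revPerm_pow k x.1 x.2).symm
  rw [Equiv.Perm.mul_apply, hx, negPerm_mul_revPerm_pow k y.1 y.2]

end PillowcaseCover

/-- The genus-1 ramification data [1,2^*][1,2^*][1,2^*][5,2^*] (type NR25) is realizable in
every sufficiently large odd degree. -/
theorem stmt17 :
    ∃ N : ℕ, ∀ n : ℕ, N ≤ n → Odd n →
      Realizable n
        [1 ::ₘ Multiset.replicate ((n - 1) / 2) 2,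
          1 ::ₘ Multiset.replicate ((n - 1) / 2) 2,
          1 ::ₘ Multiset.replicate ((n - 1) / 2) 2,
          5 ::ₘ Multiset.replicate ((n - 5) / 2) 2] := by
  refine ⟨5, fun n hn hodd => ?_⟩
  obtain ⟨k, rfl⟩ : ∃ k, n = 2 * k + 5 := by
    obtain ⟨m, rfl⟩ := hodd
    exact ⟨m - 2, by omega⟩
  have h1 : (2 * k + 5 - 1) / 2 = k + 2 := by omega
  have h5 : (2 * k + 5 - 5) / 2 = k := by omega
  rw [h1, h5]
  open PillowcaseCover in
  refine ⟨[negPerm k, revPerm k, gluePerm k, fiveCycle k * tailPerm k], ?_, ?_, ?_⟩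
  · simp only [List.map_cons, List.map_nil, fullCycleType_negPerm, fullCycleType_revPerm,
      fullCycleType_gluePerm, fullCycleType_fiveCycle_mul_tailPerm]
  · simpa only [List.prod_cons, List.prod_nil, mul_one] using prod_eq_one k
  · exact isTransitiveSet k (by simp) (by simp)
end

section
/- There exists N such that for every odd integer n ≥ N there exist permutations σ₁, σ₂, σ₃, σ₄ of {1,…,n} with σ₁σ₂σ₃σ₄ = 1, generating a subgroup that acts transitively on {1,…,n}, such that the full cycle types of σ₁, σ₂, σ₃ each consist of one 1 and (n−1)/2 copies of 2, and the full cycle type of σ₄ consists of three 3's and (n−9)/2 copies of 2. (That is, the genus-1 ramification data [1,2^*][1,2^*][1,2^*][3,3,3,2^*] is realizable in every sufficiently large odd degree.) -/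
open Equiv Finset

section CycleTypes

variable {α : Type*} [Fintype α] [DecidableEq α]

/-- A permutation of prime exponent is a product of cycles of that prime length. -/
lemma cycleType_eq_replicate_of_pow_prime_eq_one {p : ℕ} (hp : p.Prime) {σ : Perm α}
    (h : σ ^ p = 1) : σ.cycleType = Multiset.replicate (#σ.support / p) p := by
  have hall : ∀ m ∈ σ.cycleType, m = p := fun m hm =>
    ((Nat.dvd_prime hp).1 ((Perm.dvd_of_mem_cycleType hm).trans (orderOf_dvd_of_pow_eq_one h))
      ).resolve_left (by have := Perm.two_le_of_mem_cycleType hm; omega)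
  obtain ⟨c, hc⟩ : ∃ c, σ.cycleType = Multiset.replicate c p :=
    ⟨_, Multiset.eq_replicate_card.2 hall⟩
  have hsum := σ.sum_cycleType
  rw [hc, Multiset.sum_replicate, smul_eq_mul] at hsum
  rw [hc, ← hsum, Nat.mul_div_cancel _ hp.pos]

/-- The full cycle type of an involution with exactly one fixed point. -/
lemma fullCycleType_of_involutive_s18 {σ : Perm α} (h : ∀ x, σ (σ x) = x) (a : α)
    (ha : ∀ x, σ x = x ↔ x = a) :
    fullCycleType σ = 1 ::ₘ Multiset.replicate ((Fintype.card α - 1) / 2) 2 := by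
  have hsupp : #σ.support = Fintype.card α - 1 := by
    rw [show σ.support = {a}ᶜ by ext x; simp [ha], card_compl, card_singleton]
  have hpos : 0 < Fintype.card α := Fintype.card_pos_iff.2 ⟨a⟩
  have hpow : σ ^ 2 = 1 := Perm.ext fun x => by simp [pow_two, h]
  rw [fullCycleType, σ.sum_cycleType, cycleType_eq_replicate_of_pow_prime_eq_one Nat.prime_two hpow,
    hsupp, Nat.sub_sub_self hpos, Multiset.replicate_one, add_comm, Multiset.singleton_add]

/-- The full cycle type of a fixed-point-free permutation which has exponent 3 on `S` and
exponent 2 off `S`. -/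
lemma fullCycleType_of_three_two {σ : Perm α} (S : Finset α) (h : ∀ x, σ x ≠ x)
    (h₃ : ∀ x ∈ S, σ (σ (σ x)) = x) (h₂ : ∀ x ∉ S, σ (σ x) = x) :
    fullCycleType σ = Multiset.replicate (#S / 3) 3 +
      Multiset.replicate ((Fintype.card α - #S) / 2) 2 := by
  have p₄ : ∀ x, (σ ^ 4) x = σ (σ (σ (σ x))) := fun x => by simp [pow_succ]
  have p₃ : ∀ x, (σ ^ 3) x = σ (σ (σ x)) := fun x => by simp [pow_succ]
  have h₆ : σ ^ 6 = 1 := Perm.ext fun x => by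
    by_cases hx : x ∈ S
    · simp [pow_succ, h₃ x hx]
    · simp [pow_succ, h₂ x hx]
  have hdisj : Perm.Disjoint (σ ^ 4) (σ ^ 3) := fun x => by
    by_cases hx : x ∈ S
    · exact Or.inr (by rw [p₃, h₃ x hx])
    · exact Or.inl (by rw [p₄, h₂ x hx, h₂ x hx])
  have hs₄ : (σ ^ 4).support = S := by
    ext x
    by_cases hx : x ∈ S
    · simp [p₄, h₃ x hx, hx, h]
    · simp [p₄, h₂ x hx, hx]
  have hs₃ : (σ ^ 3).support = Sᶜ := by
    ext x
    by_cases hx : x ∈ S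
    · simp [p₃, h₃ x hx, hx]
    · simp [p₃, h₂ x hx, hx, h]
  have hfull : σ.support = univ := by ext x; simp [h]
  have hσ : σ.cycleType = (σ ^ 4 * σ ^ 3).cycleType := by
    rw [← pow_add, show 4 + 3 = 6 + 1 from rfl, pow_succ, h₆, one_mul]
  have h₄₃ : (σ ^ 4) ^ 3 = 1 := by rw [← pow_mul, show 4 * 3 = 6 * 2 from rfl, pow_mul, h₆, one_pow]
  have h₃₂ : (σ ^ 3) ^ 2 = 1 := by rw [← pow_mul, h₆]
  rw [fullCycleType, σ.sum_cycleType, hfull, card_univ, Nat.sub_self, Multiset.replicate_zero,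
    add_zero, hσ, hdisj.cycleType_mul,
    cycleType_eq_replicate_of_pow_prime_eq_one Nat.prime_three h₄₃,
    cycleType_eq_replicate_of_pow_prime_eq_one Nat.prime_two h₃₂, hs₄, hs₃, card_compl]

end CycleTypes

/-- The reflection `x ↦ -x` of `ℤ/n`. -/
def reflectNeg (n x : ℕ) : ℕ := if x = 0 then 0 else n - x

/-- The side pairing of the boundary of a one-face map of genus 1 with three trivalent vertices,
one pendant half-edge, and `2 * k + 9` sides. -/
def sidePairing (k x : ℕ) : ℕ :=
  if x = k + 1 then k + 1
  else if x = k + 2 then k + 5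
  else if x = k + 5 then k + 2
  else if x = k + 3 then 2 * k + 7
  else if x = 2 * k + 7 then k + 3
  else if x = k + 4 then 2 * k + 8
  else if x = 2 * k + 8 then k + 4
  else 2 * k + 6 - x

/-- The permutation rotating around the vertices of the map given by `sidePairing`. -/
def vertexRotation (k x : ℕ) : ℕ :=
  if x = k then k + 1
  else if x = k + 1 then k + 5
  else if x = k + 2 then 2 * k + 7
  else if x = k + 3 then 2 * k + 8
  else if x = k + 4 then k + 2
  else if x = 2 * k + 6 then k + 3
  else if x = 2 * k + 7 then k + 4
  else if x = 2 * k + 8 then 2 * k + 6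
  else 2 * k + 5 - x

/-- The involution of `Fin n` induced by an involution of the natural numbers below `n`. -/
def involutionOfNat {n : ℕ} (f : ℕ → ℕ) (hf : ∀ x < n, f x < n) (hff : ∀ x < n, f (f x) = x) :
    Perm (Fin n) :=
  Function.Involutive.toPerm (fun x => ⟨f x, hf x x.2⟩) fun x => Fin.ext (hff x x.2)

lemma fullCycleType_involutionOfNat {n : ℕ} (f : ℕ → ℕ) (hf : ∀ x < n, f x < n)
    (hff : ∀ x < n, f (f x) = x) (a : ℕ) (han : a < n) (ha : ∀ x < n, f x = x ↔ x = a) :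
    fullCycleType (involutionOfNat f hf hff) = 1 ::ₘ Multiset.replicate ((n - 1) / 2) 2 := by
  rw [fullCycleType_of_involutive_s18 (fun x => Fin.ext (hff x x.2)) ⟨a, han⟩
    fun x => by rw [Fin.ext_iff, Fin.ext_iff]; exact ha x x.2, Fintype.card_fin]

/-- A set of permutations of `Fin n` generates a transitive subgroup if the subgroup contains a
permutation sending each `x` to `x + 1` whenever `x + 1 < n`. -/
lemma isTransitiveSet_of_succ {n : ℕ} {s : Set (Perm (Fin n))} (g : Perm (Fin n))
    (hg : g ∈ Subgroup.closure s) (h : ∀ x : Fin n, (x : ℕ) + 1 < n → (g x : ℕ) = x + 1) :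
    IsTransitiveSet s := by
  have hpow : ∀ (j : ℕ) (hj : j < n), (g ^ j) ⟨0, by omega⟩ = ⟨j, hj⟩ := by
    intro j
    induction j with
    | zero => intro hj; rfl
    | succ j ih =>
      intro hj
      rw [pow_succ', Perm.mul_apply, ih (by omega)]
      exact Fin.ext (h _ hj)
  intro x y
  refine ⟨g ^ (y : ℕ) * (g ^ (x : ℕ))⁻¹, mul_mem (pow_mem hg _) (inv_mem (pow_mem hg _)), ?_⟩
  rw [Perm.mul_apply, Perm.inv_eq_iff_eq.2 (hpow x x.2).symm, hpow y y.2]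

lemma reflectNeg_sub {n x : ℕ} (hx : x < n) :
    reflectNeg n (n - 1 - x) = if x + 1 = n then 0 else x + 1 := by
  unfold reflectNeg
  grind

lemma vertexRotation_eq (k x : ℕ) (hx : x < 2 * k + 9) :
    sidePairing k (reflectNeg (2 * k + 9) (2 * k + 8 - x)) = vertexRotation k x := by
  rw [show 2 * k + 8 = 2 * k + 9 - 1 from rfl, reflectNeg_sub hx]
  unfold sidePairing vertexRotation
  grind (splits := 30)

/-- The sides at the trivalent vertices of the map given by `sidePairing`. -/
def trivalentSides (k : ℕ) : Finset ℕ :=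
  {k, k + 1, k + 2, k + 3, k + 4, k + 5, 2 * k + 6, 2 * k + 7, 2 * k + 8}

lemma card_trivalentSides (k : ℕ) : #(trivalentSides k) = 9 := by
  unfold trivalentSides
  repeat rw [card_insert_of_notMem (by simp <;> omega)]
  simp

lemma vertexRotation_ne (k x : ℕ) : vertexRotation k x ≠ x := by
  unfold vertexRotation
  grind (splits := 30)

lemma vertexRotation_three (k x : ℕ) (hx : x ∈ trivalentSides k) :
    vertexRotation k (vertexRotation k (vertexRotation k x)) = x := by
  simp only [trivalentSides, mem_insert, mem_singleton] at hx
  rcases hx with rfl | rfl | rfl | rfl | rfl | rfl | rfl | rfl | rfl <;>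
    simp [vertexRotation] <;> grind

lemma vertexRotation_two (k x : ℕ) (hx : x < 2 * k + 9) (hxS : x ∉ trivalentSides k) :
    vertexRotation k (vertexRotation k x) = x := by
  simp only [trivalentSides, mem_insert, mem_singleton, not_or] at hxS
  unfold vertexRotation
  grind (splits := 30)

lemma realizable_two_mul_add_nine (k : ℕ) :
    Realizable (2 * k + 9)
      [1 ::ₘ Multiset.replicate (k + 4) 2, 1 ::ₘ Multiset.replicate (k + 4) 2,
        1 ::ₘ Multiset.replicate (k + 4) 2, 3 ::ₘ 3 ::ₘ 3 ::ₘ Multiset.replicate k 2] := by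
  obtain ⟨a, ha, hat⟩ : ∃ a : Perm (Fin (2 * k + 9)), (∀ x, (a x : ℕ) = 2 * k + 8 - x) ∧
      (∀ x, a (a x) = x) ∧ fullCycleType a = 1 ::ₘ Multiset.replicate (k + 4) 2 :=
    ⟨involutionOfNat (fun x => 2 * k + 8 - x) (by grind) (by grind), fun x => rfl,
      fun x => Function.Involutive.toPerm_involutive _ x, by
      rw [fullCycleType_involutionOfNat _ _ _ (k + 4) (by omega) (by grind),
        show (2 * k + 9 - 1) / 2 = k + 4 by omega]⟩
  obtain ⟨b, hb, hbt⟩ : ∃ b : Perm (Fin (2 * k + 9)),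
      (∀ x, (b x : ℕ) = reflectNeg (2 * k + 9) x) ∧
      (∀ x, b (b x) = x) ∧ fullCycleType b = 1 ::ₘ Multiset.replicate (k + 4) 2 :=
    ⟨involutionOfNat (reflectNeg (2 * k + 9)) (by grind [reflectNeg]) (by grind [reflectNeg]),
      fun x => rfl, fun x => Function.Involutive.toPerm_involutive _ x, by
      rw [fullCycleType_involutionOfNat _ _ _ 0 (by omega) (by grind [reflectNeg]),
        show (2 * k + 9 - 1) / 2 = k + 4 by omega]⟩
  obtain ⟨c, hc, hct⟩ : ∃ c : Perm (Fin (2 * k + 9)), (∀ x, (c x : ℕ) = sidePairing k x) ∧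
      (∀ x, c (c x) = x) ∧ fullCycleType c = 1 ::ₘ Multiset.replicate (k + 4) 2 :=
    ⟨involutionOfNat (sidePairing k) (by grind (splits := 30) [sidePairing]) (by grind (splits := 30) [sidePairing]),
      fun x => rfl, fun x => Function.Involutive.toPerm_involutive _ x, by
      rw [fullCycleType_involutionOfNat _ _ _ (k + 1) (by omega) (by grind (splits := 30) [sidePairing]),
        show (2 * k + 9 - 1) / 2 = k + 4 by omega]⟩
  have hd : ∀ x, ((c * b * a) x : ℕ) = vertexRotation k x := fun x => by
    rw [Perm.mul_apply, Perm.mul_apply, hc, hb, ha, vertexRotation_eq k x x.2]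
  have hlt : ∀ x ∈ trivalentSides k, x < 2 * k + 9 := by
    simp only [trivalentSides, mem_insert, mem_singleton]
    omega
  have hdt : fullCycleType (c * b * a) = 3 ::ₘ 3 ::ₘ 3 ::ₘ Multiset.replicate k 2 := by
    rw [fullCycleType_of_three_two ((trivalentSides k).attachFin hlt), card_attachFin,
      card_trivalentSides, Fintype.card_fin, show (2 * k + 9 - 9) / 2 = k by omega]
    · rfl
    · intro x hx
      exact vertexRotation_ne k x (by rw [← hd, hx])
    · intro x hx
      rw [Fin.ext_iff, hd, hd, hd, vertexRotation_three k x (mem_attachFin hlt |>.1 hx)]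
    · intro x hx
      rw [Fin.ext_iff, hd, hd, vertexRotation_two k x x.2 (mt (mem_attachFin hlt).2 hx)]
  refine ⟨[a, b, c, c * b * a], by simp [hat.2, hbt.2, hct.2, hdt], ?_, ?_⟩
  · ext x
    simp [hat.1, hbt.1, hct.1]
  · refine isTransitiveSet_of_succ (b * a) (mul_mem (Subgroup.subset_closure (by simp))
      (Subgroup.subset_closure (by simp))) fun x hx => ?_
    rw [Perm.mul_apply, hb, ha]
    grind [reflectNeg]

/-- The genus-1 ramification data [1,2^*][1,2^*][1,2^*][3,3,3,2^*] (type 9) is realizable in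
every sufficiently large odd degree. -/
theorem stmt18 :
    ∃ N : ℕ, ∀ n : ℕ, N ≤ n → Odd n →
      Realizable n
        [1 ::ₘ Multiset.replicate ((n - 1) / 2) 2,
          1 ::ₘ Multiset.replicate ((n - 1) / 2) 2,
          1 ::ₘ Multiset.replicate ((n - 1) / 2) 2,
          3 ::ₘ 3 ::ₘ 3 ::ₘ Multiset.replicate ((n - 9) / 2) 2] := by
  refine ⟨9, fun n hn hodd => ?_⟩
  obtain ⟨k, rfl⟩ : ∃ k, n = 2 * k + 9 := by
    obtain ⟨m, rfl⟩ := hodd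
    exact ⟨m - 4, by omega⟩
  rw [show (2 * k + 9 - 1) / 2 = k + 4 by omega, show (2 * k + 9 - 9) / 2 = k by omega]
  exact realizable_two_mul_add_nine k
end

section
/- For every N there exists an integer n ≥ N with n ≡ 1 (mod 3) and permutations σ₁, σ₂, σ₃ of {1,…,n} with σ₁σ₂σ₃ = 1, generating a subgroup that acts transitively on {1,…,n}, such that the full cycle type of each σᵢ consists of one 1 and (n−1)/3 copies of 3. (That is, the genus-0 ramification data [1,3^*][1,3^*][1,3^*] is realizable in infinitely many degrees.) -/
/-- A permutation of order dividing 3 with a unique fixed point consists of one fixed point and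
3-cycles. -/
theorem fullCycleType_eq_of_pow_three_eq_one {α : Type*} [Fintype α] [DecidableEq α]
    (σ : Equiv.Perm α) (h₃ : σ ^ 3 = 1) (hfix : ∃! x, σ x = x) :
    fullCycleType σ = 1 ::ₘ Multiset.replicate ((Fintype.card α - 1) / 3) 3 := by
  obtain ⟨p, hp, huniq⟩ := hfix
  have hcycle : σ.cycleType = Multiset.replicate (Multiset.card σ.cycleType) 3 := by
    refine Multiset.eq_replicate_card.2 fun k hk => ?_
    have hdvd : k ∣ 3 := (Equiv.Perm.dvd_of_mem_cycleType hk).trans (orderOf_dvd_of_pow_eq_one h₃)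
    have htwo := Equiv.Perm.two_le_of_mem_cycleType hk
    rcases (Nat.dvd_prime Nat.prime_three).1 hdvd with h | h <;> omega
  have hsupport : σ.support = Finset.univ.erase p := by
    ext x
    simp only [Equiv.Perm.mem_support, Finset.mem_erase, Finset.mem_univ, and_true, ne_eq]
    exact not_congr ⟨huniq x, fun h => h ▸ hp⟩
  have hsum : σ.cycleType.sum = Fintype.card α - 1 := by
    rw [Equiv.Perm.sum_cycleType, hsupport, Finset.card_erase_of_mem (Finset.mem_univ p),
      Finset.card_univ]
  have hcard : Multiset.card σ.cycleType = (Fintype.card α - 1) / 3 := by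
    rw [hcycle, Multiset.sum_replicate, smul_eq_mul] at hsum
    omega
  have hpos : 0 < Fintype.card α := Fintype.card_pos_iff.2 ⟨p⟩
  have hone : Fintype.card α - (Fintype.card α - 1) = 1 := by omega
  rw [fullCycleType, hsum, hone, hcycle, hcard, Multiset.replicate_one, add_comm,
    Multiset.singleton_add]

/-- The affine permutation `x ↦ u * x + b` of a commutative ring. -/
def affinePerm {R : Type*} [CommRing R] (u : Rˣ) (b : R) : Equiv.Perm R :=
  (Units.mulLeft u).trans (Equiv.addRight b)

theorem affinePerm_apply {R : Type*} [CommRing R] (u : Rˣ) (b x : R) :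
    affinePerm u b x = u * x + b := rfl

theorem affinePerm_pow_three {R : Type*} [CommRing R] (u : Rˣ) (b : R)
    (hu : (u : R) ^ 2 + u + 1 = 0) : affinePerm u b ^ 3 = 1 := by
  ext x
  simp only [pow_succ, pow_zero, one_mul, Equiv.Perm.mul_apply, affinePerm_apply,
    Equiv.Perm.one_apply]
  linear_combination ((u - 1) * x + b) * hu

theorem affinePerm_existsUnique_fixed {R : Type*} [CommRing R] (u : Rˣ) (b : R)
    (hu : IsUnit (1 - (u : R))) : ∃! x, affinePerm u b x = x := by
  obtain ⟨v, hv⟩ := hu.exists_right_inv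
  refine ⟨v * b, ?_, fun y hy => ?_⟩
  · simp only [affinePerm_apply]
    linear_combination -b * hv
  · simp only [affinePerm_apply] at hy
    linear_combination -v * hy - y * hv

theorem affinePerm_mul_mul_eq_one {R : Type*} [CommRing R] (u : Rˣ)
    (hu : (u : R) ^ 2 + u + 1 = 0) :
    affinePerm u 0 * (affinePerm u 1 * affinePerm u (-(u : R) ^ 2)) = 1 := by
  ext x
  simp only [Equiv.Perm.mul_apply, affinePerm_apply, Equiv.Perm.one_apply]
  linear_combination ((u - 1) * x - u * (u - 1)) * hu

theorem affinePerm_one_mul_inv_pow_apply {R : Type*} [CommRing R] (u : Rˣ) (k : ℕ) (x : R) :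
    ((affinePerm u 1 * (affinePerm u 0)⁻¹) ^ k) x = x + k := by
  have htranslation : affinePerm u 1 * (affinePerm u 0)⁻¹ = Equiv.addRight (1 : R) := by
    rw [mul_inv_eq_iff_eq_mul]
    ext y
    simp [affinePerm_apply]
  rw [htranslation]
  induction k with
  | zero => simp
  | succ k ih =>
    rw [pow_succ', Equiv.Perm.mul_apply, ih]
    simp [add_assoc]

/-- Three permutations of order dividing 3, each with a unique fixed point, realize the data
`[1,3,…,3]`, `[1,3,…,3]`, `[1,3,…,3]` if their product is 1 and `τ * σ⁻¹` is transitive. -/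
theorem realizable_of_pow_three_eq_one {n : ℕ} (σ τ ρ : Equiv.Perm (Fin n))
    (hσ : σ ^ 3 = 1) (hτ : τ ^ 3 = 1) (hρ : ρ ^ 3 = 1)
    (hσ' : ∃! x, σ x = x) (hτ' : ∃! x, τ x = x) (hρ' : ∃! x, ρ x = x)
    (hprod : σ * (τ * ρ) = 1) (htrans : ∀ x y, ∃ k : ℕ, ((τ * σ⁻¹) ^ k) x = y) :
    Realizable n
      [1 ::ₘ Multiset.replicate ((n - 1) / 3) 3,
        1 ::ₘ Multiset.replicate ((n - 1) / 3) 3,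
        1 ::ₘ Multiset.replicate ((n - 1) / 3) 3] := by
  refine ⟨[σ, τ, ρ], ?_, by simpa using hprod, fun x y => ?_⟩
  · simp only [List.map_cons, List.map_nil, fullCycleType_eq_of_pow_three_eq_one σ hσ hσ',
      fullCycleType_eq_of_pow_three_eq_one τ hτ hτ',
      fullCycleType_eq_of_pow_three_eq_one ρ hρ hρ', Fintype.card_fin]
  · obtain ⟨k, hk⟩ := htrans x y
    exact ⟨(τ * σ⁻¹) ^ k, pow_mem (mul_mem (Subgroup.subset_closure (by simp))
      (inv_mem (Subgroup.subset_closure (by simp)))) _, hk⟩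

/-- A primitive cube root of unity `u` of `ZMod (m + 1)`, with `1 - u` invertible, realizes the
data with three entries `[1,3,…,3]`. -/
theorem realizable_of_zmod_unit (m : ℕ) (u : (ZMod (m + 1))ˣ)
    (hu : (u : ZMod (m + 1)) ^ 2 + u + 1 = 0) (hu' : IsUnit (1 - (u : ZMod (m + 1)))) :
    Realizable (m + 1)
      [1 ::ₘ Multiset.replicate ((m + 1 - 1) / 3) 3,
        1 ::ₘ Multiset.replicate ((m + 1 - 1) / 3) 3,
        1 ::ₘ Multiset.replicate ((m + 1 - 1) / 3) 3] := by
  have htrans (x y : ZMod (m + 1)) :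
      ∃ k : ℕ, ((affinePerm u 1 * (affinePerm u 0)⁻¹) ^ k) x = y :=
    ⟨(y - x).val, by
      rw [affinePerm_one_mul_inv_pow_apply, ZMod.natCast_zmod_val, add_sub_cancel]⟩
  exact realizable_of_pow_three_eq_one
    (affinePerm (R := ZMod (m + 1)) u 0) (affinePerm (R := ZMod (m + 1)) u 1)
    (affinePerm (R := ZMod (m + 1)) u (-(u : ZMod (m + 1)) ^ 2))
    (affinePerm_pow_three u _ hu) (affinePerm_pow_three u _ hu) (affinePerm_pow_three u _ hu)
    (affinePerm_existsUnique_fixed u _ hu') (affinePerm_existsUnique_fixed u _ hu')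
    (affinePerm_existsUnique_fixed u _ hu') (affinePerm_mul_mul_eq_one u hu) htrans

/-- The genus-0 ramification data [1,3^*][1,3^*][1,3^*] is realizable in infinitely many
degrees n ≡ 1 (mod 3). -/
theorem stmt19 :
    ∀ N : ℕ, ∃ n : ℕ, N ≤ n ∧ n % 3 = 1 ∧
      Realizable n
        [1 ::ₘ Multiset.replicate ((n - 1) / 3) 3,
          1 ::ₘ Multiset.replicate ((n - 1) / 3) 3,
          1 ::ₘ Multiset.replicate ((n - 1) / 3) 3] := by
  intro N
  have hroot : (3 * N : ZMod (9 * N ^ 2 + 3 * N + 1)) ^ 2 + 3 * N + 1 = 0 := by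
    have h := ZMod.natCast_self (9 * N ^ 2 + 3 * N + 1)
    push_cast at h
    linear_combination h
  set a : ZMod (9 * N ^ 2 + 3 * N + 1) := 3 * N with ha
  let u : (ZMod (9 * N ^ 2 + 3 * N + 1))ˣ :=
    ⟨a, a ^ 2, by linear_combination (a - 1) * hroot, by linear_combination (a - 1) * hroot⟩
  refine ⟨9 * N ^ 2 + 3 * N + 1, by nlinarith, by omega,
    realizable_of_zmod_unit _ u hroot (IsUnit.of_mul_eq_one (-(a + 2) * (3 * N ^ 2 + N)) ?_)⟩
  change (1 - a) * (-(a + 2) * (3 * N ^ 2 + N)) = 1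
  rw [ha] at hroot ⊢
  linear_combination (3 * N ^ 2 + N - 1 : ZMod (9 * N ^ 2 + 3 * N + 1)) * hroot
end
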